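/- Fix an integer d ≥ 3 and a nonzero integer a₀. There exist constants C > 0 and Ω > 0 such that for every integer N ≥ 2, the number of monic polynomials p ∈ ℤ[X] with natDegree p = d, fixed constant coefficient p.coeff 0 = a₀, and |p.coeff i| ≤ N for all 1 ≤ i ≤ d-1, whose Galois group is not the full symmetric group S_d — that is, for which it is not the case that p has d distinct complex roots and galActionHom is surjective — is at most C · N^{d-2} · (log N)^Ω. -/

import Mathlib

open Polynomial Polynomial.Gal

lemma crt_box {ι : Type} [Fintype ι] (q : ℕ) (hq : Squarefree q) (M : ι → ℕ)
    (S : (p : ℕ) → Set (ι → ZMod p)) (k : ℕ → ℕ)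
    (hS : ∀ p ∈ q.primeFactors, (S p).ncard ≤ k p) :
    {a : ι → ℤ | (∀ i, |a i| ≤ (M i : ℤ)) ∧ ∀ p ∈ q.primeFactors,
      (fun i => (a i : ZMod p)) ∈ S p}.Finite ∧
    (({a : ι → ℤ | (∀ i, |a i| ≤ (M i : ℤ)) ∧ ∀ p ∈ q.primeFactors,
      (fun i => (a i : ZMod p)) ∈ S p}.ncard : ℕ) : ℝ) ≤
      (∏ i, (2 * (M i : ℝ) / q + 2)) * ∏ p ∈ q.primeFactors, (k p : ℝ) := by
  classical
  have hq0 : q ≠ 0 := hq.ne_zero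
  have hqpos : (0 : ℤ) < q := by positivity
  set T := {a : ι → ℤ | (∀ i, |a i| ≤ (M i : ℤ)) ∧ ∀ p ∈ q.primeFactors,
      (fun i => (a i : ZMod p)) ∈ S p} with hT
  have hfin : ∀ p : q.primeFactors, (S p).Finite := fun p => by
    have : NeZero (p : ℕ) := ⟨(Nat.prime_of_mem_primeFactors p.2).ne_zero⟩
    exact Set.toFinite _
  let W : Finset ((ι → ℤ) × ((p : q.primeFactors) → (ι → ZMod p))) :=
    (Fintype.piFinset (fun i => Finset.Icc ((-(M i : ℤ)) / q) ((M i : ℤ) / q))) ×ˢ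
      (Fintype.piFinset (fun p : q.primeFactors => (hfin p).toFinset))
  let φ : (ι → ℤ) → ((ι → ℤ) × ((p : q.primeFactors) → (ι → ZMod p))) :=
    fun a => (fun i => a i / q, fun p i => (a i : ZMod p))
  have hmaps : ∀ a ∈ T, φ a ∈ (W : Set _) := by
    rintro a ⟨h1, h2⟩
    simp only [W, φ, Finset.coe_product, Set.mem_prod, Finset.mem_coe, Fintype.mem_piFinset,
      Finset.mem_Icc, Set.Finite.mem_toFinset]
    refine ⟨fun i => ?_, fun p => h2 p p.2⟩
    have := abs_le.mp (h1 i)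
    exact ⟨Int.ediv_le_ediv hqpos this.1, Int.ediv_le_ediv hqpos this.2⟩
  have hinj : Set.InjOn φ T := by
    intro a _ b _ hab
    simp only [φ, Prod.mk.injEq] at hab
    funext i
    have h1 : a i / q = b i / q := congrFun hab.1 i
    have h2 : (q : ℤ) ∣ a i - b i := by
      rw [← Nat.prod_primeFactors_of_squarefree hq]
      push_cast
      apply Finset.prod_dvd_of_coprime
      · intro x hx y hy hxy
        exact Nat.isCoprime_iff_coprime.mpr ((Nat.coprime_primes
          (Nat.prime_of_mem_primeFactors hx) (Nat.prime_of_mem_primeFactors hy)).mpr hxy)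
      · intro p hp
        have := congrFun (congrFun hab.2 ⟨p, hp⟩) i
        simp only at this
        apply (CharP.intCast_eq_zero_iff (ZMod p) p _).mp
        rw [Int.cast_sub, this, sub_self]
    have h3 : a i % q = b i % q := ((Int.modEq_iff_dvd).mpr h2).symm
    rw [← Int.mul_ediv_add_emod (a i) q, ← Int.mul_ediv_add_emod (b i) q, h1, h3]
  have hTfin : T.Finite := Set.Finite.of_injOn hmaps hinj W.finite_toSet
  refine ⟨hTfin, ?_⟩
  have hc : T.ncard ≤ W.card := by
    rw [← Set.ncard_coe_finset]
    exact Set.ncard_le_ncard_of_injOn φ hmaps hinj W.finite_toSet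
  have hW : (W.card : ℝ) ≤ (∏ i, (2 * (M i : ℝ) / q + 2)) * ∏ p ∈ q.primeFactors, (k p : ℝ) := by
    have hcW : W.card = (∏ i, (Finset.Icc ((-(M i : ℤ)) / q) ((M i : ℤ) / q)).card) *
        ∏ p : q.primeFactors, (hfin p).toFinset.card :=
      (Finset.card_product _ _).trans (congrArg₂ _ (Fintype.card_piFinset _)
        (Fintype.card_piFinset _))
    rw [hcW, Nat.cast_mul, Nat.cast_prod, Nat.cast_prod]
    refine mul_le_mul ?_ ?_ (Finset.prod_nonneg fun _ _ => Nat.cast_nonneg _)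
      (Finset.prod_nonneg fun _ _ => by positivity)
    · apply Finset.prod_le_prod (fun _ _ => Nat.cast_nonneg _)
      intro i _
      rw [Int.card_Icc]
      have h1 : (((M i : ℤ) / q : ℤ) : ℝ) ≤ (M i : ℝ) / q := by
        have := Int.ediv_mul_le (M i : ℤ) hqpos.ne'
        rw [le_div_iff₀ (by exact_mod_cast hqpos)]
        exact_mod_cast this
      have h2 : -(M i : ℝ) / q - 1 ≤ ((-(M i : ℤ)) / q : ℤ) := by
        have := Int.lt_ediv_add_one_mul_self (-(M i : ℤ)) hqpos
        rw [sub_le_iff_le_add, div_le_iff₀ (by exact_mod_cast hqpos)]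
        exact_mod_cast this.le
      have h3 : ((((M i : ℤ) / q + 1 - (-(M i : ℤ)) / q).toNat : ℤ) : ℝ) ≤
          2 * (M i : ℝ) / q + 2 := by
        rw [Int.toNat_of_nonneg]
        · have : 2 * (M i : ℝ) / q = (M i : ℝ) / q - (-(M i : ℝ) / q) := by ring
          rw [Int.cast_sub, Int.cast_add, Int.cast_one]
          linarith
        · have := Int.ediv_le_ediv hqpos (show -(M i : ℤ) ≤ M i by omega)
          omega
      exact_mod_cast h3
    · rw [← Finset.prod_attach q.primeFactors (fun p => (k p : ℝ))]
      apply Finset.prod_le_prod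
      · exact fun _ _ => Nat.cast_nonneg _
      · intro p _
        rw [← Set.ncard_eq_toFinset_card _ (hfin p)]
        exact_mod_cast hS p p.2
  exact le_trans (by exact_mod_cast hc) hW

lemma omega_sum (K N : ℕ) (hN : 1 ≤ N) :
    ∑ C ∈ (Finset.Icc 1 N).filter Squarefree, (K : ℝ) ^ C.primeFactors.card / C
      ≤ (1 + Real.log N) ^ K := by
  classical
  have hH : ∑ E ∈ Finset.Icc 1 N, (1 : ℝ) / E ≤ 1 + Real.log N := by
    have := harmonic_le_one_add_log N
    rw [harmonic_eq_sum_Icc] at this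
    push_cast at this
    simpa using this
  have hl : 0 ≤ Real.log N := Real.log_natCast_nonneg N
  induction K with
  | zero =>
    simp only [pow_zero]
    rw [Finset.sum_eq_single 1]
    · simp
    · intro C hC h1
      simp only [Finset.mem_filter, Finset.mem_Icc] at hC
      have : C.primeFactors.card ≠ 0 := by
        rw [Finset.card_ne_zero, Nat.nonempty_primeFactors]
        omega
      simp [this]
    · intro h; exact absurd h (by simp [hN])
  | succ K ih =>
    have key : ∀ C ∈ (Finset.Icc 1 N).filter Squarefree,
        ((K + 1 : ℕ) : ℝ) ^ C.primeFactors.card / C ≤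
        ∑ x ∈ C.divisorsAntidiagonal,
          ((K : ℝ) ^ x.1.primeFactors.card / x.1) * (1 / x.2) := by
      intro C hC
      simp only [Finset.mem_filter, Finset.mem_Icc] at hC
      have hC0 : C ≠ 0 := by omega
      have h1 : ((K + 1 : ℕ) : ℝ) ^ C.primeFactors.card =
          ∑ t ∈ C.primeFactors.powerset, (K : ℝ) ^ t.card := by
        have := Finset.sum_pow_mul_eq_add_pow (K : ℝ) 1 C.primeFactors
        simp only [one_pow, mul_one] at this
        rw [this]; push_cast; ring
      have hpf : ∀ t ∈ C.primeFactors.powerset, (∏ p ∈ t, p).primeFactors = t := by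
        intro t ht
        exact Nat.primeFactors_prod fun p hp =>
          Nat.prime_of_mem_primeFactors (Finset.mem_powerset.mp ht hp)
      have hdv : ∀ t ∈ C.primeFactors.powerset, (∏ p ∈ t, p) ∣ C := by
        intro t ht
        calc _ ∣ ∏ p ∈ C.primeFactors, p := Finset.prod_dvd_prod_of_subset _ _ _
                (Finset.mem_powerset.mp ht)
          _ ∣ C := Nat.prod_primeFactors_dvd C
      rw [h1, Finset.sum_div]
      have e1 : ∑ t ∈ C.primeFactors.powerset, (K : ℝ) ^ t.card / C =
          ∑ t ∈ C.primeFactors.powerset, (fun x : ℕ × ℕ =>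
            ((K : ℝ) ^ x.1.primeFactors.card / x.1) * (1 / x.2)) (∏ p ∈ t, p, C / ∏ p ∈ t, p) := by
        apply Finset.sum_congr rfl
        intro t ht
        simp only [hpf t ht]
        have h2 : ((∏ p ∈ t, p : ℕ) : ℝ) * ((C / ∏ p ∈ t, p : ℕ) : ℝ) = C := by
          exact_mod_cast Nat.mul_div_cancel' (hdv t ht)
        rw [div_mul_div_comm, mul_one, h2]
      rw [e1]
      rw [← Finset.sum_image (f := fun x : ℕ × ℕ =>
            ((K : ℝ) ^ x.1.primeFactors.card / x.1) * (1 / x.2))]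
      · apply Finset.sum_le_sum_of_subset_of_nonneg
        · intro x hx
          simp only [Finset.mem_image] at hx
          obtain ⟨t, ht, rfl⟩ := hx
          simp only [Nat.mem_divisorsAntidiagonal]
          exact ⟨Nat.mul_div_cancel' (hdv t ht), hC0⟩
        · intros; positivity
      · intro t ht t' ht' h
        simp only [Prod.mk.injEq] at h
        rw [← hpf t ht, ← hpf t' ht', h.1]
    calc _ ≤ ∑ C ∈ (Finset.Icc 1 N).filter Squarefree, ∑ x ∈ C.divisorsAntidiagonal,
          ((K : ℝ) ^ x.1.primeFactors.card / x.1) * (1 / x.2) := Finset.sum_le_sum key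
      _ ≤ ∑ x ∈ ((Finset.Icc 1 N).filter Squarefree) ×ˢ (Finset.Icc 1 N),
          ((K : ℝ) ^ x.1.primeFactors.card / x.1) * (1 / x.2) := by
        rw [← Finset.sum_biUnion]
        · apply Finset.sum_le_sum_of_subset_of_nonneg
          · intro x hx
            simp only [Finset.mem_biUnion, Finset.mem_filter, Finset.mem_Icc,
              Nat.mem_divisorsAntidiagonal, Finset.mem_product] at *
            obtain ⟨C, ⟨⟨h1, h2⟩, h3⟩, h4, h5⟩ := hx
            have a1 : 0 < x.1 := Nat.pos_of_ne_zero (by rintro h; simp [h] at h4; omega)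
            have a2 : 0 < x.2 := Nat.pos_of_ne_zero (by rintro h; simp [h] at h4; omega)
            refine ⟨⟨⟨a1, ?_⟩, ?_⟩, a2, ?_⟩
            · exact le_trans (Nat.le_of_dvd (by omega) ⟨_, h4.symm⟩) h2
            · exact h3.squarefree_of_dvd ⟨_, h4.symm⟩
            · exact le_trans (Nat.le_of_dvd (by omega) ⟨_, h4.symm.trans (mul_comm _ _)⟩) h2
          · intros; positivity
        · intro C _ C' _ hne
          simp only [Function.onFun, Finset.disjoint_left, Nat.mem_divisorsAntidiagonal]
          rintro x ⟨h1, _⟩ ⟨h2, _⟩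
          exact hne (h1.symm.trans h2)
      _ = (∑ C ∈ (Finset.Icc 1 N).filter Squarefree, (K : ℝ) ^ C.primeFactors.card / C) *
          ∑ E ∈ Finset.Icc 1 N, (1 : ℝ) / E := by
        rw [Finset.sum_product, Finset.sum_mul_sum]
      _ ≤ (1 + Real.log N) ^ K * (1 + Real.log N) := by
        gcongr
      _ = _ := by rw [pow_succ]

lemma exists_small_subset (N s A : ℕ) (P : Finset ℕ) (hP : ∀ p ∈ P, 1 ≤ p)
    (hcard : (A + 1) * s ≤ P.card) (hprod : ∏ p ∈ P, p ≤ N ^ (A + 1)) :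
    ∃ T ⊆ P, T.card = s ∧ ∏ p ∈ T, p ≤ N := by
  classical
  induction A generalizing P with
  | zero =>
    obtain ⟨T, hT, hs⟩ := Finset.exists_subset_card_eq (show s ≤ P.card by omega)
    refine ⟨T, hT, hs, le_trans ?_ (by simpa using hprod)⟩
    exact Finset.prod_le_prod_of_subset_of_one_le' hT fun p hp _ => hP p hp
  | succ A ih =>
    obtain ⟨T, hT, hs⟩ := Finset.exists_subset_card_eq (show s ≤ P.card by nlinarith)
    by_cases h : ∏ p ∈ T, p ≤ N
    · exact ⟨T, hT, hs, h⟩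
    · push Not at h
      obtain ⟨T', h1, h2, h3⟩ := ih (P \ T) (fun p hp => hP p (Finset.mem_sdiff.mp hp).1)
        (by rw [Finset.card_sdiff_of_subset hT, hs]; apply Nat.le_sub_of_add_le; linarith)
        (by
          have := Finset.prod_sdiff hT (f := fun p => p)
          by_contra hc
          push Not at hc
          have : N ^ (A + 1) * N < (∏ p ∈ P \ T, p) * ∏ p ∈ T, p := by
            apply Nat.mul_lt_mul'' hc h
          rw [← pow_succ] at this
          omega)
      exact ⟨T', h1.trans Finset.sdiff_subset, h2, h3⟩

lemma pow_omega_le (K A N m : ℕ) (hK : 1 ≤ K) (hm : m ≠ 0) (hmN : m ≤ N ^ (A + 1)) :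
    (K : ℝ) ^ m.primeFactors.card ≤ (K : ℝ) ^ (A + 1) *
      ∑ q ∈ ((Finset.Icc 1 N).filter Squarefree).filter (· ∣ m),
        ((K ^ (A + 1) : ℕ) : ℝ) ^ q.primeFactors.card := by
  classical
  obtain ⟨T, hT, hs, hle⟩ := exists_small_subset N (m.primeFactors.card / (A + 1)) A m.primeFactors
    (fun p hp => (Nat.prime_of_mem_primeFactors hp).one_le) (Nat.mul_div_le _ _)
    ((Nat.le_of_dvd (by omega) (Nat.prod_primeFactors_dvd m)).trans hmN)
  have hTp : ∀ p ∈ T, p.Prime := fun p hp => Nat.prime_of_mem_primeFactors (hT hp)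
  have hpf := Nat.primeFactors_prod hTp
  have hdv : (∏ p ∈ T, p) ∣ m :=
    (Finset.prod_dvd_prod_of_subset _ _ _ hT).trans (Nat.prod_primeFactors_dvd m)
  have hsq : Squarefree (∏ p ∈ T, p) := by
    apply Finset.squarefree_prod_of_pairwise_isCoprime
    · intro x hx y hy hxy
      exact Nat.coprime_iff_isRelPrime.mp ((Nat.coprime_primes (hTp x hx) (hTp y hy)).mpr hxy)
    · exact fun p hp => (hTp p hp).squarefree
  have hmem : (∏ p ∈ T, p) ∈ ((Finset.Icc 1 N).filter Squarefree).filter (· ∣ m) := by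
    simp only [Finset.mem_filter, Finset.mem_Icc]
    exact ⟨⟨⟨Nat.pos_of_ne_zero hsq.ne_zero, hle⟩, hsq⟩, hdv⟩
  have h1 := Finset.single_le_sum (f := fun q : ℕ => ((K ^ (A + 1) : ℕ) : ℝ) ^ q.primeFactors.card)
    (fun _ _ => by positivity) hmem
  refine le_trans ?_ (mul_le_mul_of_nonneg_left h1 (by positivity))
  simp only [hpf, hs]
  push_cast
  rw [← pow_mul, ← pow_add]
  apply pow_le_pow_right₀ (by exact_mod_cast hK)
  have := Nat.lt_mul_div_succ m.primeFactors.card (show 0 < A + 1 by omega)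
  linarith

lemma zeros_card {R : Type} [CommRing R] [IsDomain R] [DecidableEq R] {n : ℕ} (hn : 1 ≤ n)
    (F : MvPolynomial (Fin n) R) (hF : F ≠ 0) (S : Finset R) :
    ((Fintype.piFinset (fun _ : Fin n => S)).filter (fun a => MvPolynomial.eval a F = 0)).card
      ≤ F.totalDegree * S.card ^ (n - 1) := by
  rcases S.eq_empty_or_nonempty with rfl | hS
  · have : (Fintype.piFinset (fun _ : Fin n => (∅ : Finset R))) = ∅ := by
      rw [Fintype.piFinset_eq_empty]; exact ⟨⟨0, hn⟩, rfl⟩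
    simp [this]
  · have := MvPolynomial.schwartz_zippel_totalDegree hF S
    have hc : (0 : ℚ≥0) < S.card := by exact_mod_cast hS.card_pos
    rw [div_le_div_iff₀ (by positivity) hc] at this
    have h2 : S.card ^ n = S.card ^ (n - 1) * S.card := by
      rw [← pow_succ, Nat.sub_add_cancel hn]
    have h3 : ((Fintype.piFinset (fun _ : Fin n => S)).filter
        (fun a => MvPolynomial.eval a F = 0)).card * S.card ≤ F.totalDegree * S.card ^ n := by
      exact_mod_cast this
    rw [h2, ← mul_assoc] at h3
    exact Nat.le_of_mul_le_mul_right h3 hS.card_pos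

lemma zeros_mod {n : ℕ} (hn : 1 ≤ n) (F : MvPolynomial (Fin n) ℤ) (hF : F ≠ 0) :
    ∃ H : ℕ, ∀ p : ℕ, p.Prime → {x : Fin n → ZMod p |
      MvPolynomial.eval x (MvPolynomial.map (Int.castRingHom (ZMod p)) F) = 0}.ncard
        ≤ H * p ^ (n - 1) := by
  classical
  obtain ⟨m, hm⟩ := MvPolynomial.ne_zero_iff.mp hF
  refine ⟨F.totalDegree + (F.coeff m).natAbs, fun p hp => ?_⟩
  have : Fact p.Prime := ⟨hp⟩
  by_cases h : (p : ℤ) ∣ F.coeff m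
  · have h1 : p ≤ (F.coeff m).natAbs := Nat.le_of_dvd (by simpa using hm)
      (by simpa using Int.natAbs_dvd_natAbs.mpr h)
    calc _ ≤ (Set.univ : Set (Fin n → ZMod p)).ncard :=
          Set.ncard_le_ncard (Set.subset_univ _) (Set.toFinite _)
      _ = p ^ n := by simp [Set.ncard_univ]
      _ = p * p ^ (n - 1) := by rw [← pow_succ', Nat.sub_add_cancel hn]
      _ ≤ _ := Nat.mul_le_mul_right _ (by omega)
  · have h0 : MvPolynomial.map (Int.castRingHom (ZMod p)) F ≠ 0 := by
      rw [MvPolynomial.ne_zero_iff]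
      refine ⟨m, ?_⟩
      rw [MvPolynomial.coeff_map]
      intro h2
      exact h ((CharP.intCast_eq_zero_iff (ZMod p) p _).mp (by simpa using h2))
    have h1 := zeros_card hn _ h0 (Finset.univ : Finset (ZMod p))
    rw [Finset.card_univ, ZMod.card] at h1
    have h2 : (MvPolynomial.map (Int.castRingHom (ZMod p)) F).totalDegree ≤ F.totalDegree :=
      Finset.sup_mono (MvPolynomial.support_map_subset _ _)
    calc _ = _ := by
          rw [← Set.ncard_coe_finset]
          congr 1
          ext x
          simp
      _ ≤ _ := h1
      _ ≤ _ := Nat.mul_le_mul_right _ (by omega)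

lemma eval_bound {n : ℕ} (F : MvPolynomial (Fin n) ℤ) :
    ∃ A : ℕ, ∀ N : ℕ, 2 ≤ N → ∀ a : Fin n → ℤ, (∀ i, |a i| ≤ (N : ℤ)) →
      (MvPolynomial.eval a F).natAbs ≤ N ^ (A + 1) := by
  classical
  refine ⟨(∑ m ∈ F.support, (F.coeff m).natAbs) + F.totalDegree, fun N hN a ha => ?_⟩
  have h1 : (MvPolynomial.eval a F).natAbs ≤
      (∑ m ∈ F.support, (F.coeff m).natAbs) * N ^ F.totalDegree := by
    rw [MvPolynomial.eval_eq', Finset.sum_mul]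
    zify
    refine (Finset.abs_sum_le_sum_abs _ _).trans (Finset.sum_le_sum fun m hm => ?_)
    rw [abs_mul, Finset.abs_prod]
    gcongr
    calc ∏ i, |a i ^ m i| ≤ ∏ i, (N : ℤ) ^ m i := by
          apply Finset.prod_le_prod (fun _ _ => abs_nonneg _)
          intro i _
          rw [abs_pow]
          exact pow_le_pow_left₀ (abs_nonneg _) (ha i) _
      _ = (N : ℤ) ^ (∑ i, m i) := Finset.prod_pow_eq_pow_sum _ _ _
      _ ≤ _ := by
        apply pow_le_pow_right₀ (by omega)
        have := MvPolynomial.le_totalDegree hm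
        rwa [Finsupp.sum_fintype _ _ (by simp)] at this
  set H := ∑ m ∈ F.support, (F.coeff m).natAbs
  calc _ ≤ _ := h1
    _ ≤ N ^ H * N ^ F.totalDegree := Nat.mul_le_mul_right _
        ((Nat.lt_two_pow_self).le.trans (Nat.pow_le_pow_left hN _))
    _ = N ^ (H + F.totalDegree) := (pow_add _ _ _).symm
    _ ≤ _ := Nat.pow_le_pow_right (by omega) (by omega)

/-- box in `ℤ^n` -/
noncomputable def ibox (n N : ℕ) : Finset (Fin n → ℤ) :=
  Fintype.piFinset (fun _ => Finset.Icc (-(N : ℤ)) N)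

lemma mem_ibox {n N : ℕ} {a : Fin n → ℤ} : a ∈ ibox n N ↔ ∀ i, |a i| ≤ (N : ℤ) := by
  simp [ibox, Fintype.mem_piFinset, abs_le]

lemma omega_box {n : ℕ} (hn : 1 ≤ n) (F : MvPolynomial (Fin n) ℤ) (hF : F ≠ 0) (K : ℕ)
    (hK : 1 ≤ K) : ∃ C : ℝ, 0 < C ∧ ∃ Ω : ℕ, ∀ N : ℕ, 2 ≤ N →
      ∑ a ∈ (ibox n N).filter (fun a => MvPolynomial.eval a F ≠ 0),
        (K : ℝ) ^ (MvPolynomial.eval a F).natAbs.primeFactors.card ≤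
      C * (N : ℝ) ^ n * (1 + Real.log N) ^ Ω := by
  classical
  obtain ⟨H, hH⟩ := zeros_mod hn F hF
  obtain ⟨A, hA⟩ := eval_bound F
  set L := K ^ (A + 1) with hL
  refine ⟨(K : ℝ) ^ (A + 1) * 4 ^ n, by positivity, L * H, fun N hN => ?_⟩
  set Q := (Finset.Icc 1 N).filter Squarefree with hQ
  have hNpos : (0 : ℝ) < N := by positivity
  calc _ ≤ ∑ a ∈ (ibox n N).filter (fun a => MvPolynomial.eval a F ≠ 0), (K : ℝ) ^ (A + 1) *
        ∑ q ∈ Q.filter (· ∣ (MvPolynomial.eval a F).natAbs), (L : ℝ) ^ q.primeFactors.card := by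
        apply Finset.sum_le_sum
        intro a ha
        rw [Finset.mem_filter] at ha
        exact pow_omega_le K A N _ hK (by simpa using ha.2) (hA N hN a (mem_ibox.mp ha.1))
    _ = (K : ℝ) ^ (A + 1) * ∑ q ∈ Q, ∑ a ∈ ((ibox n N).filter
          (fun a => MvPolynomial.eval a F ≠ 0)).filter
            (fun a => q ∣ (MvPolynomial.eval a F).natAbs), (L : ℝ) ^ q.primeFactors.card := by
        rw [← Finset.mul_sum]
        congr 1
        simp_rw [Finset.sum_filter (p := fun q => q ∣ _)]
        rw [Finset.sum_comm]
        simp_rw [Finset.sum_filter (p := fun a : Fin n → ℤ => _ ∣ _)]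
    _ ≤ (K : ℝ) ^ (A + 1) * ∑ q ∈ Q, (4 * N) ^ n * (((L * H : ℕ) : ℝ) ^ q.primeFactors.card / q) := by
        gcongr with q hq
        rw [Finset.sum_const, nsmul_eq_mul]
        simp only [hQ, Finset.mem_filter, Finset.mem_Icc] at hq
        have hq0 : (0 : ℝ) < q := by exact_mod_cast hq.1.1
        have hb := crt_box q hq.2 (fun _ : Fin n => N) (fun p => {x : Fin n → ZMod p |
          MvPolynomial.eval x (MvPolynomial.map (Int.castRingHom (ZMod p)) F) = 0})
          (fun p => H * p ^ (n - 1)) (fun p hp => hH p (Nat.prime_of_mem_primeFactors hp))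
        have hc : ((((ibox n N).filter (fun a => MvPolynomial.eval a F ≠ 0)).filter
            (fun a => q ∣ (MvPolynomial.eval a F).natAbs)).card : ℝ) ≤
            (4 * N / q) ^ n * (H ^ q.primeFactors.card * q ^ (n - 1)) := by
          rw [← Set.ncard_coe_finset]
          refine le_trans (Nat.cast_le.mpr (Set.ncard_le_ncard ?_ hb.1)) (hb.2.trans ?_)
          · intro a ha
            simp only [Finset.coe_filter, Finset.mem_filter, Set.mem_ofPred_eq, mem_ibox] at ha
            refine ⟨ha.1.1, fun p hp => ?_⟩
            have h1 : (p : ℤ) ∣ MvPolynomial.eval a F := Int.natCast_dvd.mpr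
              ((Nat.dvd_of_mem_primeFactors hp).trans ha.2)
            have h2 := (CharP.intCast_eq_zero_iff (ZMod p) p _).mpr h1
            simp only [Set.mem_ofPred_eq]
            rw [MvPolynomial.eval_map, ← h2]
            have := MvPolynomial.eval₂_comp_left (Int.castRingHom (ZMod p)) (RingHom.id ℤ) a F
            simp only [RingHom.comp_id] at this
            rw [MvPolynomial.eval, MvPolynomial.eval₂Hom]
            exact this.symm
          · rw [Finset.prod_const, Finset.card_univ, Fintype.card_fin]
            push_cast
            rw [Finset.prod_mul_distrib, Finset.prod_const, Finset.prod_pow]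
            have : (∏ p ∈ q.primeFactors, (p : ℝ)) = q := by
              rw [← Nat.cast_prod, Nat.prod_primeFactors_of_squarefree hq.2]
            rw [this]
            gcongr
            have : (1 : ℝ) ≤ N / q := by
              rw [one_le_div hq0]; exact_mod_cast hq.1.2
            rw [mul_div_assoc, mul_div_assoc]
            linarith
        calc _ ≤ (4 * N / q) ^ n * (H ^ q.primeFactors.card * q ^ (n - 1)) *
              (L : ℝ) ^ q.primeFactors.card := by gcongr
          _ = _ := by
            push_cast
            rw [div_pow, mul_pow (L : ℝ)]
            have : (q : ℝ) ^ n = q ^ (n - 1) * q := by rw [← pow_succ, Nat.sub_add_cancel hn]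
            rw [this]
            field_simp
    _ = (K : ℝ) ^ (A + 1) * ((4 * N) ^ n * ∑ q ∈ Q, ((L * H : ℕ) : ℝ) ^ q.primeFactors.card / q) := by
        congr 1; rw [Finset.mul_sum]
    _ ≤ (K : ℝ) ^ (A + 1) * ((4 * N) ^ n * (1 + Real.log N) ^ (L * H)) := by
        gcongr
        exact omega_sum (L * H) N (by omega)
    _ = _ := by rw [mul_pow]; ring

/-- sets of size `O(N^k log^Ω)` -/
def LB {X : Type} (k : ℕ) (F : ℕ → Set X) : Prop :=
  ∃ C : ℝ, 0 < C ∧ ∃ Ω : ℕ, ∀ N : ℕ, 2 ≤ N →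
    (F N).Finite ∧ ((F N).ncard : ℝ) ≤ C * (N : ℝ) ^ k * (1 + Real.log N) ^ Ω

lemma one_le_log' {N : ℕ} (hN : 2 ≤ N) : (1 : ℝ) ≤ 1 + Real.log N := by
  have := Real.log_nonneg (x := N) (by exact_mod_cast (by omega : 1 ≤ N))
  linarith

lemma LB.mono {X : Type} {k : ℕ} {F G : ℕ → Set X} (h : LB k G)
    (hs : ∀ N, 2 ≤ N → F N ⊆ G N) : LB k F := by
  obtain ⟨C, hC, Ω, h⟩ := h
  refine ⟨C, hC, Ω, fun N hN => ⟨(h N hN).1.subset (hs N hN), le_trans ?_ (h N hN).2⟩⟩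
  exact_mod_cast Set.ncard_le_ncard (hs N hN) (h N hN).1

lemma LB.union {X : Type} {k : ℕ} {F G : ℕ → Set X} (h : LB k F) (h' : LB k G) :
    LB k (fun N => F N ∪ G N) := by
  obtain ⟨C, hC, Ω, h⟩ := h
  obtain ⟨C', hC', Ω', h'⟩ := h'
  refine ⟨C + C', by positivity, Ω + Ω', fun N hN => ⟨(h N hN).1.union (h' N hN).1, ?_⟩⟩
  have h1 := one_le_log' hN
  have e1 : (1 + Real.log N) ^ Ω ≤ (1 + Real.log N) ^ (Ω + Ω') := pow_le_pow_right₀ h1 (by omega)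
  have e2 : (1 + Real.log N) ^ Ω' ≤ (1 + Real.log N) ^ (Ω + Ω') := pow_le_pow_right₀ h1 (by omega)
  calc ((F N ∪ G N).ncard : ℝ) ≤ (F N).ncard + (G N).ncard := by
        exact_mod_cast Set.ncard_union_le _ _
    _ ≤ C * (N : ℝ) ^ k * (1 + Real.log N) ^ Ω + C' * (N : ℝ) ^ k * (1 + Real.log N) ^ Ω' :=
        add_le_add (h N hN).2 (h' N hN).2
    _ ≤ C * (N : ℝ) ^ k * (1 + Real.log N) ^ (Ω + Ω')
        + C' * (N : ℝ) ^ k * (1 + Real.log N) ^ (Ω + Ω') := by gcongr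
    _ = _ := by ring

lemma LB.iUnion {X ι : Type} {k : ℕ} (s : Finset ι) {F : ι → ℕ → Set X}
    (h : ∀ i ∈ s, LB k (F i)) : LB k (fun N => ⋃ i ∈ s, F i N) := by
  classical
  induction s using Finset.induction_on with
  | empty => exact ⟨1, one_pos, 0, fun N _ => by simp⟩
  | insert a s ha ih =>
    have := (h a (by simp)).union (ih (fun i hi => h i (by simp [hi])))
    refine this.mono (fun N _ => ?_)
    rw [Finset.set_biUnion_insert]

lemma ncard_fib {X Y : Type} {S : Set X} (φ : X → Y) {I : Set Y} (hI : I.Finite) {B : ℝ}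
    (hφ : ∀ x ∈ S, φ x ∈ I)
    (hB : ∀ y ∈ I, {x ∈ S | φ x = y}.Finite ∧ ({x ∈ S | φ x = y}.ncard : ℝ) ≤ B) :
    S.Finite ∧ (S.ncard : ℝ) ≤ I.ncard * B := by
  classical
  have hS : S = ⋃ y ∈ hI.toFinset, {x ∈ S | φ x = y} := by
    ext x
    simp only [Set.Finite.mem_toFinset, Set.mem_iUnion, exists_prop]
    exact ⟨fun h => ⟨φ x, hφ x h, h, rfl⟩, fun ⟨_, _, h, _⟩ => h⟩
  have hfin : S.Finite := by
    rw [hS]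
    exact Set.Finite.biUnion hI.toFinset.finite_toSet
      (fun y hy => (hB y (by simpa using hy)).1)
  refine ⟨hfin, ?_⟩
  have h1 : S.ncard ≤ ∑ y ∈ hI.toFinset, {x ∈ S | φ x = y}.ncard := by
    conv_lhs => rw [hS]
    exact Finset.set_ncard_biUnion_le _ _
  calc (S.ncard : ℝ) ≤ ∑ y ∈ hI.toFinset, ({x ∈ S | φ x = y}.ncard : ℝ) := by exact_mod_cast h1
    _ ≤ ∑ y ∈ hI.toFinset, B := Finset.sum_le_sum (fun y hy => (hB y (by simpa using hy)).2)
    _ = _ := by rw [Finset.sum_const, nsmul_eq_mul, Set.ncard_eq_toFinset_card _ hI]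

/-- relational version -/
lemma ncard_rel {X Y : Type} {S : Set X} (R : X → Y → Prop) {I : Set Y} (hI : I.Finite) {B : ℝ}
    (hφ : ∀ x ∈ S, ∃ y ∈ I, R x y)
    (hB : ∀ y ∈ I, {x ∈ S | R x y}.Finite ∧ ({x ∈ S | R x y}.ncard : ℝ) ≤ B) :
    S.Finite ∧ (S.ncard : ℝ) ≤ I.ncard * B := by
  classical
  rcases S.eq_empty_or_nonempty with rfl | ⟨x0, hx0⟩
  · simp only [Set.finite_empty, Set.ncard_empty, Nat.cast_zero, true_and]
    rcases I.eq_empty_or_nonempty with rfl | ⟨y, hy⟩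
    · simp
    · have := (hB y hy).2
      exact mul_nonneg (Nat.cast_nonneg _) (le_trans (Nat.cast_nonneg _) this)
  obtain ⟨y0, _⟩ := hφ x0 hx0
  have : ∀ x, ∃ y, x ∈ S → y ∈ I ∧ R x y := fun x => by
    by_cases hx : x ∈ S
    · obtain ⟨y, hy, hr⟩ := hφ x hx
      exact ⟨y, fun _ => ⟨hy, hr⟩⟩
    · exact ⟨y0, fun h => absurd h hx⟩
  choose φ h using this
  refine ncard_fib φ hI (fun x hx => (h x hx).1) (fun y hy => ?_)
  have hsub : {x ∈ S | φ x = y} ⊆ {x ∈ S | R x y} := fun x hx => ⟨hx.1, hx.2 ▸ (h x hx.1).2⟩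
  refine ⟨(hB y hy).1.subset hsub, le_trans ?_ (hB y hy).2⟩
  exact_mod_cast Set.ncard_le_ncard hsub (hB y hy).1

/-- finite boxes of integer vectors -/
lemma ncard_pi_le {ι Y : Type} [Fintype ι] (S : ι → Set Y) (hS : ∀ i, (S i).Finite) :
    {v : ι → Y | ∀ i, v i ∈ S i}.Finite ∧ {v : ι → Y | ∀ i, v i ∈ S i}.ncard = ∏ i, (S i).ncard := by
  classical
  have : {v : ι → Y | ∀ i, v i ∈ S i} = ↑(Fintype.piFinset (fun i => (hS i).toFinset)) := by
    ext v; simp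
  rw [this]
  refine ⟨Finset.finite_toSet _, ?_⟩
  rw [Set.ncard_coe_finset, Fintype.card_piFinset]
  exact Finset.prod_congr rfl (fun i _ => (Set.ncard_eq_toFinset_card _ (hS i)).symm)

lemma int_interval (x y : ℝ) (h : x ≤ y) : {n : ℤ | x ≤ n ∧ (n : ℝ) ≤ y}.Finite ∧
    ({n : ℤ | x ≤ n ∧ (n : ℝ) ≤ y}.ncard : ℝ) ≤ y - x + 1 := by
  have : {n : ℤ | x ≤ n ∧ (n : ℝ) ≤ y} = ↑(Finset.Icc ⌈x⌉ ⌊y⌋) := by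
    ext n; simp [Int.ceil_le, Int.le_floor]
  rw [this]
  refine ⟨Finset.finite_toSet _, ?_⟩
  rw [Set.ncard_coe_finset, Int.card_Icc]
  have h1 := Int.floor_le y
  have h2 := Int.le_ceil x
  by_cases h3 : 0 ≤ ⌊y⌋ + 1 - ⌈x⌉
  · have : (((⌊y⌋ + 1 - ⌈x⌉).toNat : ℤ) : ℝ) = ⌊y⌋ + 1 - ⌈x⌉ := by
      rw [Int.toNat_of_nonneg h3]; push_cast; ring
    have h4 : (((⌊y⌋ + 1 - ⌈x⌉).toNat : ℕ) : ℝ) = ⌊y⌋ + 1 - ⌈x⌉ := by exact_mod_cast this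
    rw [h4]; linarith
  · rw [Int.toNat_eq_zero.mpr (by omega)]
    simp; linarith

open NumberField in
/-- counting algebraic integers in a box -/
lemma nf_box (K : Type) [Field K] [NumberField K] (M : (K →+* ℂ) → ℝ) (hM : ∀ σ, 1 ≤ M σ) :
    {β : 𝓞 K | ∀ σ : K →+* ℂ, ‖σ β‖ ≤ M σ}.Finite ∧
    ({β : 𝓞 K | ∀ σ : K →+* ℂ, ‖σ β‖ ≤ M σ}.ncard : ℝ) ≤ ∏ σ, (12 * M σ) := by
  classical
  have hI := ncard_pi_le (ι := K →+* ℂ) (fun σ => {n : ℤ | (-(4 * M σ) - 1 : ℝ) ≤ n ∧ (n : ℝ) ≤ 4 * M σ})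
    (fun σ => (int_interval _ _ (by linarith [hM σ])).1)
  have key := ncard_fib (S := {β : 𝓞 K | ∀ σ : K →+* ℂ, ‖σ β‖ ≤ M σ})
    (fun β σ => ⌊2 * ((σ β).re + (σ β).im)⌋) hI.1 (B := 1) ?_ ?_
  · refine ⟨key.1, key.2.trans ?_⟩
    rw [mul_one, hI.2]
    push_cast
    refine Finset.prod_le_prod (fun _ _ => Nat.cast_nonneg _) (fun σ _ => ?_)
    refine ((int_interval _ _ (by linarith [hM σ])).2).trans ?_
    linarith [hM σ]
  · intro β hβ σ
    have h1 := hβ σ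
    have h2 := (abs_le.mp ((Complex.abs_re_le_norm (σ β)).trans h1))
    have h3 := (abs_le.mp ((Complex.abs_im_le_norm (σ β)).trans h1))
    have h4 := Int.floor_le (2 * ((σ β).re + (σ β).im))
    have h5 := Int.lt_floor_add_one (2 * ((σ β).re + (σ β).im))
    refine ⟨by linarith, by linarith⟩
  · intro v _
    have hsub : ({x ∈ {β : 𝓞 K | ∀ σ : K →+* ℂ, ‖σ β‖ ≤ M σ} |
        (fun σ : K →+* ℂ => ⌊2 * ((σ x).re + (σ x).im)⌋) = v}).Subsingleton := by
      intro a ha b hb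
      by_contra hab
      have hlt : ∀ σ : K →+* ℂ, |((σ (a - b : K)).re + (σ (a - b : K)).im)| < 1 / 2 := by
        intro σ
        have e : ⌊2 * ((σ a).re + (σ a).im)⌋ = ⌊2 * ((σ b).re + (σ b).im)⌋ :=
          congrFun (ha.2.trans hb.2.symm) σ
        have := Int.abs_sub_lt_one_of_floor_eq_floor e
        rw [map_sub, Complex.sub_re, Complex.sub_im]
        rw [abs_lt] at this ⊢
        constructor <;> linarith [this.1, this.2]
      have hnorm : ∀ σ : K →+* ℂ, ‖σ (a - b : K)‖ < 1 := by
        intro σ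
        have h1 := abs_lt.mp (hlt σ)
        have h2 := abs_lt.mp (hlt (ComplexEmbedding.conjugate σ))
        simp only [ComplexEmbedding.conjugate_coe_eq, Complex.conj_re, Complex.conj_im] at h2
        set z := σ (a - b : K)
        have : ‖z‖ ^ 2 < 1 := by
          rw [Complex.sq_norm, Complex.normSq_apply]
          have hr : |z.re| < 1 / 2 := by rw [abs_lt]; constructor <;> linarith [h1.1, h1.2, h2.1, h2.2]
          have hi : |z.im| < 1 / 2 := by rw [abs_lt]; constructor <;> linarith [h1.1, h1.2, h2.1, h2.2]
          rw [abs_lt] at hr hi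
          nlinarith [hr.1, hr.2, hi.1, hi.2]
        nlinarith [norm_nonneg z]
      have hne : (a - b : 𝓞 K) ≠ 0 := sub_ne_zero.mpr hab
      obtain ⟨σ, hσ⟩ := exists_conjugate_one_le_norm hne
      exact absurd (hnorm σ) (not_lt.mpr (by simpa using hσ))
    exact ⟨hsub.finite, by exact_mod_cast (Set.ncard_le_one hsub.finite).mpr (fun a ha b hb => hsub ha hb)⟩

open NumberField in
lemma nf_norm (K : Type) [Field K] [NumberField K] (x : K) :
    ∏ σ : K →+* ℂ, ‖σ x‖ = |(Algebra.norm ℚ x : ℚ)| := by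
  have := congr_arg (‖·‖) (Algebra.norm_eq_prod_embeddings ℚ ℂ x)
  simp only [eq_ratCast, Complex.norm_ratCast, norm_prod] at this
  rw [Rat.cast_abs, this]
  exact (Fintype.prod_equiv (RingHom.equivRatAlgHom K ℂ) _ _ (fun σ => rfl))

open NumberField in
lemma nf_norm' (K : Type) [Field K] [NumberField K] (x : 𝓞 K) :
    ∏ σ : K →+* ℂ, ‖σ x‖ = ((Algebra.norm ℤ x).natAbs : ℝ) := by
  rw [nf_norm, ← Algebra.coe_norm_int]
  rw [Nat.cast_natAbs]
  push_cast
  rfl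

open NumberField in
lemma nf_dvd_norm (K : Type) [Field K] [NumberField K] (x : 𝓞 K) :
    x ∣ ((Algebra.norm ℤ x).natAbs : 𝓞 K) := by
  have := Ideal.absNorm_mem (Ideal.span {x})
  rwa [Ideal.mem_span_singleton, Ideal.absNorm_span_singleton] at this

open NumberField in
/-- counting elements of given norm -/
lemma nf_U (K : Type) [Field K] [NumberField K] (n : ℕ) (hn : 1 ≤ n) (X : ℝ) (hX : 1 ≤ X) (d : ℕ)
    (hd : Module.finrank ℚ K = d) :
    {α : 𝓞 K | (Algebra.norm ℤ α).natAbs = n ∧ ∀ σ : K →+* ℂ, ‖σ α‖ ≤ X}.Finite ∧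
    ({α : 𝓞 K | (Algebra.norm ℤ α).natAbs = n ∧ ∀ σ : K →+* ℂ, ‖σ α‖ ≤ X}.ncard : ℝ) ≤
      (d * Real.log X + 2) ^ d * ((n : ℝ) ^ d * (12 * Real.exp 1) ^ d) := by
  classical
  have hlog : 0 ≤ Real.log X := Real.log_nonneg hX
  have hcard : Fintype.card (K →+* ℂ) = d := by rw [NumberField.Embeddings.card, hd]
  have hne : ∀ α : 𝓞 K, (Algebra.norm ℤ α).natAbs = n → α ≠ 0 := by
    rintro α h rfl
    have : Module.finrank ℤ (𝓞 K) ≠ 0 := Module.finrank_pos.ne'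
    simp [Algebra.norm_zero] at h
    omega
  have hIb : -((d : ℝ) * Real.log X) - 1 + Real.log X ≤ Real.log X := by
    have : 0 ≤ (d : ℝ) * Real.log X := by positivity
    linarith
  have hI := ncard_pi_le (ι := K →+* ℂ)
    (fun _ => {m : ℤ | -((d : ℝ) * Real.log X) - 1 + Real.log X ≤ m ∧ (m : ℝ) ≤ Real.log X})
    (fun σ => (int_interval _ _ hIb).1)
  have hn0 : Ideal.span {(n : 𝓞 K)} ≠ ⊥ := by
    simp; omega
  have hQfin : Finite (𝓞 K ⧸ Ideal.span {(n : 𝓞 K)}) := Ideal.finiteQuotientOfFreeOfNeBot _ hn0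
  have hQ : Nat.card (𝓞 K ⧸ Ideal.span {(n : 𝓞 K)}) = n ^ d := by
    rw [← Submodule.cardQuot_apply, ← Ideal.absNorm_apply, Ideal.absNorm_span_natCast,
      RingOfIntegers.rank, hd]
  have key := ncard_fib (S := {α : 𝓞 K | (Algebra.norm ℤ α).natAbs = n ∧ ∀ σ : K →+* ℂ, ‖σ α‖ ≤ X})
    (fun α σ => ⌊Real.log ‖σ α‖⌋) hI.1 (B := (n : ℝ) ^ d * (12 * Real.exp 1) ^ d) ?_ ?_
  · refine ⟨key.1, key.2.trans ?_⟩
    rw [hI.2, Finset.prod_const, Finset.card_univ, hcard]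
    push_cast
    gcongr
    refine ((int_interval _ _ hIb).2).trans ?_
    linarith
  · rintro α ⟨h1, h2⟩ σ
    have hpos : ∀ σ : K →+* ℂ, 0 < ‖σ α‖ := fun σ => by
      rw [norm_pos_iff, _root_.map_ne_zero]
      exact RingOfIntegers.coe_ne_zero_iff.mpr (hne α h1)
    have h4 := Int.floor_le (Real.log ‖σ α‖)
    have h5 := Int.lt_floor_add_one (Real.log ‖σ α‖)
    have h6 : ∀ σ : K →+* ℂ, Real.log ‖σ α‖ ≤ Real.log X := fun σ =>
      Real.log_le_log (hpos σ) (h2 σ)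
    have h7 : 0 ≤ ∑ σ : K →+* ℂ, Real.log ‖σ α‖ := by
      rw [← Real.log_prod (fun σ _ => (hpos σ).ne'), nf_norm', h1]
      exact Real.log_nonneg (by exact_mod_cast hn)
    rw [← Finset.add_sum_erase _ _ (Finset.mem_univ σ)] at h7
    have h8 : ∑ σ ∈ Finset.univ.erase σ, Real.log ‖σ α‖ ≤ (d - 1) * Real.log X := by
      refine (Finset.sum_le_card_nsmul _ _ _ (fun τ _ => h6 τ)).trans (le_of_eq ?_)
      rw [nsmul_eq_mul, Finset.card_erase_of_mem (Finset.mem_univ _), Finset.card_univ, hcard,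
        Nat.cast_pred (hcard ▸ Fintype.card_pos_iff.mpr ⟨σ⟩)]
    refine ⟨?_, by linarith [h6 σ]⟩
    nlinarith
  · intro v _
    have key2 := ncard_fib (S := {x ∈ {α : 𝓞 K | (Algebra.norm ℤ α).natAbs = n ∧
          ∀ σ : K →+* ℂ, ‖σ α‖ ≤ X} | (fun σ : K →+* ℂ => ⌊Real.log ‖σ x‖⌋) = v})
      (fun α => Ideal.Quotient.mk (Ideal.span {(n : 𝓞 K)}) α) (I := Set.univ) Set.finite_univ
      (B := (12 * Real.exp 1) ^ d) (fun _ _ => Set.mem_univ _) ?_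
    · refine ⟨key2.1, key2.2.trans (le_of_eq ?_)⟩
      rw [Set.ncard_univ, hQ]; push_cast; ring
    · intro q _
      set T := {x ∈ {x ∈ {α : 𝓞 K | (Algebra.norm ℤ α).natAbs = n ∧
          ∀ σ : K →+* ℂ, ‖σ α‖ ≤ X} | (fun σ : K →+* ℂ => ⌊Real.log ‖σ x‖⌋) = v} |
          Ideal.Quotient.mk (Ideal.span {(n : 𝓞 K)}) x = q} with hT
      rcases T.eq_empty_or_nonempty with h | ⟨β, hβ⟩
      · rw [h]; simp; positivity
      have hb := nf_box K (fun _ => Real.exp 1) (fun _ => by simp)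
      rw [Finset.prod_const, Finset.card_univ, hcard] at hb
      have hsub : T ⊆ (fun u => β * u) '' {β : 𝓞 K | ∀ σ : K →+* ℂ, ‖σ β‖ ≤ Real.exp 1} := by
        intro α hα
        have hm : α - β ∈ Ideal.span {(n : 𝓞 K)} := by
          rw [← Ideal.Quotient.eq, hα.2, hβ.2]
        rw [Ideal.mem_span_singleton] at hm
        have hd1 : β ∣ α := by
          have := nf_dvd_norm K β
          rw [hβ.1.1.1] at this
          have h2 := dvd_add (this.trans hm) (dvd_refl β)
          simpa using h2
        obtain ⟨u, hu⟩ := hd1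
        refine ⟨u, fun σ => ?_, hu.symm⟩
        have hβ0 : 0 < ‖σ β‖ := by
          rw [norm_pos_iff, _root_.map_ne_zero]
          exact RingOfIntegers.coe_ne_zero_iff.mpr (hne β hβ.1.1.1)
        have hα0 : 0 < ‖σ α‖ := by
          rw [norm_pos_iff, _root_.map_ne_zero]
          exact RingOfIntegers.coe_ne_zero_iff.mpr (hne α hα.1.1.1)
        have e1 : ⌊Real.log ‖σ α‖⌋ = ⌊Real.log ‖σ β‖⌋ := congrFun (hα.1.2.trans hβ.1.2.symm) σ
        have e2 := (abs_lt.mp (Int.abs_sub_lt_one_of_floor_eq_floor e1)).2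
        have e3 : ‖σ α‖ = ‖σ β‖ * ‖σ u‖ := by
          rw [hu]; push_cast; rw [map_mul, norm_mul]
        have hu0 : 0 < ‖σ u‖ := by
          by_contra h
          have : ‖σ u‖ = 0 := le_antisymm (not_lt.mp h) (norm_nonneg _)
          rw [this] at e3; linarith
        rw [e3, Real.log_mul hβ0.ne' hu0.ne'] at e2
        rw [← Real.exp_log hu0]
        exact Real.exp_le_exp.mpr (by linarith)
      refine ⟨(hb.1.image _).subset hsub, le_trans ?_ hb.2⟩
      exact_mod_cast (Set.ncard_le_ncard hsub (hb.1.image _)).trans (Set.ncard_image_le hb.1)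

lemma poly_count {R : Type} [CommRing R] (n : ℕ) (S : ℕ → Set R) (B : ℕ → ℝ)
    (hS : ∀ i < n, (S i).Finite ∧ ((S i).ncard : ℝ) ≤ B i) :
    {p : R[X] | p.Monic ∧ p.natDegree = n ∧ ∀ i < n, p.coeff i ∈ S i}.Finite ∧
    ({p : R[X] | p.Monic ∧ p.natDegree = n ∧ ∀ i < n, p.coeff i ∈ S i}.ncard : ℝ) ≤
      ∏ i ∈ Finset.range n, B i := by
  have hI := ncard_pi_le (ι := Fin n) (fun i => S i) (fun i => (hS i i.2).1)
  have key := ncard_fib (S := {p : R[X] | p.Monic ∧ p.natDegree = n ∧ ∀ i < n, p.coeff i ∈ S i})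
    (fun p (i : Fin n) => p.coeff i) hI.1 (B := 1) (fun p hp i => hp.2.2 i i.2) ?_
  · refine ⟨key.1, key.2.trans ?_⟩
    rw [mul_one, hI.2, Nat.cast_prod, Finset.prod_range]
    exact Finset.prod_le_prod (fun _ _ => Nat.cast_nonneg _) (fun i _ => (hS i i.2).2)
  · intro v _
    have hsub : ({x ∈ {p : R[X] | p.Monic ∧ p.natDegree = n ∧ ∀ i < n, p.coeff i ∈ S i} |
        (fun i : Fin n => x.coeff i) = v}).Subsingleton := by
      rintro a ⟨⟨ha1, ha2, -⟩, ha3⟩ b ⟨⟨hb1, hb2, -⟩, hb3⟩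
      ext i
      rcases lt_trichotomy i n with h | h | h
      · exact congrFun (ha3.trans hb3.symm) ⟨i, h⟩
      · have e1 := ha1.coeff_natDegree
        have e2 := hb1.coeff_natDegree
        rw [ha2, ← h] at e1; rw [hb2, ← h] at e2
        rw [e1, e2]
      · rw [coeff_eq_zero_of_natDegree_lt (by omega), coeff_eq_zero_of_natDegree_lt (by omega)]
    exact ⟨hsub.finite, by
      exact_mod_cast (Set.ncard_le_one hsub.finite).mpr (fun a ha b hb => hsub ha hb)⟩

/-- monic polynomials with bounded coefficients -/
def BP (n : ℕ) (a X : ℝ) : Set ℤ[X] := {p | p.Monic ∧ p.natDegree = n ∧ |(p.coeff 0 : ℝ)| ≤ a ∧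
  ∀ i, 1 ≤ i → i < n → |(p.coeff i : ℝ)| ≤ X}

lemma BP_count {n : ℕ} (hn : 1 ≤ n) {a X : ℝ} (ha : 0 ≤ a) (hX : 1 ≤ X) :
    (BP n a X).Finite ∧ ((BP n a X).ncard : ℝ) ≤ (2 * a + 1) * (3 * X) ^ (n - 1) := by
  have key := poly_count n (fun i => {m : ℤ | (-(if i = 0 then a else X) : ℝ) ≤ m ∧
    (m : ℝ) ≤ (if i = 0 then a else X)}) (fun i => 2 * (if i = 0 then a else X) + 1) (by
      intro i _
      have := int_interval (-(if i = 0 then a else X)) (if i = 0 then a else X) (by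
        split_ifs <;> linarith)
      refine ⟨this.1, this.2.trans (le_of_eq (by ring))⟩)
  have hsub : BP n a X ⊆ {p : ℤ[X] | p.Monic ∧ p.natDegree = n ∧ ∀ i < n, p.coeff i ∈
     {m : ℤ | (-(if i = 0 then a else X) : ℝ) ≤ m ∧ (m : ℝ) ≤ (if i = 0 then a else X)}} := by
    rintro p ⟨h1, h2, h3, h4⟩
    refine ⟨h1, h2, fun i hi => ?_⟩
    rcases Nat.eq_zero_or_pos i with rfl | h
    · simpa using abs_le.mp h3
    · simpa [h.ne'] using abs_le.mp (h4 i h hi)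
  refine ⟨key.1.subset hsub, le_trans (Nat.cast_le.mpr (Set.ncard_le_ncard hsub key.1))
    (key.2.trans ?_)⟩
  obtain ⟨m, rfl⟩ := Nat.exists_eq_add_of_le' hn
  rw [Finset.prod_range_succ']
  simp only [Nat.add_eq_zero_iff, one_ne_zero, and_false, if_false, if_true, Finset.prod_const,
    Finset.card_range, Nat.add_sub_cancel]
  rw [mul_comm]
  gcongr
  linarith

/-- the family of polynomials -/
def PF (d : ℕ) (a₀ : ℤ) (N : ℕ) : Set ℤ[X] := {p | p.Monic ∧ p.natDegree = d ∧ p.coeff 0 = a₀ ∧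
  ∀ i, 1 ≤ i → i ≤ d - 1 → |p.coeff i| ≤ (N : ℤ)}

/-- Mahler measure of integer polynomials -/
noncomputable abbrev mah (p : ℤ[X]) : ℝ := (p.map (Int.castRingHom ℂ)).mahlerMeasure

/-- constant in the Mahler bound -/
noncomputable def cA (d : ℕ) (a₀ : ℤ) : ℝ := |(a₀ : ℝ)| + d

lemma one_le_cA {d : ℕ} (hd : 1 ≤ d) (a₀ : ℤ) : 1 ≤ cA d a₀ := by
  have : (1 : ℝ) ≤ d := by exact_mod_cast hd
  have := abs_nonneg (a₀ : ℝ)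
  unfold cA; linarith

lemma mah_le {d : ℕ} (hd : 1 ≤ d) {a₀ : ℤ} {N : ℕ} (hN : 1 ≤ N) {p : ℤ[X]} (hp : p ∈ PF d a₀ N) :
    mah p ≤ cA d a₀ * N := by
  obtain ⟨h1, h2, h3, h4⟩ := hp
  have hN' : (1 : ℝ) ≤ N := by exact_mod_cast hN
  refine (mahlerMeasure_le_sum_norm_coeff _).trans ?_
  rw [sum_over_range _ (by simp), h1.natDegree_map, h2]
  obtain ⟨e, rfl⟩ := Nat.exists_eq_add_of_le' hd
  rw [Finset.sum_range_succ, Finset.sum_range_succ']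
  have e1 : p.coeff (e + 1) = 1 := by rw [← h2]; exact h1
  have e2 : ∑ k ∈ Finset.range e, ‖(p.map (Int.castRingHom ℂ)).coeff (k + 1)‖ ≤ e * N := by
    refine (Finset.sum_le_card_nsmul _ _ (N : ℝ) (fun i hi => ?_)).trans ?_
    · have := h4 (i + 1) (by omega) (by simpa using Finset.mem_range.mp hi)
      rw [coeff_map]
      simp only [eq_intCast, Complex.norm_intCast]
      exact_mod_cast this
    · simp
  simp only [coeff_map, h3, e1, eq_intCast, Complex.norm_intCast] at e2 ⊢
  unfold cA
  push_cast
  rw [abs_one]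
  nlinarith [abs_nonneg (a₀ : ℝ)]

lemma one_le_mah {p : ℤ[X]} (hp : p.Monic) : 1 ≤ mah p :=
  one_le_mahlerMeasure_of_ne_zero hp.ne_zero

lemma monic_one_le {p : ℂ[X]} (hp : p.Monic) : 1 ≤ p.mahlerMeasure := by
  have := leadingCoeff_le_mahlerMeasure p
  rwa [hp.leadingCoeff, norm_one] at this

lemma coeff_le_mah {p : ℂ[X]} {d i : ℕ} (hp : p.natDegree ≤ d) :
    ‖p.coeff i‖ ≤ 2 ^ d * p.mahlerMeasure := by
  refine (norm_coeff_le_choose_mul_mahlerMeasure i p).trans ?_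
  gcongr
  · exact mahlerMeasure_nonneg _
  · exact_mod_cast (Nat.choose_le_two_pow _ _).trans (Nat.pow_le_pow_right (by omega) hp)

lemma log_bd {A : ℝ} (hA : 1 ≤ A) {N : ℕ} (hN : 2 ≤ N) :
    Real.log (A * N) ≤ (1 + Real.log A) * (1 + Real.log N) := by
  rw [Real.log_mul (by linarith) (by positivity)]
  have := Real.log_nonneg hA
  have := Real.log_nonneg (x := N) (by exact_mod_cast (by omega : 1 ≤ N))
  nlinarith

lemma partA_e {d e : ℕ} {a₀ : ℤ} (ha : a₀ ≠ 0) (he : 1 ≤ e) (hed : e < d) : LB (d - 2)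
    (fun N => {f ∈ PF d a₀ N | ∃ g h : ℤ[X], g.Monic ∧ h.Monic ∧ g.natDegree = e ∧
      h.natDegree = d - e ∧ f = g * h}) := by
  set A := cA d a₀ with hA
  have hA1 : 1 ≤ A := one_le_cA (by omega) a₀
  set a : ℝ := |(a₀ : ℝ)| with ha'
  have ha0 : 0 ≤ a := abs_nonneg _
  set c : ℝ := 3 * (2 ^ d * Real.exp 1) with hc
  have hexp : 1 ≤ Real.exp 1 := by simp
  have hlA : 0 ≤ Real.log A := Real.log_nonneg hA1
  refine ⟨(1 + Real.log A + 1) * ((2 * a + 1) ^ 2 * (c * A) ^ (d - 2)), by positivity, 1,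
    fun N hN => ?_⟩
  have hN1 : (1 : ℝ) ≤ N := by exact_mod_cast (by omega : 1 ≤ N)
  have hAN : 1 ≤ A * N := one_le_mul_of_one_le_of_one_le hA1 hN1
  have hl : 0 ≤ Real.log (A * N) := Real.log_nonneg hAN
  have hI := int_interval 0 (Real.log (A * N)) hl
  have key := ncard_rel (S := {f ∈ PF d a₀ N | ∃ g h : ℤ[X], g.Monic ∧ h.Monic ∧ g.natDegree = e ∧
      h.natDegree = d - e ∧ f = g * h}) (fun f k => ∃ g h : ℤ[X], g.Monic ∧ h.Monic ∧
        g.natDegree = e ∧ h.natDegree = d - e ∧ f = g * h ∧ ⌊Real.log (mah g)⌋ = k) hI.1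
        (B := (2 * a + 1) ^ 2 * (c * A) ^ (d - 2) * N ^ (d - 2)) ?_ ?_
  · refine ⟨key.1, key.2.trans ?_⟩
    have h1 : ({n : ℤ | 0 ≤ (n : ℝ) ∧ (n : ℝ) ≤ Real.log (A * N)}.ncard : ℝ) ≤
        (1 + Real.log A + 1) * (1 + Real.log N) := by
      refine hI.2.trans ?_
      have := log_bd hA1 hN
      have := one_le_log' hN
      linarith
    calc _ ≤ (1 + Real.log A + 1) * (1 + Real.log N) *
          ((2 * a + 1) ^ 2 * (c * A) ^ (d - 2) * N ^ (d - 2)) := by gcongr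
      _ = _ := by ring
  · rintro f ⟨hf, g, h, hg, hh, hge, hhe, rfl⟩
    refine ⟨_, ⟨?_, ?_⟩, g, h, hg, hh, hge, hhe, rfl, rfl⟩
    · exact_mod_cast Int.floor_nonneg.mpr (Real.log_nonneg (one_le_mah hg))
    · refine (Int.floor_le _).trans (Real.log_le_log (by linarith [one_le_mah hg]) ?_)
      refine le_trans ?_ (mah_le (by omega) (by omega) hf)
      rw [mah, mah, Polynomial.map_mul, mahlerMeasure_mul]
      exact le_mul_of_one_le_right (mahlerMeasure_nonneg _) (one_le_mah hh)
  · rintro k ⟨hk0, hk1⟩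
    set Ek := Real.exp k with hEk
    have hE1 : 1 ≤ Ek := Real.one_le_exp hk0
    have hE2 : Ek ≤ A * N := by
      rw [← Real.exp_log (by linarith : 0 < A * N)]; exact Real.exp_le_exp.mpr hk1
    have hE3 : 1 ≤ A * N / Ek := by rwa [one_le_div (by linarith)]
    have h2d : (1 : ℝ) ≤ 2 ^ d := one_le_pow₀ (by norm_num)
    have hG := BP_count he ha0 (X := 2 ^ d * Real.exp 1 * Ek) (by
      exact one_le_mul_of_one_le_of_one_le (one_le_mul_of_one_le_of_one_le h2d hexp) hE1)
    have hH := BP_count (n := d - e) (by omega) ha0 (X := 2 ^ d * Real.exp 1 * (A * N / Ek)) (by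
      exact one_le_mul_of_one_le_of_one_le (one_le_mul_of_one_le_of_one_le h2d hexp) hE3)
    set G := BP e a (2 ^ d * Real.exp 1 * Ek)
    set H := BP (d - e) a (2 ^ d * Real.exp 1 * (A * N / Ek))
    have hsub : {f ∈ {f ∈ PF d a₀ N | ∃ g h : ℤ[X], g.Monic ∧ h.Monic ∧ g.natDegree = e ∧
      h.natDegree = d - e ∧ f = g * h} | ∃ g h : ℤ[X], g.Monic ∧ h.Monic ∧
        g.natDegree = e ∧ h.natDegree = d - e ∧ f = g * h ∧ ⌊Real.log (mah g)⌋ = k} ⊆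
        (fun x : ℤ[X] × ℤ[X] => x.1 * x.2) '' (G ×ˢ H) := by
      rintro f ⟨⟨hf, -⟩, g, h, hg, hh, hge, hhe, rfl, hk⟩
      have hm := mah_le (by omega) (by omega) hf
      rw [mah, Polynomial.map_mul, mahlerMeasure_mul] at hm
      have hg1 := one_le_mah hg
      have hl1 : Ek ≤ mah g := by
        rw [← Real.exp_log (by linarith : 0 < mah g), hEk, ← hk]
        exact Real.exp_le_exp.mpr (Int.floor_le _)
      have hl2 : mah g ≤ Real.exp 1 * Ek := by
        rw [← Real.exp_log (by linarith : 0 < mah g), hEk, ← hk, ← Real.exp_add]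
        exact Real.exp_le_exp.mpr (by linarith [Int.lt_floor_add_one (Real.log (mah g))])
      have hl3 : mah h ≤ A * N / Ek := by
        rw [le_div_iff₀ (by linarith)]
        nlinarith [mahlerMeasure_nonneg (h.map (Int.castRingHom ℂ))]
      have h0 : g.coeff 0 * h.coeff 0 = a₀ := by rw [← mul_coeff_zero]; exact hf.2.2.1
      have hca : ∀ x : ℤ, x ∣ a₀ → |(x : ℝ)| ≤ a := by
        intro x hx
        rw [ha', ← Int.cast_abs, ← Int.cast_abs]
        have := Int.le_of_dvd (abs_pos.mpr ha) ((abs_dvd_abs _ _).mpr hx)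
        exact_mod_cast this
      refine ⟨(g, h), ⟨⟨hg, hge, hca _ (h0 ▸ dvd_mul_right _ _), fun i _ hi => ?_⟩,
        ⟨hh, hhe, hca _ (h0 ▸ dvd_mul_left _ _), fun i _ hi => ?_⟩⟩, rfl⟩
      · have := coeff_le_mah (p := g.map (Int.castRingHom ℂ)) (d := d) (i := i)
          (by rw [hg.natDegree_map]; omega)
        rw [coeff_map, eq_intCast, Complex.norm_intCast] at this
        refine this.trans ?_
        rw [mul_assoc]
        gcongr
      · have := coeff_le_mah (p := h.map (Int.castRingHom ℂ)) (d := d) (i := i)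
          (by rw [hh.natDegree_map]; omega)
        rw [coeff_map, eq_intCast, Complex.norm_intCast] at this
        refine this.trans ?_
        rw [mul_assoc]
        gcongr
        refine hl3.trans ?_
        exact le_mul_of_one_le_left (by linarith) hexp
    have hfin := (hG.1.prod hH.1).image (fun x : ℤ[X] × ℤ[X] => x.1 * x.2)
    refine ⟨hfin.subset hsub, ?_⟩
    have hn := (Set.ncard_le_ncard hsub hfin).trans (Set.ncard_image_le (hG.1.prod hH.1))
    rw [Set.ncard_prod] at hn
    have hc0 : 0 ≤ c := by positivity
    calc _ ≤ (G.ncard : ℝ) * H.ncard := by exact_mod_cast hn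
      _ ≤ ((2 * a + 1) * (3 * (2 ^ d * Real.exp 1 * Ek)) ^ (e - 1)) *
        ((2 * a + 1) * (3 * (2 ^ d * Real.exp 1 * (A * N / Ek))) ^ (d - e - 1)) :=
          mul_le_mul hG.2 hH.2 (Nat.cast_nonneg _) (by positivity)
      _ = (2 * a + 1) ^ 2 * ((c * Ek) ^ (e - 1) * (c * (A * N / Ek)) ^ (d - e - 1)) := by
        rw [hc]; ring
      _ ≤ (2 * a + 1) ^ 2 * ((c * (A * N)) ^ (e - 1) * (c * (A * N)) ^ (d - e - 1)) := by
        gcongr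
        exact div_le_self (by linarith) hE1
      _ = _ := by
        rw [← pow_add, show e - 1 + (d - e - 1) = d - 2 by omega, ← mul_assoc, mul_pow]; ring

lemma partA {d : ℕ} {a₀ : ℤ} (ha : a₀ ≠ 0) (hd : 1 ≤ d) : LB (d - 2)
    (fun N => {f ∈ PF d a₀ N | ¬ Irreducible f}) := by
  refine (LB.iUnion (Finset.Ico 1 d) (F := fun e N => {f ∈ PF d a₀ N | ∃ g h : ℤ[X], g.Monic ∧
    h.Monic ∧ g.natDegree = e ∧ h.natDegree = d - e ∧ f = g * h}) (fun e he => ?_)).mono ?_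
  · rw [Finset.mem_Ico] at he
    exact partA_e ha he.1 he.2
  · rintro N hN f ⟨hf, hirr⟩
    rw [hf.1.irreducible_iff_natDegree] at hirr
    have hne : f ≠ 1 := by
      rintro rfl
      have := hf.2.1
      simp at this; omega
    push Not at hirr
    obtain ⟨g, h, hg, hh, rfl, hg0, hh0⟩ := hirr hne
    have hdeg := hf.2.1
    rw [hg.natDegree_mul hh] at hdeg
    simp only [Set.mem_iUnion, Finset.mem_Ico]
    exact ⟨g.natDegree, ⟨by omega, by omega⟩, hf, g, h, hg, hh, rfl, by omega, rfl⟩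

lemma one_le_prod_real {ι : Type} (s : Finset ι) (f : ι → ℝ) (h : ∀ i ∈ s, 1 ≤ f i) :
    1 ≤ ∏ i ∈ s, f i := by
  rw [← Finset.prod_const_one (s := s)]
  exact Finset.prod_le_prod (fun _ _ => zero_le_one) h

open NumberField in
lemma partB_count (m r n : ℕ) (hn : 1 ≤ n) (A : ℝ) (hA : 1 ≤ A) : ∃ C : ℝ, 0 < C ∧ ∃ Ω : ℕ,
    ∀ N : ℕ, 2 ≤ N → ∀ (L : Type) [Field L] [NumberField L], Module.finrank ℚ L = m →
    ∀ (t : ℕ) (b : 𝓞 L), 1 ≤ t →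
    {g : (𝓞 L)[X] | g.Monic ∧ g.natDegree = r + 2 ∧ g.eval (t : 𝓞 L) = b ∧
      (Algebra.norm ℤ (g.coeff 0)).natAbs = n ∧
      ∏ τ : L →+* ℂ, (g.map (τ.comp (algebraMap (𝓞 L) L))).mahlerMeasure ≤ A * N}.Finite ∧
    ({g : (𝓞 L)[X] | g.Monic ∧ g.natDegree = r + 2 ∧ g.eval (t : 𝓞 L) = b ∧
      (Algebra.norm ℤ (g.coeff 0)).natAbs = n ∧
      ∏ τ : L →+* ℂ, (g.map (τ.comp (algebraMap (𝓞 L) L))).mahlerMeasure ≤ A * N}.ncard : ℝ) ≤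
      C * (N : ℝ) ^ r * (1 + Real.log N) ^ Ω := by
  have hexp : 1 ≤ Real.exp 1 := by simp
  have hlA : 0 ≤ Real.log A := Real.log_nonneg hA
  set A' : ℝ := 2 ^ (r + 2) * A with hA'
  have hA'1 : 1 ≤ A' := one_le_mul_of_one_le_of_one_le (one_le_pow₀ (by norm_num)) hA
  have hlA' : 0 ≤ Real.log A' := Real.log_nonneg hA'1
  set c : ℝ := (12 * (2 ^ (r + 2) * Real.exp 1)) ^ m with hc
  refine ⟨(1 + Real.log A + 1) ^ m * ((m * (1 + Real.log A') + 2) ^ m *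
    ((n : ℝ) ^ m * (12 * Real.exp 1) ^ m) * (c * A) ^ r), by positivity, m + m, ?_⟩
  intro N hN L _ _ hm t b ht
  classical
  have hN1 : (1 : ℝ) ≤ N := by exact_mod_cast (by omega : 1 ≤ N)
  have hAN : 1 ≤ A * N := one_le_mul_of_one_le_of_one_le hA hN1
  have hA'N : 1 ≤ A' * N := one_le_mul_of_one_le_of_one_le hA'1 hN1
  have hl : 0 ≤ Real.log (A * N) := Real.log_nonneg hAN
  have hl1 := one_le_log' hN
  have hcard : Fintype.card (L →+* ℂ) = m := by rw [NumberField.Embeddings.card, hm]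
  have hI0 := int_interval 0 (Real.log (A * N)) hl
  have hI := ncard_pi_le (ι := L →+* ℂ)
    (fun _ => {n : ℤ | (0 : ℝ) ≤ n ∧ (n : ℝ) ≤ Real.log (A * N)}) (fun _ => hI0.1)
  set J := {v : (L →+* ℂ) → ℤ | ∀ i, v i ∈ {n : ℤ | (0 : ℝ) ≤ n ∧ (n : ℝ) ≤ Real.log (A * N)}}
    with hJ
  set J' := {v ∈ J | ∏ τ, Real.exp (v τ) ≤ A * N} with hJ'
  have hJf : J'.Finite := hI.1.subset (fun v hv => hv.1)
  have hJc : (J'.ncard : ℝ) ≤ ((1 + Real.log A + 1) * (1 + Real.log N)) ^ m := by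
    have h1 : (J'.ncard : ℝ) ≤ J.ncard := by
      exact_mod_cast Set.ncard_le_ncard (s := J') (t := J) (fun v hv => hv.1) hI.1
    refine h1.trans ?_
    rw [hI.2, Finset.prod_const, Finset.card_univ, hcard]
    push_cast
    gcongr
    refine hI0.2.trans ?_
    have := log_bd hA hN
    linarith
  set M : (𝓞 L)[X] → (L →+* ℂ) → ℝ := fun g τ =>
    (g.map (τ.comp (algebraMap (𝓞 L) L))).mahlerMeasure with hMdef
  have hM1 : ∀ g : (𝓞 L)[X], g.Monic → ∀ τ, 1 ≤ M g τ := fun g hg τ => monic_one_le (hg.map _)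
  have hcoef : ∀ g : (𝓞 L)[X], g.natDegree = r + 2 → ∀ τ : L →+* ℂ, ∀ i,
      ‖τ (g.coeff i)‖ ≤ 2 ^ (r + 2) * M g τ := by
    intro g hg τ i
    have := coeff_le_mah (p := g.map (τ.comp (algebraMap (𝓞 L) L))) (d := r + 2) (i := i)
      ((natDegree_map_le).trans hg.le)
    rw [coeff_map] at this
    exact this
  have key := ncard_fib (S := {g : (𝓞 L)[X] | g.Monic ∧ g.natDegree = r + 2 ∧
      g.eval (t : 𝓞 L) = b ∧ (Algebra.norm ℤ (g.coeff 0)).natAbs = n ∧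
      ∏ τ : L →+* ℂ, M g τ ≤ A * N}) (fun g τ => ⌊Real.log (M g τ)⌋) hJf
      (B := (m * (1 + Real.log A') + 2) ^ m * (1 + Real.log N) ^ m *
        ((n : ℝ) ^ m * (12 * Real.exp 1) ^ m) * (c * (A * N)) ^ r) ?_ ?_
  · refine ⟨key.1, key.2.trans ?_⟩
    calc _ ≤ ((1 + Real.log A + 1) * (1 + Real.log N)) ^ m * ((m * (1 + Real.log A') + 2) ^ m *
          (1 + Real.log N) ^ m * ((n : ℝ) ^ m * (12 * Real.exp 1) ^ m) * (c * (A * N)) ^ r) := by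
          gcongr
      _ = _ := by rw [mul_pow, ← mul_assoc c, mul_pow (c * A), pow_add]; ring
  · rintro g ⟨hg, hdeg, -, -, hprod⟩
    refine ⟨fun τ => ⟨?_, ?_⟩, ?_⟩
    · exact_mod_cast Int.floor_nonneg.mpr (Real.log_nonneg (hM1 g hg τ))
    · refine (Int.floor_le _).trans (Real.log_le_log (by linarith [hM1 g hg τ]) ?_)
      refine le_trans ?_ hprod
      rw [← Finset.mul_prod_erase _ _ (Finset.mem_univ τ)]
      exact le_mul_of_one_le_right (by linarith [hM1 g hg τ])
        (one_le_prod_real _ _ (fun τ _ => hM1 g hg τ))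
    · refine le_trans (Finset.prod_le_prod (fun _ _ => (Real.exp_pos _).le) (fun τ _ => ?_)) hprod
      have := hM1 g hg τ
      rw [← Real.exp_log (by linarith : 0 < M g τ)]
      exact Real.exp_le_exp.mpr (Int.floor_le _)
  · rintro k ⟨hk, hkp⟩
    have hbox := nf_box L (fun τ => 2 ^ (r + 2) * (Real.exp 1 * Real.exp (k τ))) (fun τ => by
      refine one_le_mul_of_one_le_of_one_le (one_le_pow₀ (by norm_num))
        (one_le_mul_of_one_le_of_one_le hexp (Real.one_le_exp (hk τ).1)))
    have hU := nf_U L n hn (A' * N) hA'N m hm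
    set S0 := {α : 𝓞 L | (Algebra.norm ℤ α).natAbs = n ∧ ∀ σ : L →+* ℂ, ‖σ α‖ ≤ A' * N}
    set S2 := {β : 𝓞 L | ∀ σ : L →+* ℂ, ‖σ β‖ ≤ 2 ^ (r + 2) * (Real.exp 1 * Real.exp (k σ))}
    have hbb : (S2.ncard : ℝ) ≤ c * (A * N) := by
      refine hbox.2.trans ?_
      calc _ = ∏ τ : L →+* ℂ, (12 * (2 ^ (r + 2) * Real.exp 1) * Real.exp (k τ)) :=
            Finset.prod_congr rfl (fun τ _ => by ring)
        _ = c * ∏ τ : L →+* ℂ, Real.exp (k τ) := by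
          rw [Finset.prod_mul_distrib, Finset.prod_const, Finset.card_univ, hcard]
        _ ≤ _ := by gcongr
    have hUU : (S0.ncard : ℝ) ≤ (m * (1 + Real.log A') + 2) ^ m * (1 + Real.log N) ^ m *
        ((n : ℝ) ^ m * (12 * Real.exp 1) ^ m) := by
      refine hU.2.trans ?_
      rw [← mul_pow (m * (1 + Real.log A') + 2)]
      have h0 : 0 ≤ Real.log (A' * N) := Real.log_nonneg hA'N
      refine mul_le_mul_of_nonneg_right (pow_le_pow_left₀ (by positivity) ?_ _) (by positivity)
      have := log_bd hA'1 hN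
      have h2 : (m : ℝ) * Real.log (A' * N) ≤ m * ((1 + Real.log A') * (1 + Real.log N)) := by gcongr
      linarith
    have pc := poly_count (r + 2) (fun i => if i = 0 then S0 else if i = 1 then {0} else S2)
      (fun i => if i = 0 then (m * (1 + Real.log A') + 2) ^ m * (1 + Real.log N) ^ m *
        ((n : ℝ) ^ m * (12 * Real.exp 1) ^ m) else if i = 1 then 1 else c * (A * N)) (by
        intro i _
        split_ifs
        · exact ⟨hU.1, hUU⟩
        · simp
        · exact ⟨hbox.1, hbb⟩)
    rw [Finset.prod_range_succ', Finset.prod_range_succ'] at pc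
    simp only [Nat.add_eq_zero_iff, one_ne_zero, and_false, if_false, if_true, Finset.prod_const,
      Finset.card_range, zero_add, mul_one, Nat.add_eq_right] at pc
    set P := {p : (𝓞 L)[X] | p.Monic ∧ p.natDegree = r + 2 ∧ ∀ i < r + 2, p.coeff i ∈
      if i = 0 then S0 else if i = 1 then {0} else S2}
    set T := {x ∈ {g : (𝓞 L)[X] | g.Monic ∧ g.natDegree = r + 2 ∧
      g.eval (t : 𝓞 L) = b ∧ (Algebra.norm ℤ (g.coeff 0)).natAbs = n ∧
      ∏ τ : L →+* ℂ, M g τ ≤ A * N} | (fun τ => ⌊Real.log (M x τ)⌋) = k} with hT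
    have hmaps : ∀ g ∈ T, g - C (g.coeff 1) * X ∈ P := by
      rintro g ⟨⟨hg, hdeg, -, hnorm, hprod⟩, hk'⟩
      have hd1 : (C (g.coeff 1) * X : (𝓞 L)[X]).degree < g.degree := by
        refine lt_of_le_of_lt (degree_C_mul_X_le _) ?_
        rw [degree_eq_natDegree hg.ne_zero, hdeg]
        exact_mod_cast (by omega : 1 < r + 2)
      refine ⟨hg.sub_of_left hd1, ?_, fun i hi => ?_⟩
      · rw [natDegree_eq_of_degree_eq (degree_sub_eq_left_of_degree_lt hd1), hdeg]
      · rw [coeff_sub, coeff_C_mul, coeff_X]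
        split_ifs with h0 h1 h2
        · subst h0
          omega
        · simp only [mul_zero, sub_zero]
          subst h0
          refine ⟨hnorm, fun σ => (hcoef g hdeg σ 0).trans ?_⟩
          rw [hA', mul_assoc]
          gcongr
          refine le_trans ?_ hprod
          rw [← Finset.mul_prod_erase _ _ (Finset.mem_univ σ)]
          exact le_mul_of_one_le_right (by linarith [hM1 g hg σ])
            (one_le_prod_real _ _ (fun τ _ => hM1 g hg τ))
        · subst h2
          simp
        · omega
        · omega
        · simp only [mul_zero, sub_zero]
          intro σ
          refine (hcoef g hdeg σ i).trans ?_
          gcongr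
          have h1 := hM1 g hg σ
          rw [← Real.exp_log (by linarith : 0 < M g σ), ← hk', ← Real.exp_add]
          refine Real.exp_le_exp.mpr ?_
          dsimp only
          linarith [Int.lt_floor_add_one (Real.log (M g σ))]
    have hinj : Set.InjOn (fun g : (𝓞 L)[X] => g - C (g.coeff 1) * X) T := by
      rintro g hg h hh hgh
      dsimp only at hgh
      have e1 := congrArg (eval (t : 𝓞 L)) hgh
      simp only [eval_sub, eval_mul, eval_C, eval_X, hg.1.2.2.1, hh.1.2.2.1] at e1
      have ht0 : (t : 𝓞 L) ≠ 0 := by exact_mod_cast (by omega : t ≠ 0)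
      have e2 : g.coeff 1 = h.coeff 1 := mul_right_cancel₀ ht0 (by linear_combination -e1)
      rw [e2] at hgh
      linear_combination hgh
    have hTf : T.Finite := Set.Finite.of_injOn hmaps hinj pc.1
    refine ⟨hTf, le_trans (Nat.cast_le.mpr (Set.ncard_le_ncard_of_injOn _ hmaps hinj pc.1))
      (pc.2.trans (le_of_eq ?_))⟩
    ring

section

open IntermediateField NumberField

lemma nf_adj {α : ℂ} (hα : IsIntegral ℤ α) : NumberField ℚ⟮α⟯ where
  to_charZero := inferInstance
  to_finiteDimensional := adjoin.finiteDimensional (hα.tower_top)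

lemma nf_le {α : ℂ} (hα : IsIntegral ℤ α) {L : IntermediateField ℚ ℂ} (hL : L ≤ ℚ⟮α⟯) :
    NumberField L where
  to_charZero := inferInstance
  to_finiteDimensional := by
    have : FiniteDimensional ℚ ℚ⟮α⟯ := adjoin.finiteDimensional (hα.tower_top)
    exact FiniteDimensional.of_injective (inclusion hL).toLinearMap (inclusion_injective hL)

lemma mem_adj {α : ℂ} (hα : IsIntegral ℤ α) {l : ℂ} (hl : l ∈ ℚ⟮α⟯) :
    ∃ q : ℚ[X], l = aeval α q := by
  have : l ∈ ℚ⟮α⟯.toSubalgebra := hl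
  rw [adjoin_simple_toSubalgebra_of_isAlgebraic (hα.tower_top (A := ℚ)).isAlgebraic,
    Algebra.adjoin_singleton_eq_range_aeval] at this
  obtain ⟨q, hq⟩ := this
  exact ⟨q, hq.symm⟩

section fac
variable {α : ℂ} (hα : IsIntegral ℤ α) {L : IntermediateField ℚ ℂ} [NumberField L]

/-- conjugate of a polynomial over `𝓞 L` -/
noncomputable abbrev cj {L : Type} [Field L] (g : (𝓞 L)[X]) (τ : L →+* ℂ) : ℂ[X] :=
  g.map (τ.comp (algebraMap (𝓞 L) L))

include hα

lemma minpoly_L : minpoly L α = (minpoly (𝓞 L) α).map (algebraMap (𝓞 L) L) :=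
  minpoly.isIntegrallyClosed_eq_field_fractions' L (hα.tower_top)

lemma fac_root (hL : L ≤ ℚ⟮α⟯) (l : L) : ∃ q : ℚ[X], ∀ (τ : L →+* ℂ) (z : ℂ),
    (cj (minpoly (𝓞 L) α) τ).eval z = 0 → τ l = aeval z q := by
  obtain ⟨q, hq⟩ := mem_adj hα (hL l.2)
  refine ⟨q, fun τ z hz => ?_⟩
  have h1 : minpoly L α ∣ q.map (algebraMap ℚ L) - C l := by
    apply minpoly.dvd
    rw [map_sub, aeval_map_algebraMap, aeval_C, ← hq]
    exact sub_self _
  rw [minpoly_L hα] at h1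
  have h2 := Polynomial.map_dvd τ h1
  rw [Polynomial.map_map] at h2
  obtain ⟨r, hr⟩ := h2
  have h3 := congrArg (eval z) hr
  rw [eval_mul, hz, zero_mul, Polynomial.map_sub, map_C, eval_sub, eval_C, Polynomial.map_map,
    eval_map] at h3
  have h4 : τ.comp (algebraMap ℚ L) = algebraMap ℚ ℂ := Subsingleton.elim _ _
  rw [h4] at h3
  rw [aeval_def]
  linear_combination -h3

lemma fac_coprime (hL : L ≤ ℚ⟮α⟯) {τ τ' : L →+* ℂ} (h : τ ≠ τ') :
    IsCoprime (cj (minpoly (𝓞 L) α) τ) (cj (minpoly (𝓞 L) α) τ') := by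
  rw [Polynomial.isCoprime_iff_aeval_ne_zero_of_isAlgClosed ℂ ℂ]
  intro z
  by_contra! hz
  apply h
  ext l
  obtain ⟨q, hq⟩ := fac_root hα hL l
  rw [hq τ z (by simpa using hz.1), hq τ' z (by simpa using hz.2)]

lemma fac_deg (hL : L ≤ ℚ⟮α⟯) :
    Module.finrank ℚ L * (minpoly (𝓞 L) α).natDegree = (minpoly ℤ α).natDegree := by
  have h1 := finrank_bot_mul_relfinrank hL
  rw [adjoin.finrank (hα.tower_top)] at h1
  have h2 : relfinrank L ℚ⟮α⟯ = (minpoly (𝓞 L) α).natDegree := by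
    rw [relfinrank_eq_finrank_of_le hL, extendScalars_adjoin, adjoin.finrank (hα.tower_top),
      minpoly_L hα, (minpoly.monic (hα.tower_top)).natDegree_map]
  rw [h2] at h1
  rw [h1, minpoly.isIntegrallyClosed_eq_field_fractions' ℚ hα, (minpoly.monic hα).natDegree_map]

lemma fac_prod (hL : L ≤ ℚ⟮α⟯) :
    (minpoly ℤ α).map (Int.castRingHom ℂ) = ∏ τ : L →+* ℂ, cj (minpoly (𝓞 L) α) τ := by
  have hm : (minpoly (𝓞 L) α).Monic := minpoly.monic hα.tower_top
  have hm1 : (∏ τ : L →+* ℂ, cj (minpoly (𝓞 L) α) τ).Monic :=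
    monic_prod_of_monic _ _ (fun τ _ => hm.map _)
  have hm2 : ((minpoly ℤ α).map (Int.castRingHom ℂ)).Monic := (minpoly.monic hα).map _
  refine eq_of_monic_of_dvd_of_natDegree_le hm1 hm2 ?_ ?_
  · apply Fintype.prod_dvd_of_coprime
    · intro τ τ' h
      exact fac_coprime hα hL h
    · intro τ
      have h1 : minpoly L α ∣ (minpoly ℤ α).map (Int.castRingHom L) := by
        apply minpoly.dvd
        have := minpoly.aeval ℤ α
        rw [aeval_def, ← eval_map] at this ⊢
        rw [Polynomial.map_map, RingHom.ext_int ((algebraMap L ℂ).comp (Int.castRingHom L))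
          (algebraMap ℤ ℂ)]
        exact this
      rw [minpoly_L hα] at h1
      have h2 := Polynomial.map_dvd τ h1
      rw [Polynomial.map_map, Polynomial.map_map] at h2
      rw [RingHom.ext_int (τ.comp (Int.castRingHom L)) (Int.castRingHom ℂ)] at h2
      exact h2
  · rw [(minpoly.monic hα).natDegree_map, natDegree_prod_of_monic _ _ (fun τ _ => hm.map _),
      ← fac_deg hα hL]
    simp only [hm.natDegree_map]
    rw [Finset.sum_const, Finset.card_univ, NumberField.Embeddings.card, smul_eq_mul]

end fac

lemma fac_simple {b : ℂ} (hb : IsIntegral ℤ b) {L : IntermediateField ℚ ℂ} [NumberField L]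
    (hL : L = ℚ⟮b⟯) (b' : 𝓞 L) (hb' : algebraMap (𝓞 L) ℂ b' = b) :
    (minpoly ℤ b).map (Int.castRingHom ℂ) = ∏ τ : L →+* ℂ, (X - C (τ b')) := by
  rw [fac_prod hb hL.le]
  refine Finset.prod_congr rfl (fun τ _ => ?_)
  have : minpoly (𝓞 L) b = X - C b' := by
    apply map_injective (algebraMap (𝓞 L) L) RingOfIntegers.coe_injective
    rw [← minpoly_L hb, ← hb', Polynomial.map_sub, map_X, map_C]
    exact minpoly.eq_X_sub_C ℂ (b' : L)
  rw [this, cj, Polynomial.map_sub, map_X, map_C]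
  rfl

/-- irreducible integer polynomials are minimal polynomials -/
lemma minpoly_of_irr {f : ℤ[X]} (hf : f.Monic) (hirr : Irreducible f) {α : ℂ}
    (h : aeval α f = 0) : minpoly ℤ α = f := by
  have hint : IsIntegral ℤ α := ⟨f, hf, by rw [← aeval_def]; exact h⟩
  have hd := minpoly.isIntegrallyClosed_dvd hint h
  have hna : ¬ IsUnit (minpoly ℤ α) := minpoly.not_isUnit ℤ α
  have := (hirr.dvd_iff.mp hd).resolve_left hna
  exact (eq_of_monic_of_associated hf (minpoly.monic hint) this).symm

lemma mah_prod {ι : Type} (s : Finset ι) (f : ι → ℂ[X]) :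
    (∏ i ∈ s, f i).mahlerMeasure = ∏ i ∈ s, (f i).mahlerMeasure := by
  classical
  induction s using Finset.induction_on with
  | empty => simp
  | insert a s ha ih => rw [Finset.prod_insert ha, Finset.prod_insert ha, mahlerMeasure_mul, ih]

lemma exists_t {ι : Type} [Fintype ι] (e : ℕ) (he : 1 ≤ e) (g : ι → ℂ[X])
    (hdeg : ∀ i, (g i).natDegree = e) (hc : ∀ i j, i ≠ j → IsCoprime (g i) (g j)) :
    ∃ t : ℕ, 1 ≤ t ∧ t ≤ Fintype.card ι * Fintype.card ι * e + 1 ∧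
      Function.Injective (fun i => (g i).eval (t : ℂ)) := by
  classical
  have hne : ∀ i j, i ≠ j → g i - g j ≠ 0 := by
    intro i j hij h
    have h1 := hc i j hij
    rw [sub_eq_zero.mp h, isCoprime_self] at h1
    have := natDegree_eq_zero_of_isUnit h1
    rw [hdeg] at this; omega
  set P : ℂ[X] := ∏ q ∈ (Finset.univ : Finset (ι × ι)).filter (fun q => q.1 ≠ q.2),
    (g q.1 - g q.2) with hP
  have hP0 : P ≠ 0 := Finset.prod_ne_zero_iff.mpr (fun q hq => hne _ _ (Finset.mem_filter.mp hq).2)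
  have hPd : P.natDegree ≤ Fintype.card ι * Fintype.card ι * e := by
    refine (natDegree_prod_le _ _).trans ?_
    refine (Finset.sum_le_card_nsmul _ _ e (fun q _ => ?_)).trans ?_
    · exact (natDegree_sub_le _ _).trans (by rw [hdeg, hdeg, max_self])
    · rw [smul_eq_mul]
      gcongr
      exact (Finset.card_le_univ _).trans (by rw [Fintype.card_prod])
  by_contra! hcon
  have hsub : (Finset.Icc 1 (Fintype.card ι * Fintype.card ι * e + 1)).image (fun t : ℕ => (t : ℂ))
      ⊆ P.roots.toFinset := by
    intro z hz
    obtain ⟨t, ht, rfl⟩ := Finset.mem_image.mp hz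
    rw [Finset.mem_Icc] at ht
    have := hcon t ht.1 ht.2
    rw [Function.Injective] at this
    push Not at this
    obtain ⟨i, j, hij, hne'⟩ := this
    rw [Multiset.mem_toFinset, mem_roots hP0, IsRoot.def, hP, eval_prod]
    refine Finset.prod_eq_zero (i := (i, j)) (by simpa using hne') ?_
    rw [eval_sub]
    exact sub_eq_zero.mpr hij
  have h1 := Finset.card_le_card hsub
  rw [Finset.card_image_of_injective _ Nat.cast_injective, Nat.card_Icc] at h1
  have h2 := (Multiset.toFinset_card_le P.roots).trans (card_roots' P)
  omega

lemma eval_le_mah {p : ℂ[X]} {e : ℕ} (hp : p.natDegree = e) (t T : ℕ) (ht : 1 ≤ t) (hT : t ≤ T) :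
    ‖p.eval (t : ℂ)‖ ≤ ((e + 1) * (2 ^ e * T ^ e)) * p.mahlerMeasure := by
  have hm := mahlerMeasure_nonneg p
  rw [eval_eq_sum_range, hp]
  refine (norm_sum_le _ _).trans ?_
  refine (Finset.sum_le_card_nsmul _ _ (2 ^ e * p.mahlerMeasure * T ^ e) (fun i hi => ?_)).trans ?_
  · rw [norm_mul, norm_pow, Complex.norm_natCast]
    have h1 := coeff_le_mah (p := p) (i := i) hp.le
    have h2 : (t : ℝ) ^ i ≤ T ^ e := by
      calc (t : ℝ) ^ i ≤ (t : ℝ) ^ e := pow_le_pow_right₀ (by exact_mod_cast ht)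
            (by have := Finset.mem_range.mp hi; omega)
        _ ≤ _ := by gcongr
    gcongr
  · rw [Finset.card_range, nsmul_eq_mul]
    push_cast
    exact le_of_eq (by ring)

lemma gen_of_inj {L : IntermediateField ℚ ℂ} [NumberField L] (b : L)
    (h : Function.Injective (fun τ : L →+* ℂ => τ b)) : L = ℚ⟮(b : ℂ)⟯ := by
  have h1 : ℚ⟮b⟯ = ⊤ := by
    rw [Field.primitive_element_iff_algHom_eq_of_eval' ℚ ℂ (fun x => IsAlgClosed.splits _)]
    intro φ ψ hφ
    have : (φ : L →+* ℂ) = ψ := h hφ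
    ext x
    exact DFunLike.congr_fun this x
  exact ((lift_adjoin_simple ℚ L b).symm.trans ((congrArg lift h1).trans (lift_top ℚ L))).symm

/-- relation between polynomial and auxiliary generator -/
def RB (m r : ℕ) (f : ℤ[X]) (b : ℂ) (t : ℕ) : Prop :=
  ∃ (L : IntermediateField ℚ ℂ) (_ : NumberField L) (α : ℂ) (b' : 𝓞 L), IsIntegral ℤ α ∧
    minpoly ℤ α = f ∧ L ≤ ℚ⟮α⟯ ∧ Module.finrank ℚ L = m ∧ (minpoly (𝓞 L) α).natDegree = r + 2 ∧
    L = ℚ⟮b⟯ ∧ algebraMap (𝓞 L) ℂ b' = b ∧ (minpoly (𝓞 L) α).eval (t : 𝓞 L) = b'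

/-- set for a fixed shape -/
def SB (d : ℕ) (a₀ : ℤ) (m r : ℕ) (N : ℕ) : Set ℤ[X] := {f ∈ PF d a₀ N |
  ∃ (L : IntermediateField ℚ ℂ) (_ : NumberField L) (α : ℂ), IsIntegral ℤ α ∧
    minpoly ℤ α = f ∧ L ≤ ℚ⟮α⟯ ∧ Module.finrank ℚ L = m ∧ (minpoly (𝓞 L) α).natDegree = r + 2}

lemma SB_mah {d : ℕ} (hd : 1 ≤ d) {a₀ : ℤ} {N : ℕ} (hN : 2 ≤ N) {f : ℤ[X]} (hf : f ∈ PF d a₀ N)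
    {L : IntermediateField ℚ ℂ} [NumberField L] {α : ℂ} (hα : IsIntegral ℤ α)
    (hm : minpoly ℤ α = f) (hL : L ≤ ℚ⟮α⟯) :
    ∏ τ : L →+* ℂ, (cj (minpoly (𝓞 L) α) τ).mahlerMeasure ≤ cA d a₀ * N := by
  rw [← mah_prod, ← fac_prod hα hL, hm]
  exact mah_le hd (by omega) hf

lemma SB_norm {d : ℕ} {a₀ : ℤ} {N : ℕ} {f : ℤ[X]} (hf : f ∈ PF d a₀ N)
    {L : IntermediateField ℚ ℂ} [NumberField L] {α : ℂ} (hα : IsIntegral ℤ α)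
    (hm : minpoly ℤ α = f) (hL : L ≤ ℚ⟮α⟯) :
    (Algebra.norm ℤ ((minpoly (𝓞 L) α).coeff 0)).natAbs = a₀.natAbs := by
  have h1 := congrArg (fun p => ‖p.coeff 0‖) (fac_prod hα hL)
  simp only [coeff_zero_prod, norm_prod, cj, coeff_map, RingHom.comp_apply] at h1
  have h2 := nf_norm' L ((minpoly (𝓞 L) α).coeff 0)
  rw [h2, hm, hf.2.2.1] at h1
  have h3 : ((a₀.natAbs : ℕ) : ℝ) = ((Algebra.norm ℤ ((minpoly (𝓞 L) α).coeff 0)).natAbs : ℝ) := by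
    rw [← h1, Nat.cast_natAbs]
    simp
  exact_mod_cast h3.symm

lemma partB_idx {d : ℕ} (hd : 1 ≤ d) {a₀ : ℤ} {m r : ℕ} {N : ℕ} (hN : 2 ≤ N) {f : ℤ[X]}
    (hf : f ∈ SB d a₀ m r N) {T : ℕ} (hT : T = m * m * (r + 2) + 1) {Y : ℝ}
    (hY : Y = 2 ^ m * (((r + 2 : ℕ) + 1) * (2 ^ (r + 2) * (T : ℝ) ^ (r + 2))) ^ m * cA d a₀) :
    ∃ t : ℕ, ∃ b : ℂ, 1 ≤ t ∧ t ≤ T ∧ (∃ h ∈ BP m (Y * N) (Y * N), aeval b h = 0) ∧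
      RB m r f b t := by
  obtain ⟨hf, L, _, α, hα, hm, hL, hfr, hdeg⟩ := hf
  have hcard : Fintype.card (L →+* ℂ) = m := by rw [NumberField.Embeddings.card, hfr]
  have hmon : (minpoly (𝓞 L) α).Monic := minpoly.monic hα.tower_top
  obtain ⟨t, ht1, htT, hinj⟩ := exists_t (r + 2) (by omega)
    (fun τ : L →+* ℂ => cj (minpoly (𝓞 L) α) τ) (fun τ => by rw [hmon.natDegree_map, hdeg])
    (fun τ τ' h => fac_coprime hα hL h)
  rw [hcard, ← hT] at htT
  set b' : 𝓞 L := (minpoly (𝓞 L) α).eval (t : 𝓞 L) with hb'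
  have hev : ∀ τ : L →+* ℂ, (cj (minpoly (𝓞 L) α) τ).eval (t : ℂ) = τ b' := by
    intro τ
    have := eval_map_apply (τ.comp (algebraMap (𝓞 L) L)) (p := minpoly (𝓞 L) α) (t : 𝓞 L)
    rw [map_natCast] at this
    rw [this, hb']; rfl
  simp only [hev] at hinj
  have hgen := gen_of_inj (b' : L) hinj
  have hbint : IsIntegral ℤ (algebraMap (𝓞 L) ℂ b') :=
    (RingOfIntegers.isIntegral b').map (IsScalarTower.toAlgHom ℤ (𝓞 L) ℂ)
  refine ⟨t, algebraMap (𝓞 L) ℂ b', ht1, htT, ⟨minpoly ℤ (algebraMap (𝓞 L) ℂ b'), ?_,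
    minpoly.aeval _ _⟩, L, inferInstance, α, b', hα, hm, hL, hfr, hdeg, hgen, rfl, hb'.symm⟩
  have hs := fac_simple hbint hgen b' rfl
  have hmon' := minpoly.monic hbint
  have hdeg' : (minpoly ℤ (algebraMap (𝓞 L) ℂ b')).natDegree = m := by
    rw [← hmon'.natDegree_map (Int.castRingHom ℂ), hs, natDegree_prod_of_monic _ _
      (fun τ _ => monic_X_sub_C _)]
    simp [hcard]
  have hM : mah (minpoly ℤ (algebraMap (𝓞 L) ℂ b')) ≤
      (((r + 2 : ℕ) + 1) * (2 ^ (r + 2) * (T : ℝ) ^ (r + 2))) ^ m * (cA d a₀ * N) := by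
    rw [mah, hs, mah_prod]
    calc ∏ τ : L →+* ℂ, (X - C (τ b')).mahlerMeasure
        ≤ ∏ τ : L →+* ℂ, ((((r + 2 : ℕ) + 1) * (2 ^ (r + 2) * (T : ℝ) ^ (r + 2))) *
          (cj (minpoly (𝓞 L) α) τ).mahlerMeasure) := by
          refine Finset.prod_le_prod (fun τ _ => mahlerMeasure_nonneg _) (fun τ _ => ?_)
          rw [mahlerMeasure_X_sub_C, ← hev τ]
          refine max_le ?_ (eval_le_mah (by rw [hmon.natDegree_map, hdeg]) t T ht1 htT)
          have h1 : (1 : ℝ) ≤ T := by exact_mod_cast ht1.trans htT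
          have h2 := monic_one_le (hmon.map (τ.comp (algebraMap (𝓞 L) L)))
          refine one_le_mul_of_one_le_of_one_le (one_le_mul_of_one_le_of_one_le ?_
            (one_le_mul_of_one_le_of_one_le (one_le_pow₀ (by norm_num)) (one_le_pow₀ h1))) h2
          push_cast; linarith [(Nat.cast_nonneg r : (0:ℝ) ≤ r)]
      _ ≤ _ := by
          rw [Finset.prod_mul_distrib, Finset.prod_const, Finset.card_univ, hcard]
          gcongr; exact SB_mah hd hN hf hα hm hL
  have hco : ∀ i, |((minpoly ℤ (algebraMap (𝓞 L) ℂ b')).coeff i : ℝ)| ≤ Y * N := by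
    intro i
    have := coeff_le_mah (p := (minpoly ℤ (algebraMap (𝓞 L) ℂ b')).map (Int.castRingHom ℂ)) (i := i)
      (d := m) (by rw [hmon'.natDegree_map, hdeg'])
    rw [coeff_map] at this
    simp only [eq_intCast, Complex.norm_intCast] at this
    refine this.trans ?_
    rw [hY]
    calc _ ≤ 2 ^ m * ((((r + 2 : ℕ) + 1) * (2 ^ (r + 2) * (T : ℝ) ^ (r + 2))) ^ m *
          (cA d a₀ * N)) := by gcongr
      _ = _ := by ring
  exact ⟨hmon', hdeg', hco 0, fun i _ _ => hco i⟩

/-- roots of a finite set of monic polynomials -/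
lemma roots_count {F : Set ℤ[X]} (hF : F.Finite) {m : ℕ} (h : ∀ f ∈ F, f.Monic ∧ f.natDegree ≤ m) :
    {b : ℂ | ∃ f ∈ F, aeval b f = 0}.Finite ∧
    ({b : ℂ | ∃ f ∈ F, aeval b f = 0}.ncard : ℝ) ≤ F.ncard * m := by
  refine ncard_rel (fun b f => aeval b f = 0) hF (fun b hb => hb) (fun f hf => ?_)
  obtain ⟨h1, h2⟩ := h f hf
  have hsub : {b ∈ {b : ℂ | ∃ f ∈ F, aeval b f = 0} | aeval b f = 0} ⊆
      ((f.map (Int.castRingHom ℂ)).roots.toFinset : Set ℂ) := by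
    rintro b ⟨_, hb⟩
    simp only [Finset.mem_coe, Multiset.mem_toFinset]
    rw [mem_roots (h1.map _).ne_zero, IsRoot.def, eval_map]
    exact hb
  refine ⟨(Finset.finite_toSet _).subset hsub, ?_⟩
  have := Set.ncard_le_ncard hsub (Finset.finite_toSet _)
  rw [Set.ncard_coe_finset] at this
  have h3 := (Multiset.toFinset_card_le (f.map (Int.castRingHom ℂ)).roots).trans (card_roots' _)
  rw [h1.natDegree_map] at h3
  exact_mod_cast this.trans (h3.trans h2)

lemma partB_e {d : ℕ} (hd : 1 ≤ d) {a₀ : ℤ} (ha : a₀ ≠ 0) {m r : ℕ} (hm : 2 ≤ m)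
    (hmr : m * (r + 2) = d) : LB (d - 2) (SB d a₀ m r) := by
  have hcA := one_le_cA hd a₀
  obtain ⟨C, hC, Ω, hB⟩ := partB_count m r a₀.natAbs (by omega) (cA d a₀) hcA
  set T : ℕ := m * m * (r + 2) + 1 with hT
  set Y : ℝ := 2 ^ m * (((r + 2 : ℕ) + 1) * (2 ^ (r + 2) * (T : ℝ) ^ (r + 2))) ^ m * cA d a₀ with hY
  have hY0 : 0 < Y := by positivity
  set Y' : ℝ := max 1 Y with hY'
  refine ⟨((3 * (3 * Y') ^ m) * m * T) * C, by positivity, Ω, fun N hN => ?_⟩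
  have hN1 : (1 : ℝ) ≤ N := by exact_mod_cast (by omega : 1 ≤ N)
  have hY'N : 1 ≤ Y' * N := one_le_mul_of_one_le_of_one_le (le_max_left _ _) hN1
  have hBP := BP_count (n := m) (by omega) (a := Y' * N) (X := Y' * N) (by linarith) hY'N
  have hroots := roots_count hBP.1 (m := m) (fun f hf => ⟨hf.1, hf.2.1.le⟩)
  have hIf := hroots.1.prod (Finset.finite_toSet (Finset.Icc 1 T))
  have key := ncard_rel (S := SB d a₀ m r N) (fun f (q : ℂ × ℕ) => RB m r f q.1 q.2) hIf
    (B := C * (N : ℝ) ^ r * (1 + Real.log N) ^ Ω) ?_ ?_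
  · refine ⟨key.1, key.2.trans ?_⟩
    rw [Set.ncard_prod, Set.ncard_coe_finset, Nat.card_Icc]
    have hl := one_le_log' hN
    have h1 : (({b : ℂ | ∃ f ∈ BP m (Y' * N) (Y' * N), aeval b f = 0}.ncard * (T + 1 - 1) : ℕ) : ℝ) ≤
        ((3 * (3 * Y') ^ m) * m * T) * N ^ m := by
      push_cast
      calc _ ≤ ((2 * (Y' * N) + 1) * (3 * (Y' * N)) ^ (m - 1) * m) * (T : ℝ) := by
            gcongr
            refine hroots.2.trans ?_
            gcongr
            exact hBP.2
        _ ≤ (3 * ((3 * (Y' * N)) * (3 * (Y' * N)) ^ (m - 1)) * m) * (T : ℝ) := by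
            have h5 : (2 * (Y' * N) + 1) ≤ 3 * (3 * (Y' * N)) := by linarith
            rw [← mul_assoc 3 (3 * (Y' * (N : ℝ)))]
            gcongr
        _ = _ := by
            rw [← pow_succ', Nat.sub_add_cancel (by omega)]
            rw [show 3 * (Y' * N) = (3 * Y') * N by ring, mul_pow]
            ring
    calc _ ≤ (((3 * (3 * Y') ^ m) * m * T) * N ^ m) * (C * (N : ℝ) ^ r * (1 + Real.log N) ^ Ω) := by
          gcongr
      _ = (((3 * (3 * Y') ^ m) * m * T) * C) * N ^ (m + r) * (1 + Real.log N) ^ Ω := by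
          rw [pow_add]; ring
      _ ≤ _ := by
          gcongr
          rw [← hmr]
          have : m + r + 2 ≤ m * (r + 2) := by nlinarith
          omega
  · intro f hf
    obtain ⟨t, b, h1, h2, ⟨h, hh, hb⟩, hR⟩ := partB_idx hd hN hf hT hY
    refine ⟨(b, t), ⟨⟨h, ?_, hb⟩, by simp [h1, h2]⟩, hR⟩
    have : Y * N ≤ Y' * N := by gcongr; exact le_max_right _ _
    exact ⟨hh.1, hh.2.1, hh.2.2.1.trans this, fun i hi hi' => (hh.2.2.2 i hi hi').trans this⟩
  · rintro ⟨b, t⟩ ⟨-, ht⟩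
    rw [Finset.mem_coe, Finset.mem_Icc] at ht
    by_cases hemp : {x ∈ SB d a₀ m r N | RB m r x b t} = ∅
    · simp only [hemp, Set.finite_empty, Set.ncard_empty, true_and, Nat.cast_zero]
      have := one_le_log' hN
      positivity
    obtain ⟨f0, -, L0, inst, α0, b0, hR⟩ := Set.nonempty_iff_ne_empty.mpr hemp
    have hL0 : L0 = ℚ⟮b⟯ := hR.2.2.2.2.2.1
    subst hL0
    have hfib := hB N hN ℚ⟮b⟯ hR.2.2.2.1 t b0 ht.1
    set G := {g : (𝓞 ℚ⟮b⟯)[X] | g.Monic ∧ g.natDegree = r + 2 ∧ g.eval (t : 𝓞 ℚ⟮b⟯) = b0 ∧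
      (Algebra.norm ℤ (g.coeff 0)).natAbs = a₀.natAbs ∧
      ∏ τ : ℚ⟮b⟯ →+* ℂ, (g.map (τ.comp (algebraMap (𝓞 ℚ⟮b⟯) ℚ⟮b⟯))).mahlerMeasure ≤ cA d a₀ * N}
      with hG
    have key := ncard_rel (S := {x ∈ SB d a₀ m r N | RB m r x b t})
      (fun f (g : (𝓞 ℚ⟮b⟯)[X]) => f.map (Int.castRingHom ℂ) = ∏ τ : ℚ⟮b⟯ →+* ℂ, cj g τ) hfib.1
      (B := 1) ?_ ?_
    · refine ⟨key.1, key.2.trans ?_⟩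
      rw [mul_one]; exact hfib.2
    · rintro f ⟨hf, L, inst', α, b', hα, hmin, hL, hfr, hdeg, hLb, hb', hev⟩
      subst hLb
      have hbb : b' = b0 := by
        apply FaithfulSMul.algebraMap_injective (𝓞 ℚ⟮b⟯) ℂ
        rw [hb', hR.2.2.2.2.2.2.1]
      refine ⟨minpoly (𝓞 ℚ⟮b⟯) α, ⟨minpoly.monic hα.tower_top, hdeg, hbb ▸ hev,
        SB_norm hf.1 hα hmin hL, SB_mah hd hN hf.1 hα hmin hL⟩, ?_⟩
      rw [← hmin]
      exact fac_prod hα hL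
    · intro g _
      have : {x ∈ {x ∈ SB d a₀ m r N | RB m r x b t} |
          x.map (Int.castRingHom ℂ) = ∏ τ : ℚ⟮b⟯ →+* ℂ, cj g τ}.Subsingleton := by
        rintro f ⟨_, hf⟩ f' ⟨_, hf'⟩
        exact map_injective _ (RingHom.injective_int _) (hf.trans hf'.symm)
      exact ⟨this.finite, by exact_mod_cast (Set.ncard_le_one this.finite).mpr this⟩

/-- no field strictly between `ℚ` and `ℚ(α)` -/
def Mini (α : ℂ) : Prop := ∀ L : IntermediateField ℚ ℂ, L ≤ ℚ⟮α⟯ → L = ⊥ ∨ L = ℚ⟮α⟯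

theorem partB {d : ℕ} {a₀ : ℤ} (ha : a₀ ≠ 0) (hd : 1 ≤ d) : LB (d - 2) (fun N =>
    {f ∈ PF d a₀ N | Irreducible f ∧ ∃ α : ℂ, aeval α f = 0 ∧ ¬ Mini α}) := by
  have := LB.iUnion (X := ℤ[X]) (k := d - 2) (((Finset.range (d + 1)) ×ˢ (Finset.range (d + 1))).filter
    (fun q => 2 ≤ q.1 ∧ q.1 * (q.2 + 2) = d)) (F := fun q => SB d a₀ q.1 q.2) (fun q hq => by
      have := (Finset.mem_filter.mp hq).2
      exact partB_e hd ha this.1 this.2)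
  refine this.mono (fun N hN => ?_)
  rintro f ⟨hf, hirr, α, hα, hmini⟩
  have hint : IsIntegral ℤ α := ⟨f, hf.1, by rw [← aeval_def]; exact hα⟩
  have hmin := minpoly_of_irr hf.1 hirr hα
  rw [Mini] at hmini
  push Not at hmini
  obtain ⟨L, hL, h1, h2⟩ := hmini
  have := nf_le hint hL
  have hdeg := fac_deg hint hL
  rw [hmin, hf.2.1] at hdeg
  have hm : 2 ≤ Module.finrank ℚ L := by
    have h3 : 0 < Module.finrank ℚ L := Module.finrank_pos
    have h4 : Module.finrank ℚ L ≠ 1 := fun h => h1 (finrank_eq_one_iff.mp h)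
    omega
  have he : 2 ≤ (minpoly (𝓞 L) α).natDegree := by
    have h3 : 0 < (minpoly (𝓞 L) α).natDegree := minpoly.natDegree_pos hint.tower_top
    have h4 : (minpoly (𝓞 L) α).natDegree ≠ 1 := by
      intro h
      rw [h, mul_one] at hdeg
      apply h2
      have := adjoin.finiteDimensional (hint.tower_top (A := ℚ))
      refine eq_of_le_of_finrank_eq hL ?_
      rw [adjoin.finrank hint.tower_top, minpoly.isIntegrallyClosed_eq_field_fractions' ℚ hint,
        (minpoly.monic hint).natDegree_map, hmin, hf.2.1, hdeg]
    omega
  simp only [Set.mem_iUnion]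
  refine ⟨(Module.finrank ℚ L, (minpoly (𝓞 L) α).natDegree - 2), ?_, hf, L, this, α, hint, hmin, hL,
    rfl, by dsimp only; omega⟩
  rw [Finset.mem_filter, Finset.mem_product, Finset.mem_range, Finset.mem_range]
  dsimp only
  rw [Nat.sub_add_cancel he]
  refine ⟨⟨by nlinarith, ?_⟩, hm, hdeg⟩
  have : (minpoly (𝓞 L) α).natDegree ≤ d := by nlinarith
  omega

lemma zmod_local (p j : ℕ) [hp : Fact p.Prime] (hj : j ≠ 0) : IsLocalRing (ZMod (p ^ j)) := by
  have : NeZero (p ^ j) := ⟨pow_ne_zero _ hp.out.ne_zero⟩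
  have : Fact (1 < p ^ j) := ⟨Nat.one_lt_pow hj hp.out.one_lt⟩
  refine IsLocalRing.of_surjective' (PadicInt.toZModPow (p := p) j) (fun x => ⟨(x.val : ℤ_[p]), ?_⟩)
  rw [map_natCast, ZMod.natCast_val, ZMod.cast_id]

lemma idem_trace {R : Type} [CommRing R] [IsLocalRing R] {d : ℕ} (A : Matrix (Fin d) (Fin d) R)
    (hA : A * A = A) (hne : A ≠ 0) : ∃ k : ℕ, 1 ≤ k ∧ k ≤ d ∧ A.trace = (k : R) := by
  set e : (Fin d → R) →ₗ[R] (Fin d → R) := Matrix.toLin' A with he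
  have hee : IsIdempotentElem e := by
    rw [IsIdempotentElem, he, Module.End.mul_eq_comp, ← Matrix.toLin'_mul, hA]
  have hpr : Module.Projective R (LinearMap.range e) := by
    refine Module.Projective.of_split (LinearMap.range e).subtype e.rangeRestrict ?_
    ext ⟨x, y, rfl⟩ : 1
    apply Subtype.ext
    exact LinearMap.congr_fun hee y
  have hpk : Module.Projective R (LinearMap.ker e) := by
    refine Module.Projective.of_split (LinearMap.ker e).subtype
      (LinearMap.codRestrict _ (LinearMap.id - e) (fun x => ?_)) ?_
    · rw [LinearMap.mem_ker, LinearMap.sub_apply, map_sub, LinearMap.id_apply, sub_eq_zero]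
      exact (LinearMap.congr_fun hee x).symm
    · ext ⟨x, hx⟩ : 1
      apply Subtype.ext
      simp [LinearMap.mem_ker.mp hx]
  have hfr : Module.Finite R (LinearMap.range e) := inferInstance
  have hfk : Module.Finite R (LinearMap.ker e) := by
    refine Module.Finite.of_surjective (LinearMap.codRestrict (LinearMap.ker e) (LinearMap.id - e)
      (fun x => ?_)) ?_
    · rw [LinearMap.mem_ker, LinearMap.sub_apply, map_sub, LinearMap.id_apply, sub_eq_zero]
      exact (LinearMap.congr_fun hee x).symm
    · rintro ⟨x, hx⟩
      refine ⟨x, Subtype.ext ?_⟩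
      simp [LinearMap.mem_ker.mp hx]
  have h1 : Module.Free R (LinearMap.range e) := Module.free_of_flat_of_isLocalRing
  have h2 : Module.Free R (LinearMap.ker e) := Module.free_of_flat_of_isLocalRing
  have htr := (LinearMap.IsIdempotentElem.isProj_range e hee).trace
  refine ⟨Module.finrank R (LinearMap.range e), ?_, ?_, ?_⟩
  · rw [Nat.one_le_iff_ne_zero]
    intro h0
    rw [Module.finrank_eq_zero_iff_of_free] at h0
    apply hne
    have : e = 0 := by
      ext1 i
      ext1
      have := Subsingleton.elim (⟨e (Pi.single i 1), LinearMap.mem_range_self e _⟩ :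
        LinearMap.range e) 0
      simpa using congrArg Subtype.val this
    exact (Matrix.toLin' (R := R) (m := Fin d) (n := Fin d)).map_eq_zero_iff.mp this
  · refine (LinearMap.finrank_range_le e).trans ?_
    simp
  · rw [← htr, he, Matrix.trace_toLin'_eq]

lemma idem_intTrace (K : Type) [Field K] [NumberField K] (p j : ℕ) [hp : Fact p.Prime]
    (hj : Module.finrank ℚ K < p ^ j) (hj0 : j ≠ 0) (x : 𝓞 K)
    (hx : ((p ^ j : ℕ) : 𝓞 K) ∣ x * x - x) (hx0 : ¬ ((p ^ j : ℕ) : 𝓞 K) ∣ x) :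
    Algebra.intTrace ℤ (𝓞 K) x ∉ Ideal.span {((p ^ j : ℕ) : ℤ)} := by
  have := zmod_local p j hj0
  set b := Module.finBasisOfFinrankEq ℤ (𝓞 K) (RingOfIntegers.rank K) with hb
  set n := p ^ j with hn
  have hn0 : n ≠ 0 := pow_ne_zero _ hp.out.ne_zero
  set A : Matrix _ _ ℤ := Algebra.leftMulMatrix b x with hA
  set A' := A.map (Int.castRingHom (ZMod n)) with hA'
  have hzero : ∀ y : 𝓞 K, (n : 𝓞 K) ∣ y ↔
      (Algebra.leftMulMatrix b y).map (Int.castRingHom (ZMod n)) = 0 := by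
    intro y
    constructor
    · rintro ⟨z, rfl⟩
      rw [_root_.map_mul, Matrix.map_mul, map_natCast]
      ext i k
      simp [Matrix.mul_apply, Matrix.natCast_apply]
    · intro h
      have h1 : ∀ i k, (n : ℤ) ∣ Algebra.leftMulMatrix b y i k := by
        intro i k
        have := congrFun (congrFun h i) k
        simpa [ZMod.intCast_zmod_eq_zero_iff_dvd] using this
      have h2 := Algebra.leftMulMatrix_mulVec_repr b y 1
      rw [mul_one] at h2
      have h3 : ∀ i, (n : ℤ) ∣ b.repr y i := by
        intro i
        rw [← h2]
        rw [Matrix.mulVec, dotProduct]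
        exact Finset.dvd_sum (fun k _ => Dvd.dvd.mul_right (h1 i k) _)
      choose c hc using h3
      refine ⟨∑ i, c i • b i, ?_⟩
      rw [← b.sum_repr y, Finset.mul_sum]
      refine Finset.sum_congr rfl (fun i _ => ?_)
      rw [hc i, mul_smul]
      simp
  have hidem : A' * A' = A' := by
    have h := (hzero _).mp hx
    rw [_root_.map_sub, _root_.map_mul] at h
    rw [hA', ← Matrix.map_mul, ← sub_eq_zero, ← h]
    ext i k
    simp [hA]
  obtain ⟨k, hk1, hkd, htr⟩ := idem_trace A' hidem (fun h => hx0 ((hzero x).mpr h))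
  rw [Algebra.intTrace_eq_trace, Algebra.trace_eq_matrix_trace b, Ideal.mem_span_singleton]
  intro hdvd
  have h1 : A'.trace = ((A.trace : ℤ) : ZMod n) := by
    simp [hA', Matrix.trace]
  rw [h1, (ZMod.intCast_zmod_eq_zero_iff_dvd _ n).mpr hdvd] at htr
  have := (ZMod.natCast_eq_zero_iff k n).mp htr.symm
  have := Nat.le_of_dvd (by omega) this
  omega

/-- at most `n` distinct roots mod `p` (with multiplicity by degree) -/
def Zc (p : ℕ) [Fact p.Prime] (n : ℕ) (f : ℤ[X]) : Prop :=
  ∃ u : (ZMod p)[X], u.Monic ∧ u.natDegree ≤ n ∧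
    ∀ z : AlgebraicClosure (ZMod p), eval₂ (Int.castRingHom _) z f = 0 → aeval z u = 0

lemma diff_local (K : Type) [Field K] [NumberField K] (p j : ℕ) [hp : Fact p.Prime]
    (hj : Module.finrank ℚ K < p ^ j) (hj0 : j ≠ 0) (P : Ideal (𝓞 K)) (hP : P.IsPrime)
    (hP0 : P ≠ ⊥) (E : ℕ) (hE0 : E ≠ 0) (hE : P ^ E ∣ Ideal.span {((p ^ j : ℕ) : 𝓞 K)})
    (hE' : ¬ P ^ (E + 1) ∣ Ideal.span {((p ^ j : ℕ) : 𝓞 K)}) :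
    ¬ P ^ E ∣ differentIdeal ℤ (𝓞 K) := by
  obtain ⟨Q, hQ⟩ := hE
  have hPQ : ¬ P ∣ Q := by
    rintro ⟨c, rfl⟩
    apply hE'
    rw [hQ]
    exact ⟨c, by ring⟩
  have hmax : P.IsMaximal := hP.isMaximal hP0
  have hcop : IsCoprime (P ^ E) Q := by
    apply IsCoprime.pow_left
    rw [Ideal.isCoprime_iff_sup_eq]
    by_contra h
    have := hmax.eq_of_le h le_sup_left
    exact hPQ (Ideal.dvd_iff_le.mpr (this ▸ le_sup_right))
  rw [Ideal.isCoprime_iff_exists] at hcop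
  obtain ⟨y, hy, x, hx, hxy⟩ := hcop
  have hx1 : x * x - x = -(y * x) := by linear_combination x * hxy
  refine not_dvd_differentIdeal_of_intTrace_not_mem ℤ (p := Ideal.span {((p ^ j : ℕ) : ℤ)})
    (P ^ E) Q ?_ x hx ?_
  · rw [← hQ, Ideal.map_span, Set.image_singleton]
    simp
  · apply idem_intTrace K p j hj hj0 x
    · rw [hx1, dvd_neg, ← Ideal.mem_span_singleton, hQ]
      exact Ideal.mul_mem_mul hy hx
    · intro h
      rw [← Ideal.mem_span_singleton, hQ] at h
      have h0 : P ^ E * Q ≤ P ^ E := Ideal.mul_le_left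
      have h1 : x ∈ P := Ideal.pow_le_self hE0 (h0 h)
      have h2 : y ∈ P := Ideal.pow_le_self hE0 hy
      exact hP.ne_top ((Ideal.eq_top_iff_one _).mpr (hxy ▸ P.add_mem h2 h1))

lemma ideal_pow_exact {K : Type} [Field K] [NumberField K] {P J : Ideal (𝓞 K)} (hP : P.IsPrime)
    (hP0 : P ≠ ⊥) (hJ : J ≠ ⊥) : ∃ E, P ^ E ∣ J ∧ ¬ P ^ (E + 1) ∣ J := by
  have hPp : Prime P := Ideal.prime_of_isPrime hP0 hP
  have hf : FiniteMultiplicity P J := FiniteMultiplicity.of_prime_left hPp hJ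
  exact ⟨multiplicity P J, pow_multiplicity_dvd _ _, hf.not_pow_dvd_of_multiplicity_lt (Nat.lt_succ_self _)⟩

lemma ideal_split {K : Type} [Field K] [NumberField K] {I J : Ideal (𝓞 K)} (hJ : J ≠ ⊥)
    (h : ∀ P : Ideal (𝓞 K), P.IsPrime → P ≠ ⊥ → ∀ E, E ≠ 0 → P ^ E ∣ J → ¬ P ^ (E + 1) ∣ J →
      ¬ P ^ E ∣ I) :
    ∃ G H : Ideal (𝓞 K), I = G * H ∧ G.absNorm * J.radical.absNorm ∣ J.absNorm ∧
      ∀ P : Ideal (𝓞 K), P.IsPrime → P ∣ J → ¬ P ∣ H := by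
  have hGI : I ⊔ J ∣ I := Ideal.dvd_iff_le.mpr le_sup_left
  have hGJ : I ⊔ J ∣ J := Ideal.dvd_iff_le.mpr le_sup_right
  obtain ⟨H, hH⟩ := hGI
  obtain ⟨J1, hJ1⟩ := hGJ
  have hgcd : ∀ A : Ideal (𝓞 K), A ∣ I → A ∣ J → A ∣ I ⊔ J := fun A h1 h2 =>
    Ideal.dvd_iff_le.mpr (sup_le (Ideal.dvd_iff_le.mp h1) (Ideal.dvd_iff_le.mp h2))
  have hne : ∀ P : Ideal (𝓞 K), P ∣ J → P ≠ ⊥ := by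
    rintro P hd rfl
    exact hJ (zero_dvd_iff.mp hd)
  have hE0 : ∀ P : Ideal (𝓞 K), P ∣ J → ∀ E, ¬ P ^ (E + 1) ∣ J → E ≠ 0 := by
    rintro P hd E h1 rfl
    exact h1 (by simpa using hd)
  refine ⟨I ⊔ J, H, hH, ?_, ?_⟩
  · conv_rhs => rw [hJ1, _root_.map_mul]
    apply mul_dvd_mul_left
    apply Ideal.absNorm_dvd_absNorm_of_le
    rw [Ideal.radical_eq_sInf]
    refine le_sInf ?_
    rintro P ⟨hJP, hP⟩
    have hPJ : P ∣ J := Ideal.dvd_iff_le.mpr hJP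
    have hP0 := hne P hPJ
    obtain ⟨E, h1, h2⟩ := ideal_pow_exact hP hP0 hJ
    have h3 := h P hP hP0 E (hE0 P hPJ E h2) h1 h2
    by_contra hcon
    have hcon' : ¬ P ∣ J1 := fun hh => hcon (Ideal.dvd_iff_le.mp hh)
    apply h3
    rw [hJ1] at h1
    have := (Ideal.prime_of_isPrime hP0 hP).pow_dvd_of_dvd_mul_right E hcon' h1
    rw [hH]
    exact this.mul_right _
  · intro P hP hPJ hPH
    have hP0 := hne P hPJ
    obtain ⟨E, h1, h2⟩ := ideal_pow_exact hP hP0 hJ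
    have h3 := h P hP hP0 E (hE0 P hPJ E h2) h1 h2
    have hG0 : I ⊔ J ≠ ⊥ := fun h0 => by
      rw [h0, ← Ideal.zero_eq_bot, zero_mul] at hJ1
      exact hJ hJ1
    obtain ⟨a, h4, h5⟩ := ideal_pow_exact hP hP0 hG0
    have h6 : P ^ (a + 1) ∣ I := by
      rw [hH, pow_succ]
      exact mul_dvd_mul h4 hPH
    have h7 : a + 1 ≤ E := by
      by_contra hlt
      exact h3 ((pow_dvd_pow P (by omega : E ≤ a + 1)).trans h6)
    exact h5 (hgcd _ h6 ((pow_dvd_pow P h7).trans h1))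

lemma zc_aux {d p : ℕ} [Fact p.Prime] (A : Matrix (Fin d) (Fin d) ℤ) (V : ℤ[X])
    (hV : (aeval A V).map (Int.castRingHom (ZMod p)) = 0) {F : Type} [Field F] [Algebra (ZMod p) F]
    (z : F) (hz : eval₂ (Int.castRingHom F) z A.charpoly = 0) : eval₂ (Int.castRingHom F) z V = 0 := by
  set B : Matrix (Fin d) (Fin d) F := A.map (Int.castRingHom F) with hB
  have h1 : z ∈ spectrum F B := by
    rw [Matrix.mem_spectrum_iff_isRoot_charpoly, hB, Matrix.charpoly_map, IsRoot.def, eval_map]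
    exact hz
  have h2 : aeval B (V.map (Int.castRingHom F)) = 0 := by
    have h3 : aeval B (V.map (Int.castRingHom F)) = (aeval A V).map (Int.castRingHom F) := by
      rw [aeval_def, eval₂_map]
      have := hom_eval₂ V (algebraMap ℤ (Matrix (Fin d) (Fin d) ℤ))
        (Int.castRingHom F).mapMatrix A
      rw [aeval_def]
      refine Eq.trans ?_ this.symm
      congr 1
      exact RingHom.ext_int _ _
    rw [h3]
    have h4 : (Int.castRingHom F) = (algebraMap (ZMod p) F).comp (Int.castRingHom (ZMod p)) :=
      RingHom.ext_int _ _
    rw [h4, RingHom.coe_comp, ← Matrix.map_map, hV]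
    ext i j; simp
  have h5 := spectrum.subset_polynomial_aeval B (V.map (Int.castRingHom F)) ⟨z, h1, rfl⟩
  have : Nontrivial (Matrix (Fin d) (Fin d) F) := by
    by_contra hnt
    rw [not_nontrivial_iff_subsingleton] at hnt
    rw [spectrum.of_subsingleton] at h1
    exact h1
  rw [h2, spectrum.zero_eq] at h5
  have h6 : eval z (V.map (Int.castRingHom F)) = 0 := h5
  rw [eval_map] at h6
  exact h6

lemma leftMul_zero (K : Type) [Field K] [NumberField K] {d n : ℕ} (b : Module.Basis (Fin d) ℤ (𝓞 K))
    (y : 𝓞 K) (h : (n : 𝓞 K) ∣ y) :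
    (Algebra.leftMulMatrix b y).map (Int.castRingHom (ZMod n)) = 0 := by
  obtain ⟨z, rfl⟩ := h
  rw [_root_.map_mul, Matrix.map_mul, map_natCast]
  ext i k
  simp [Matrix.mul_apply, Matrix.natCast_apply]

lemma zc_field (K : Type) [Field K] [NumberField K] (p j : ℕ) [hp : Fact p.Prime]
    (hj : Module.finrank ℚ K < p ^ j) (hj0 : j ≠ 0) (v : ℕ) (hv : (p : ℤ) ^ v ∣ discr K) :
    v ≤ Module.finrank ℚ K * j ∧
    ∀ β : 𝓞 K, Zc p (Module.finrank ℚ K * j - v) (minpoly ℤ β) := by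
  set d := Module.finrank ℚ K with hd
  set J : Ideal (𝓞 K) := Ideal.span {((p ^ j : ℕ) : 𝓞 K)} with hJ
  have hn0 : ((p ^ j : ℕ) : 𝓞 K) ≠ 0 := by exact_mod_cast pow_ne_zero _ hp.out.ne_zero
  have hJ0 : J ≠ ⊥ := by rwa [hJ, Ne, Ideal.span_singleton_eq_bot]
  obtain ⟨G, H, hGH, hdvd, hH⟩ := ideal_split (I := differentIdeal ℤ (𝓞 K)) hJ0
    (fun P hP hP0 E hE0 h1 h2 => diff_local K p j hj hj0 P hP hP0 E hE0 h1 h2)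
  have hnormJ : J.absNorm = p ^ (d * j) := by
    rw [hJ, Ideal.absNorm_span_singleton, ← map_natCast (algebraMap ℤ (𝓞 K)), Algebra.norm_algebraMap,
      RingOfIntegers.rank, ← hd, Int.natAbs_pow, Int.natAbs_natCast, ← pow_mul, mul_comm]
  have hpH : ¬ p ∣ H.absNorm := by
    intro h
    obtain ⟨P, hP, hPu, hPd⟩ := Ideal.exists_isMaximal_dvd_of_dvd_absNorm
      (Nat.prime_iff_prime_int.mp hp.out) H (by exact_mod_cast h)
    refine hH P hP.isPrime ?_ hPd
    rw [Ideal.dvd_iff_le, hJ, Ideal.span_singleton_le_iff_mem]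
    have : (p : ℤ) ∈ Ideal.under ℤ P := by rw [hPu]; exact Ideal.mem_span_singleton_self _
    rw [Ideal.under, Ideal.mem_comap] at this
    push_cast
    exact Ideal.pow_mem_of_mem _ (by simpa using this) _ (by omega)
  have hvG : p ^ v ∣ G.absNorm := by
    have h1 : p ^ v ∣ (differentIdeal ℤ (𝓞 K)).absNorm := by
      rw [NumberField.absNorm_differentIdeal K (𝓞 K), ← Int.natCast_dvd]
      exact_mod_cast hv
    rw [hGH, _root_.map_mul] at h1
    exact (Nat.Coprime.pow_left v ((Nat.Prime.coprime_iff_not_dvd hp.out).mpr hpH)).dvd_of_dvd_mul_right h1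
  set R := J.radical with hR
  have hpR : (p : 𝓞 K) ∈ R := ⟨j, by rw [hJ]; push_cast; exact Ideal.mem_span_singleton_self _⟩
  have hRtop : R ≠ ⊤ := by
    rw [hR, Ne, Ideal.radical_eq_top]
    intro h
    rw [h, Ideal.absNorm_top] at hnormJ
    have hd0 : 0 < d := Module.finrank_pos
    have := Nat.one_lt_pow (n := d * j) (by positivity) hp.out.one_lt
    omega
  have hnt : Nontrivial (𝓞 K ⧸ R) := Ideal.Quotient.nontrivial_iff.mpr hRtop
  have hchar : CharP (𝓞 K ⧸ R) p := by
    apply ringChar.of_eq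
    apply CharP.ringChar_of_prime_eq_zero hp.out
    rw [← map_natCast (Ideal.Quotient.mk R)]
    exact Ideal.Quotient.eq_zero_iff_mem.mpr hpR
  let _ : Algebra (ZMod p) (𝓞 K ⧸ R) := ZMod.algebra _ p
  have hR0 : R.absNorm ≠ 0 := by
    intro h0
    rw [h0, mul_zero, zero_dvd_iff, hnormJ] at hdvd
    exact pow_ne_zero _ hp.out.ne_zero hdvd
  have hfin : Finite (𝓞 K ⧸ R) := by
    rw [Ideal.absNorm_apply, Submodule.cardQuot_apply] at hR0
    exact Nat.finite_of_card_ne_zero hR0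
  have hfinm : Module.Finite (ZMod p) (𝓞 K ⧸ R) := Module.Finite.of_finite
  have hcard : R.absNorm = p ^ Module.finrank (ZMod p) (𝓞 K ⧸ R) := by
    rw [Ideal.absNorm_apply, Submodule.cardQuot_apply]
    have := Module.natCard_eq_pow_finrank (K := ZMod p) (V := 𝓞 K ⧸ R)
    rwa [Nat.card_zmod] at this
  set m := Module.finrank (ZMod p) (𝓞 K ⧸ R) with hm
  have hle : v + m ≤ d * j := by
    rw [hnormJ, hcard] at hdvd
    have := (mul_dvd_mul_right hvG (p ^ m)).trans hdvd
    rw [← pow_add] at this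
    exact (Nat.pow_dvd_pow_iff_le_right hp.out.one_lt).mp this
  refine ⟨by omega, fun β => ?_⟩
  set L := Algebra.lmul (ZMod p) (𝓞 K ⧸ R) (Ideal.Quotient.mk R β) with hL
  refine ⟨L.charpoly, L.charpoly_monic, by rw [LinearMap.charpoly_natDegree]; omega, fun z hz => ?_⟩
  obtain ⟨U, hU⟩ := map_surjective (Int.castRingHom (ZMod p)) (ZMod.ringHom_surjective _) L.charpoly
  have hUR : aeval β U ∈ R := by
    have h1 := L.aeval_self_charpoly
    rw [hL, aeval_algHom_apply] at h1
    have h2 : aeval (Ideal.Quotient.mk R β) L.charpoly = 0 :=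
      Algebra.lmul_injective (R := ZMod p) (h1.trans (map_zero _).symm)
    rw [← hU, aeval_def, eval₂_map, RingHom.ext_int (RingHom.comp _ _) ((Ideal.Quotient.mk R).comp
      (algebraMap ℤ (𝓞 K))), ← hom_eval₂] at h2
    exact Ideal.Quotient.eq_zero_iff_mem.mp h2
  obtain ⟨k, hk⟩ := Ideal.exists_radical_pow_le_of_fg J (IsNoetherian.noetherian _)
  have hUk : (p : 𝓞 K) ∣ aeval β (U ^ k) := by
    rw [_root_.map_pow]
    have h1 := hk (Ideal.pow_mem_pow hUR k)
    rw [hJ, Ideal.mem_span_singleton] at h1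
    refine dvd_trans ?_ h1
    push_cast
    exact dvd_pow_self _ hj0
  set b := Module.finBasisOfFinrankEq ℤ (𝓞 K) (RingOfIntegers.rank K) with hb
  have h1 := leftMul_zero K b _ hUk
  rw [← aeval_algHom_apply] at h1
  have h2 := zc_aux _ _ h1 z ?_
  · rw [eval₂_pow] at h2
    have h3 := eq_zero_of_pow_eq_zero h2
    rw [← hU, aeval_def, eval₂_map, RingHom.ext_int (RingHom.comp _ _) (Int.castRingHom _)]
    exact h3
  · have h3 : minpoly ℤ β ∣ (Algebra.leftMulMatrix b β).charpoly := by
      apply minpoly.isIntegrallyClosed_dvd (RingOfIntegers.isIntegral β)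
      apply Algebra.leftMulMatrix_injective b
      rw [map_zero, ← aeval_algHom_apply, Matrix.aeval_self_charpoly]
    obtain ⟨q, hq⟩ := h3
    rw [hq, eval₂_mul, hz, zero_mul]

lemma zc_of_res (p : ℕ) [hp : Fact p.Prime] (n : ℕ) (f : ℤ[X]) (hf : f.Monic) (k : Type) [Field k] [CharP k p]
    (hs : (f.map (Int.castRingHom k)).Splits) (hn : (f.rootSet k).ncard ≤ n) : Zc p n f := by
  classical
  let := ZMod.algebra k p
  set F := f.map (Int.castRingHom (ZMod p)) with hF
  have hFm : F.Monic := hf.map _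
  have hF0 : F ≠ 0 := hFm.ne_zero
  set r := UniqueFactorizationMonoid.radical F with hr
  have hr0 : r ≠ 0 := UniqueFactorizationMonoid.radical_ne_zero
  set u := normalize r with hu
  have hum : u.Monic := monic_normalize hr0
  have hass : Associated u r := normalize_associated r
  have hsq : Squarefree u := (hass.squarefree_iff).2 UniqueFactorizationMonoid.squarefree_radical
  have hsep : u.Separable := PerfectField.separable_iff_squarefree.2 hsq
  have hdvd : u ∣ F := hass.dvd.trans UniqueFactorizationMonoid.radical_dvd_self
  have hFk : F.map (algebraMap (ZMod p) k) = f.map (Int.castRingHom k) := by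
    rw [hF, Polynomial.map_map]; congr 1; exact RingHom.ext_int _ _
  have hsu : (u.map (algebraMap (ZMod p) k)).Splits := by
    refine Polynomial.Splits.of_dvd (hFk ▸ hs) ?_ (Polynomial.map_dvd _ hdvd)
    rw [hFk]; exact (hf.map _).ne_zero
  refine ⟨u, hum, ?_, ?_⟩
  · rw [← card_rootSet_eq_natDegree hsep hsu, ← Nat.card_eq_fintype_card]
    refine le_trans ?_ hn
    change (u.rootSet k).ncard ≤ _
    refine Set.ncard_le_ncard ?_ (Set.toFinite _)
    intro x hx
    rw [mem_rootSet] at hx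
    rw [mem_rootSet']
    refine ⟨(hf.map _).ne_zero, ?_⟩
    have : aeval x F = 0 := by
      obtain ⟨c, hc⟩ := hdvd
      rw [hc, _root_.map_mul, hx.2, zero_mul]
    rw [aeval_def, eval₂_eq_eval_map, hFk] at this
    rw [aeval_def, eval₂_eq_eval_map]
    exact this
  · intro z hz
    obtain ⟨m, hm⟩ := UniqueFactorizationMonoid.exists_dvd_radical_self_pow hF0
    have h1 : F ∣ u ^ m := hm.trans (hass.symm.pow_pow).dvd
    have h2 : aeval z F = 0 := by
      rw [aeval_def, hF, eval₂_map]
      rw [← hz]; congr 1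
    obtain ⟨c, hc⟩ := h1
    have h3 : (aeval z u) ^ m = 0 := by rw [← _root_.map_pow, hc, _root_.map_mul, h2, zero_mul]
    exact eq_zero_of_pow_eq_zero h3

lemma exists_inertia (S : Type) [Field S] [NumberField S] [IsGalois ℚ S] (p : ℕ) [hp : Fact p.Prime]
    (h : (p : ℤ) ∣ discr S) : ∃ P : Ideal (𝓞 S), P.IsMaximal ∧ (p : 𝓞 S) ∈ P ∧
      ∃ g : S ≃ₐ[ℚ] S, g ≠ 1 ∧ g ∈ P.inertia (S ≃ₐ[ℚ] S) := by
  have hpp := Nat.prime_iff_prime_int.1 hp.out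
  by_contra! hc
  refine (not_dvd_discr_iff_forall_liesOver S (𝓞 S) hpp).2 ?_ h
  intro P hP hl
  have hmem : (p : 𝓞 S) ∈ P := by
    have := (Ideal.liesOver_span_iff hP.ne_top hpp).1 hl
    simpa using this
  have h1 := hc P hP hmem
  have hprime := hP.isPrime
  have hpP : (Ideal.span {(p:ℤ)}).IsPrime := (Ideal.span_singleton_prime hpp.ne_zero).2 hpp
  have h2 : Nat.card (P.inertia (S ≃ₐ[ℚ] S)) = 1 := by
    rw [Nat.card_eq_one_iff_unique]
    refine ⟨⟨fun a b => ?_⟩, ⟨1⟩⟩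
    ext1
    rw [not_imp_not.1 (h1 a) a.2, not_imp_not.1 (h1 b) b.2]
  have hmx : (Ideal.span {(p:ℤ)}).IsMaximal := hpP.isMaximal (by simpa using hp.out.ne_zero)
  have : PerfectField (Ideal.span {(p:ℤ)}).ResidueField := by
    infer_instance
  rw [Ideal.card_inertia_eq_ramificationIdxIn (Ideal.span {(p:ℤ)}) P,
    Ideal.ramificationIdxIn_eq_ramificationIdx (Ideal.span {(p:ℤ)}) P (S ≃ₐ[ℚ] S)] at h2
  have hu : P.under ℤ = Ideal.span {(p:ℤ)} := hl.over.symm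
  have key : ∀ (I : Ideal ℤ) (_ : I.IsPrime), I = Ideal.span {(p:ℤ)} → PerfectField I.ResidueField := by
    rintro _ _ rfl; infer_instance
  have : PerfectField (P.under ℤ).ResidueField := key _ _ hu
  exact Ideal.ramificationIdx_eq_one_iff.1 h2

set_option linter.unusedVariables false in
lemma swap_or_zc (S : Type) [Field S] [NumberField S] [IsGalois ℚ S] (p : ℕ) [hp : Fact p.Prime]
    (h : (p : ℤ) ∣ discr S) (f : ℤ[X]) (hf : f.Monic)
    (hs : (f.map (algebraMap ℤ (𝓞 S))).Splits) (n : ℕ) (hn : (f.rootSet (𝓞 S)).ncard ≤ n + 2)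
    (hfaith : ∀ g : S ≃ₐ[ℚ] S, (∀ x : f.rootSet (𝓞 S), g • x = x) → g = 1)
    [DecidableEq (f.rootSet (𝓞 S))] :
    (∃ g : S ≃ₐ[ℚ] S, (MulAction.toPermHom (S ≃ₐ[ℚ] S) (f.rootSet (𝓞 S)) g).IsSwap) ∨ Zc p n f := by
  obtain ⟨P, hP, hpP, g, hg1, hg⟩ := exists_inertia S p h
  by_cases hc : (f.rootSet (𝓞 S ⧸ P)).ncard ≤ n
  · right
    let := Ideal.Quotient.field P
    have : CharP (𝓞 S ⧸ P) p := by
      refine (CharP.charP_iff_prime_eq_zero hp.out).2 ?_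
      rw [← map_natCast (Ideal.Quotient.mk P)]
      exact Ideal.Quotient.eq_zero_iff_mem.2 hpP
    refine zc_of_res p n f hf (𝓞 S ⧸ P) ?_ hc
    have := hs.map (Ideal.Quotient.mk P)
    rw [Polynomial.map_map] at this
    rwa [RingHom.ext_int ((Ideal.Quotient.mk P).comp (algebraMap ℤ (𝓞 S))) (Int.castRingHom _)] at this
  · left
    refine ⟨g, ?_⟩
    have := hs.toPermHom_apply_eq_one_or_isSwap_of_ncard_le_of_mem_inertia (G := S ≃ₐ[ℚ] S) P (by omega) g hg
    refine this.resolve_left fun h1 => hg1 (hfaith g fun x => ?_)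
    have := congrArg (fun e => e x) h1
    exact this


lemma perm_top (S : Type) [Field S] [NumberField S] [IsGalois ℚ S] (f : ℤ[X]) (hf : f.Monic)
    (hirr : Irreducible f) (a : 𝓞 S) (ha : aeval a f = 0)
    (hmini : ∀ L : IntermediateField ℚ S, L ≤ ℚ⟮(a:S)⟯ → L = ⊥ ∨ L = ℚ⟮(a:S)⟯)
    (hnt : Nontrivial (f.rootSet (𝓞 S)))
    [DecidableEq (f.rootSet (𝓞 S))]
    (hsw : ∃ g : S ≃ₐ[ℚ] S, (MulAction.toPermHom (S ≃ₐ[ℚ] S) (f.rootSet (𝓞 S)) g).IsSwap) :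
    Function.Surjective (MulAction.toPermHom (S ≃ₐ[ℚ] S) (f.rootSet (𝓞 S))) := by
  have hirrQ : Irreducible (f.map (algebraMap ℤ ℚ)) := (hf.irreducible_iff_irreducible_map_fraction_map).1 hirr
  have hmq : ∀ x : 𝓞 S, aeval x f = 0 → minpoly ℚ (x : S) = f.map (algebraMap ℤ ℚ) := by
    intro x hx
    refine (minpoly.eq_of_irreducible_of_monic hirrQ ?_ (hf.map _)).symm
    rw [aeval_map_algebraMap]
    have := congrArg (algebraMap (𝓞 S) S) hx
    rw [map_zero, ← aeval_algebraMap_apply] at this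
    exact this
  have htr : MulAction.IsPretransitive (S ≃ₐ[ℚ] S) (f.rootSet (𝓞 S)) := by
    refine ⟨fun x y => ?_⟩
    have hx := (mem_rootSet.1 x.2).2
    have hy := (mem_rootSet.1 y.2).2
    have : IsConjRoot ℚ ((y : 𝓞 S) : S) ((x : 𝓞 S) : S) := by
      rw [isConjRoot_def, hmq _ hx, hmq _ hy]
    obtain ⟨σ, hσ⟩ := this.exists_algEquiv
    refine ⟨σ, ?_⟩
    ext
    rw [rootSet.coe_smul]
    exact hσ
  have haR : a ∈ f.rootSet (𝓞 S) := mem_rootSet.2 ⟨hf.ne_zero, ha⟩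
  have hstab : MulAction.stabilizer (S ≃ₐ[ℚ] S) (⟨a, haR⟩ : f.rootSet (𝓞 S)) = ℚ⟮(a:S)⟯.fixingSubgroup := by
    ext g
    rw [MulAction.mem_stabilizer_iff, IntermediateField.mem_fixingSubgroup_iff]
    have h1 : g • (⟨a, haR⟩ : f.rootSet (𝓞 S)) = ⟨a, haR⟩ ↔ g (a : S) = a := by
      rw [Subtype.ext_iff, rootSet.coe_smul, RingOfIntegers.ext_iff]
      exact Iff.rfl
    rw [h1]
    constructor
    · intro h y hy
      have : ℚ⟮(a:S)⟯ ≤ IntermediateField.fixedField (Subgroup.zpowers g) := by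
        rw [adjoin_simple_le_iff]
        rw [IntermediateField.mem_fixedField_iff]
        intro k hk
        have : Subgroup.zpowers g ≤ MulAction.stabilizer (S ≃ₐ[ℚ] S) (a:S) := by
          rw [Subgroup.zpowers_le]
          exact h
        exact this hk
      exact (IntermediateField.mem_fixedField_iff _ _).1 (this hy) g (Subgroup.mem_zpowers g)
    · intro h
      exact h a (mem_adjoin_simple_self ℚ _)
  have hcoat : IsCoatom (MulAction.stabilizer (S ≃ₐ[ℚ] S) (⟨a, haR⟩ : f.rootSet (𝓞 S))) := by
    constructor
    · intro htop
      obtain ⟨x, hx⟩ := exists_ne (⟨a, haR⟩ : f.rootSet (𝓞 S))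
      obtain ⟨g, hg⟩ := htr.exists_smul_eq ⟨a, haR⟩ x
      have : g ∈ MulAction.stabilizer (S ≃ₐ[ℚ] S) (⟨a, haR⟩ : f.rootSet (𝓞 S)) := htop ▸ Subgroup.mem_top g
      rw [MulAction.mem_stabilizer_iff, hg] at this
      exact hx this
    · intro H hH
      rw [hstab] at hH
      have h1 : IntermediateField.fixedField H ≤ ℚ⟮(a:S)⟯ := by
        rw [← IsGalois.fixedField_fixingSubgroup ℚ⟮(a:S)⟯]
        exact IntermediateField.fixedField_antitone hH.le
      have h2 := IntermediateField.fixingSubgroup_fixedField H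
      rcases hmini _ h1 with h | h
      · rw [← h2, h, IntermediateField.fixingSubgroup_bot]
      · rw [h] at h2
        exact absurd h2 hH.ne
  have hprim := (MulAction.isCoatom_stabilizer_iff_preprimitive (S ≃ₐ[ℚ] S) (⟨a, haR⟩ : f.rootSet (𝓞 S))).1 hcoat
  set φ := MulAction.toPermHom (S ≃ₐ[ℚ] S) (f.rootSet (𝓞 S)) with hφ
  have hp2 : MulAction.IsPreprimitive φ.range (f.rootSet (𝓞 S)) := by
    let F : (f.rootSet (𝓞 S)) →ₑ[φ.rangeRestrict] (f.rootSet (𝓞 S)) := ⟨id, fun g x => rfl⟩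
    exact MulAction.IsPreprimitive.of_surjective (f := F) Function.surjective_id
  obtain ⟨g, hg⟩ := hsw
  exact MonoidHom.range_eq_top.1 (Equiv.Perm.subgroup_eq_top_of_isPreprimitive_of_isSwap_mem hp2 _ hg ⟨g, rfl⟩)

/-- the Galois closure has full symmetric Galois group -/
def Full (α : ℂ) : Prop :=
  Module.finrank ℚ (normalClosure ℚ ℚ⟮α⟯ ℂ) = (Module.finrank ℚ ℚ⟮α⟯).factorial

lemma nc_eq (α : ℂ) (hα : IsIntegral ℚ α) :
    normalClosure ℚ ℚ⟮α⟯ ℂ = IntermediateField.adjoin ℚ ((minpoly ℚ α).rootSet ℂ) := by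
  apply le_antisymm
  · rw [normalClosure_le_iff]
    intro φ
    rintro y ⟨x, hx⟩
    obtain ⟨q, hq⟩ := (adjoin.powerBasis hα).exists_eq_aeval' x
    rw [adjoin.powerBasis_gen] at hq
    have hm : φ (AdjoinSimple.gen ℚ α) ∈ IntermediateField.adjoin ℚ ((minpoly ℚ α).rootSet ℂ) := by
      apply subset_adjoin
      refine mem_rootSet.2 ⟨minpoly.ne_zero hα, ?_⟩
      rw [aeval_algHom_apply]
      have : aeval (AdjoinSimple.gen ℚ α) (minpoly ℚ α) = 0 := by
        rw [← minpoly_gen]; exact minpoly.aeval _ _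
      rw [this, map_zero]
    have h1 : y = aeval (φ (AdjoinSimple.gen ℚ α)) q := by
      rw [aeval_algHom_apply, ← hx, hq]; rfl
    rw [h1]
    have h2 := aeval_algHom_apply (IntermediateField.adjoin ℚ ((minpoly ℚ α).rootSet ℂ)).val ⟨_, hm⟩ q
    exact h2 ▸ SetLike.coe_mem _
  · rw [adjoin_le_iff]
    intro y hy
    have hy' : y ∈ (minpoly ℚ α).aroots ℂ := by
      rw [rootSet] at hy
      simpa using hy
    let φ := (IntermediateField.algHomAdjoinIntegralEquiv ℚ (K := ℂ) hα).symm ⟨y, hy'⟩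
    have : φ (AdjoinSimple.gen ℚ α) = y := by
      exact IntermediateField.algHomAdjoinIntegralEquiv_symm_apply_gen ℚ hα ⟨y, hy'⟩
    exact φ.fieldRange_le_normalClosure ⟨_, this⟩

lemma nc_split (α : ℂ) (hα : IsIntegral ℚ α) :
    (minpoly ℚ α).IsSplittingField ℚ (normalClosure ℚ ℚ⟮α⟯ ℂ) := by
  rw [nc_eq α hα]
  exact adjoin_rootSet_isSplittingField (IsAlgClosed.splits _)

lemma full_surj (f : ℤ[X]) (hf : f.Monic) (hirr : Irreducible f) (α : ℂ) (ha : aeval α f = 0) (hF : Full α)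
    [Fact (((f.map (Int.castRingHom ℚ)).map (algebraMap ℚ ℂ)).Splits)] :
    Fintype.card ((f.map (Int.castRingHom ℚ)).rootSet ℂ) = f.natDegree ∧
      Function.Surjective (galActionHom (f.map (Int.castRingHom ℚ)) ℂ) := by
  have hirrQ : Irreducible (f.map (Int.castRingHom ℚ)) := (hf.irreducible_iff_irreducible_map_fraction_map).1 hirr
  have hα : IsIntegral ℚ α := IsIntegral.tower_top (R := ℤ) ⟨f, hf, ha⟩
  have hmin : minpoly ℚ α = f.map (Int.castRingHom ℚ) := by
    refine (minpoly.eq_of_irreducible_of_monic hirrQ ?_ (hf.map _)).symm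
    exact (aeval_map_algebraMap ℚ α f).trans ha
  have hsp := nc_split α hα
  rw [hmin] at hsp
  have hcard : Fintype.card ((f.map (Int.castRingHom ℚ)).rootSet ℂ) = f.natDegree := by
    rw [card_rootSet_eq_natDegree hirrQ.separable (IsAlgClosed.splits _), hf.natDegree_map]
  refine ⟨hcard, ?_⟩
  have h1 : Nat.card (f.map (Int.castRingHom ℚ)).Gal = (f.natDegree).factorial := by
    rw [card_of_separable hirrQ.separable, ← (IsSplittingField.algEquiv (normalClosure ℚ ℚ⟮α⟯ ℂ) (f.map (Int.castRingHom ℚ))).toLinearEquiv.finrank_eq,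
      hF, IntermediateField.adjoin.finrank hα, hmin, hf.natDegree_map]
  have hinj := galActionHom_injective (f.map (Int.castRingHom ℚ)) ℂ
  refine ((Nat.bijective_iff_injective_and_card _).2 ⟨hinj, ?_⟩).2
  rw [h1, Nat.card_perm, Nat.card_eq_fintype_card, hcard]

lemma r2 (α : ℂ) (hα : IsIntegral ℤ α) (hM : Mini α) (hF : ¬ Full α) [NumberField ℚ⟮α⟯]
    (hd : 2 ≤ Module.finrank ℚ ℚ⟮α⟯) (p : ℕ) [Fact p.Prime] (hp : (p : ℤ) ∣ discr ℚ⟮α⟯) :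
    Zc p (Module.finrank ℚ ℚ⟮α⟯ - 2) (minpoly ℤ α) := by
  classical
  have hαQ : IsIntegral ℚ α := hα.tower_top
  set f := minpoly ℤ α with hf
  have hfm : f.Monic := minpoly.monic hα
  have hfirr : Irreducible f := minpoly.irreducible hα
  have hmin : minpoly ℚ α = f.map (algebraMap ℤ ℚ) := minpoly.isIntegrallyClosed_eq_field_fractions' ℚ hα
  have hsp := nc_split α hαQ
  have hdeg : Module.finrank ℚ ℚ⟮α⟯ = f.natDegree := by
    rw [IntermediateField.adjoin.finrank hαQ, hmin, hfm.natDegree_map]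
  have hle : ℚ⟮α⟯ ≤ normalClosure ℚ ℚ⟮α⟯ ℂ := le_normalClosure _
  have hF' : Module.finrank ℚ (normalClosure ℚ ℚ⟮α⟯ ℂ) ≠ (Module.finrank ℚ ℚ⟮α⟯).factorial := hF
  clear hF
  generalize hS : normalClosure ℚ ℚ⟮α⟯ ℂ = S at hsp hle hF'
  have hsep : (minpoly ℚ α).Separable := (minpoly.irreducible hαQ).separable
  have hgal : IsGalois ℚ S := IsGalois.of_separable_splitting_field hsep
  have hfd : FiniteDimensional ℚ S := IsSplittingField.finiteDimensional S (minpoly ℚ α)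
  have hnf : NumberField S := ⟨⟩
  let := (inclusion hle).toRingHom.toAlgebra
  have hp' : (p : ℤ) ∣ discr S := hp.trans (discr_dvd_discr ℚ⟮α⟯ S)
  have hS' : (f.map (algebraMap ℤ S)).Splits := by
    have := hsp.splits
    rwa [hmin, Polynomial.map_map, RingHom.ext_int ((algebraMap ℚ S).comp (algebraMap ℤ ℚ)) (algebraMap ℤ S)] at this
  have hSO : (f.map (algebraMap ℤ (𝓞 S))).Splits := by
    refine Polynomial.Splits.of_splits_map_of_injective (i := algebraMap (𝓞 S) S) RingOfIntegers.coe_injective ?_ ?_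
    · rwa [Polynomial.map_map, ← IsScalarTower.algebraMap_eq]
    · intro x hx
      rw [Polynomial.map_map, ← IsScalarTower.algebraMap_eq] at hx
      have hx' : aeval x f = 0 := by
        rw [aeval_def, eval₂_eq_eval_map]
        exact (mem_roots'.1 hx).2
      exact ⟨⟨x, f, hfm, hx'⟩, rfl⟩
  have hαS : α ∈ S := hle (mem_adjoin_simple_self ℚ α)
  let a : 𝓞 S := ⟨⟨α, hαS⟩, (isIntegral_algHom_iff (S.val.restrictScalars ℤ) S.val.injective).1 hα⟩
  have hn : (f.rootSet (𝓞 S)).ncard = f.natDegree := by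
    have h1 := hSO.image_rootSet_of_map_ne_zero (IsScalarTower.toAlgHom ℤ (𝓞 S) S) (hfm.map _).ne_zero
    rw [← Set.ncard_image_of_injective _ RingOfIntegers.coe_injective]
    have h2 := card_rootSet_eq_natDegree hsep hsp.splits
    rw [hmin, hfm.natDegree_map, ← Nat.card_eq_fintype_card] at h2
    rw [← h2]
    change _ = Set.ncard _
    congr 1
    refine Eq.trans h1 ?_
    ext x
    rw [mem_rootSet, mem_rootSet, aeval_map_algebraMap]
    simp [hfm.ne_zero, (hfm.map (Int.castRingHom ℚ)).ne_zero]
  have hfaith : ∀ g : S ≃ₐ[ℚ] S, (∀ x : f.rootSet (𝓞 S), g • x = x) → g = 1 := by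
    intro g hg
    have := hsp.adjoin_rootSet
    have h2 : (g : S →ₐ[ℚ] S) = AlgHom.id ℚ S := by
      refine AlgHom.ext_of_adjoin_eq_top this ?_
      intro x hx
      have hx' : aeval x f = 0 := by
        have := (mem_rootSet.1 hx).2
        rwa [hmin, aeval_map_algebraMap] at this
      let y : 𝓞 S := ⟨x, f, hfm, hx'⟩
      have hy : y ∈ f.rootSet (𝓞 S) := by
        refine mem_rootSet.2 ⟨hfm.ne_zero, ?_⟩
        apply RingOfIntegers.coe_injective
        rw [map_zero, ← aeval_algebraMap_apply]
        exact hx'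
      have := congrArg (fun z : f.rootSet (𝓞 S) => ((z : 𝓞 S) : S)) (hg ⟨y, hy⟩)
      exact this
    ext x : 1
    exact DFunLike.congr_fun h2 x
  rcases swap_or_zc S p hp' f hfm hSO (Module.finrank ℚ ℚ⟮α⟯ - 2) (by omega) hfaith with h | h
  swap
  · exact h
  exfalso
  have haf : aeval a f = 0 := by
    apply RingOfIntegers.coe_injective
    rw [map_zero, ← aeval_algebraMap_apply]
    apply S.val.injective
    rw [map_zero]
    have := aeval_algHom_apply (S.val.restrictScalars ℤ) (algebraMap (𝓞 S) S a) f
    exact this.symm.trans (minpoly.aeval ℤ α)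
  have hsurj := perm_top S f hfm hfirr a haf ?_ ?_ h
  · have hinj : Function.Injective (MulAction.toPermHom (S ≃ₐ[ℚ] S) (f.rootSet (𝓞 S))) := by
      rw [injective_iff_map_eq_one]
      intro g hg
      exact hfaith g fun x => congrArg (fun e => e x) hg
    have := Nat.card_congr (Equiv.ofBijective _ ⟨hinj, hsurj⟩)
    rw [Nat.card_perm, IsGalois.card_aut_eq_finrank] at this
    apply hF'
    rw [this, hdeg]
    congr 1
  · have hmap : (ℚ⟮(a : S)⟯).map S.val = ℚ⟮α⟯ := by
      refine Eq.trans (adjoin_map ℚ {(⟨α, hαS⟩ : S)} S.val) ?_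
      rw [Set.image_singleton]
      rfl
    intro L hL
    have hLe : L.map S.val ≤ ℚ⟮α⟯ := by
      rw [← hmap]
      exact IntermediateField.map_mono _ hL
    rcases hM (L.map S.val) hLe with h | h
    · left
      rw [← IntermediateField.map_bot S.val] at h
      exact IntermediateField.map_injective S.val h
    · right
      rw [← hmap] at h
      exact IntermediateField.map_injective S.val h
  · rw [← Finite.one_lt_card_iff_nontrivial]
    change 1 < (f.rootSet (𝓞 S)).ncard
    rw [hn, ← hdeg]; omega

/-- at most `n` distinct roots, over the prime field -/
def ZF (p n : ℕ) (f : (ZMod p)[X]) : Prop :=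
  ∃ u : (ZMod p)[X], u.Monic ∧ u.natDegree = n ∧ f ∣ u ^ f.natDegree

lemma zf_of_zc (p n : ℕ) [Fact p.Prime] (f : ℤ[X]) (hf : f.Monic) (h : Zc p n f) :
    ZF p n (f.map (Int.castRingHom (ZMod p))) := by
  obtain ⟨u, hu, hn, hz⟩ := h
  set F := f.map (Int.castRingHom (ZMod p)) with hF
  have hFm : F.Monic := hf.map _
  have h1 : F ∣ u ^ F.natDegree := by
    rw [← map_dvd_map' (algebraMap (ZMod p) (AlgebraicClosure (ZMod p)))]
    have hs : (F.map (algebraMap (ZMod p) (AlgebraicClosure (ZMod p)))).Splits := IsAlgClosed.splits _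
    have hprod := hs.eq_prod_roots_of_monic (hFm.map _)
    have hcard := hs.natDegree_eq_card_roots
    rw [hFm.natDegree_map] at hcard
    rw [Polynomial.map_pow, hcard]
    nth_rw 1 [hprod]
    have : ∀ m : Multiset (AlgebraicClosure (ZMod p)), (∀ z ∈ m, X - C z ∣ u.map (algebraMap (ZMod p) (AlgebraicClosure (ZMod p)))) →
      (m.map fun a => X - C a).prod ∣ u.map (algebraMap (ZMod p) (AlgebraicClosure (ZMod p))) ^ m.card := by
      intro m
      induction m using Multiset.induction_on with
      | empty => simp
      | cons a m ih =>
        intro h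
        rw [Multiset.map_cons, Multiset.prod_cons, Multiset.card_cons, pow_succ']
        exact mul_dvd_mul (h a (by simp)) (ih fun z hz => h z (by simp [hz]))
    apply this
    intro z hz'
    rw [dvd_iff_isRoot, IsRoot.def, eval_map_algebraMap]
    apply hz
    have := (mem_roots'.1 hz').2
    rw [IsRoot.def, eval_map, hF, eval₂_map] at this
    rw [← this]
    congr 1
  refine ⟨u * X ^ (n - u.natDegree), hu.mul (monic_X_pow _), ?_, ?_⟩
  · rw [hu.natDegree_mul (monic_X_pow _), natDegree_X_pow]; omega
  · rw [mul_pow]; exact h1.mul_right _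

lemma card_nf_le {k : Type} [Field k] [DecidableEq k] (g : k[X]) (hg : g ≠ 0) :
    (UniqueFactorizationMonoid.normalizedFactors g).card ≤ g.natDegree := by
  have h := UniqueFactorizationMonoid.prod_normalizedFactors hg
  have h0 : (0 : k[X]) ∉ UniqueFactorizationMonoid.normalizedFactors g :=
    UniqueFactorizationMonoid.zero_notMem_normalizedFactors g
  rw [← natDegree_eq_of_degree_eq (degree_eq_degree_of_associated h), natDegree_multiset_prod _ h0]
  have := Multiset.card_nsmul_le_sum (s := (UniqueFactorizationMonoid.normalizedFactors g).map natDegree) (a := 1) (by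
    intro x hx
    obtain ⟨q, hq, rfl⟩ := Multiset.mem_map.1 hx
    exact (UniqueFactorizationMonoid.irreducible_of_normalized_factor q hq).natDegree_pos)
  simpa using this

lemma zf_count (p n d : ℕ) [Fact p.Prime] :
    {f : (ZMod p)[X] | f.Monic ∧ f.natDegree = d ∧ ZF p n f}.Finite ∧
    ({f : (ZMod p)[X] | f.Monic ∧ f.natDegree = d ∧ ZF p n f}.ncard : ℝ) ≤ (p : ℝ) ^ n * 2 ^ (d * n) := by
  classical
  have hI := poly_count n (R := ZMod p) (fun _ => Set.univ) (fun _ => p) (fun i _ => ⟨Set.finite_univ, by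
    rw [Set.ncard_univ, Nat.card_zmod]⟩)
  have := ncard_rel (S := {f : (ZMod p)[X] | f.Monic ∧ f.natDegree = d ∧ ZF p n f})
    (fun f u => u.natDegree = n ∧ u ≠ 0 ∧ f ∣ u ^ f.natDegree) hI.1 (B := 2 ^ (d * n)) ?_ ?_
  · refine ⟨this.1, this.2.trans ?_⟩
    gcongr
    refine hI.2.trans ?_
    simp
  · rintro f ⟨h1, h2, u, h3, h4, h5⟩
    exact ⟨u, ⟨h3, h4, by simp⟩, h4, h3.ne_zero, h5⟩
  · rintro u ⟨h3, h4, -⟩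
    have hu : u ^ d ≠ 0 := pow_ne_zero _ h3.ne_zero
    set m := UniqueFactorizationMonoid.normalizedFactors (u ^ d)
    have hmap : Set.MapsTo (UniqueFactorizationMonoid.normalizedFactors)
      {x | x ∈ {f : (ZMod p)[X] | f.Monic ∧ f.natDegree = d ∧ ZF p n f} ∧ u.natDegree = n ∧ u ≠ 0 ∧ x ∣ u ^ x.natDegree}
      (m.powerset.toFinset : Set (Multiset (ZMod p)[X])) := by
      rintro f ⟨⟨h5, h6, -⟩, -, -, h7⟩
      rw [Finset.mem_coe, Multiset.mem_toFinset, Multiset.mem_powerset]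
      rw [h6] at h7
      exact (UniqueFactorizationMonoid.dvd_iff_normalizedFactors_le_normalizedFactors h5.ne_zero hu).1 h7
    have hinj : Set.InjOn (UniqueFactorizationMonoid.normalizedFactors)
      {x | x ∈ {f : (ZMod p)[X] | f.Monic ∧ f.natDegree = d ∧ ZF p n f} ∧ u.natDegree = n ∧ u ≠ 0 ∧ x ∣ u ^ x.natDegree} := by
      rintro f ⟨⟨h5, -⟩, -⟩ g ⟨⟨h6, -⟩, -⟩ h
      have e1 := UniqueFactorizationMonoid.prod_normalizedFactors h5.ne_zero
      have e2 := UniqueFactorizationMonoid.prod_normalizedFactors h6.ne_zero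
      rw [h] at e1
      exact eq_of_monic_of_associated h5 h6 (e1.symm.trans e2)
    refine ⟨Set.Finite.of_injOn hmap hinj (Finset.finite_toSet _), ?_⟩
    have hle := Set.ncard_le_ncard_of_injOn _ hmap hinj (Finset.finite_toSet _)
    rw [Set.ncard_coe_finset] at hle
    have h8 : m.powerset.toFinset.card ≤ 2 ^ (d * n) := by
      refine (Multiset.toFinset_card_le _).trans ?_
      rw [Multiset.card_powerset]
      refine Nat.pow_le_pow_right (by omega) ((card_nf_le _ hu).trans ?_)
      rw [natDegree_pow, h4]
    exact_mod_cast hle.trans h8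

lemma zf_count0 (p n d : ℕ) (hp : p.Prime) (hn : 1 ≤ n) (hd : 1 ≤ d) (a : ZMod p) (ha : a ≠ 0) :
    ({f : (ZMod p)[X] | f.Monic ∧ f.natDegree = d ∧ f.coeff 0 = a ∧ ZF p n f}.ncard : ℝ) ≤
      2 * d * 2 ^ (d * n) * (p : ℝ) ^ (n - 1) := by
  classical
  have : Fact p.Prime := ⟨hp⟩
  have hZ := zf_count p n d
  set A := {f : (ZMod p)[X] | f.Monic ∧ f.natDegree = d ∧ f.coeff 0 = a ∧ ZF p n f} with hA
  have key := ncard_fib (S := (Set.univ : Set (ZMod p)ˣ) ×ˢ A) (fun x => scaleRoots x.2 (x.1 : ZMod p)) hZ.1 (B := d) ?_ ?_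
  · have h1 : ((Set.univ : Set (ZMod p)ˣ) ×ˢ A).ncard = (p - 1) * A.ncard := by
      rw [Set.ncard_prod, Set.ncard_univ, Nat.card_eq_fintype_card, ZMod.card_units]
    have h2 := key.2
    rw [h1] at h2
    have h3 : (p : ℝ) ≤ 2 * ((p - 1 : ℕ) : ℝ) := by
      have := hp.two_le
      exact_mod_cast (by omega : p ≤ 2 * (p - 1))
    have hp0 : (0:ℝ) < p := by exact_mod_cast hp.pos
    have h4 : (p : ℝ) ^ n = p * (p : ℝ) ^ (n - 1) := by
      rw [← pow_succ']; congr 1; omega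
    have h5 : ((p:ℝ) * A.ncard) ≤ p * (2 * d * 2 ^ (d * n) * (p : ℝ) ^ (n - 1)) := by
      calc ((p:ℝ) * A.ncard) ≤ 2 * ((p - 1 : ℕ) : ℝ) * A.ncard := by gcongr
        _ = 2 * (((p - 1) * A.ncard : ℕ) : ℝ) := by push_cast; ring
        _ ≤ 2 * ((p : ℝ) ^ n * 2 ^ (d * n) * d) := by
          refine mul_le_mul_of_nonneg_left (h2.trans ?_) (by norm_num)
          gcongr
          exact hZ.2
        _ = _ := by rw [h4]; ring
    exact le_of_mul_le_mul_left h5 hp0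
  · rintro ⟨t, f⟩ ⟨-, h1, h2, h3, u, h4, h5, c, h6⟩
    refine ⟨(monic_scaleRoots_iff _).2 h1, by rw [natDegree_scaleRoots, h2], scaleRoots u t, (monic_scaleRoots_iff _).2 h4, by
      rw [natDegree_scaleRoots, h5], ?_⟩
    rw [natDegree_scaleRoots]
    have hpow : ∀ k, (scaleRoots u (t : ZMod p)) ^ k = scaleRoots (u ^ k) (t : ZMod p) := by
      intro k
      induction k with
      | zero => simp
      | succ k ih => rw [pow_succ, ih, pow_succ, mul_scaleRoots_of_noZeroDivisors]
    rw [hpow, h6, mul_scaleRoots_of_noZeroDivisors]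
    exact dvd_mul_right _ _
  · intro g hg
    set q : (ZMod p)[X] := X ^ d - C (g.coeff 0 / a)
    have hmap : Set.MapsTo (fun x : (ZMod p)ˣ × (ZMod p)[X] => (x.1 : ZMod p))
        {x ∈ (Set.univ : Set (ZMod p)ˣ) ×ˢ A | scaleRoots x.2 (x.1 : ZMod p) = g} (q.roots.toFinset : Set (ZMod p)) := by
      rintro ⟨t, f⟩ ⟨⟨-, h1, h2, h3, -⟩, h4⟩
      simp only at h4
      rw [Finset.mem_coe, Multiset.mem_toFinset, mem_roots (X_pow_sub_C_ne_zero (by omega) _)]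
      have := congrArg (fun r => r.coeff 0) h4
      simp only [coeff_scaleRoots, h3, h2, Nat.sub_zero] at this
      simp only [q, IsRoot.def, eval_sub, eval_pow, eval_X, eval_C]
      rw [← this]; field_simp; ring
    have hinj : Set.InjOn (fun x : (ZMod p)ˣ × (ZMod p)[X] => (x.1 : ZMod p))
        {x ∈ (Set.univ : Set (ZMod p)ˣ) ×ˢ A | scaleRoots x.2 (x.1 : ZMod p) = g} := by
      rintro ⟨t, f⟩ ⟨-, h4⟩ ⟨t', f'⟩ ⟨-, h4'⟩ h
      have ht : t = t' := Units.ext h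
      subst ht
      simp only at h4 h4'
      congr 1
      have := congrArg (fun r => scaleRoots r ((t⁻¹ : (ZMod p)ˣ) : ZMod p)) (h4.trans h4'.symm)
      simp only [← Polynomial.scaleRoots_mul, Units.mul_inv, scaleRoots_one] at this
      exact this
    refine ⟨Set.Finite.of_injOn hmap hinj (Finset.finite_toSet _), ?_⟩
    have hle := Set.ncard_le_ncard_of_injOn _ hmap hinj (Finset.finite_toSet _)
    rw [Set.ncard_coe_finset] at hle
    have h8 : q.roots.toFinset.card ≤ d := by
      refine (Multiset.toFinset_card_le _).trans ((card_roots' _).trans ?_)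
      rw [natDegree_X_pow_sub_C]
    exact_mod_cast hle.trans h8

/-- admissible moduli -/
def GoodD (d B D : ℕ) : Prop := D ≠ 0 ∧
  ∀ p ∈ D.primeFactors, B < p ∧ 2 ≤ D.factorization p ∧ D.factorization p ≤ d - 1

/-- the congruence conditions attached to a modulus -/
def ZD (d D : ℕ) (f : ℤ[X]) : Prop := ∀ p ∈ D.primeFactors,
  ZF p (d - D.factorization p) (f.map (Int.castRingHom (ZMod p)))

/-- the modulus belongs to the field -/
def FD (d B c : ℕ) (α : ℂ) (D : ℕ) : Prop := GoodD d B D ∧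
  (∀ [NumberField ℚ⟮α⟯], (discr ℚ⟮α⟯).natAbs ≤ c * D) ∧
  ∀ β : ℂ, IsIntegral ℤ β → ℚ⟮β⟯ = ℚ⟮α⟯ → ZD d D (minpoly ℤ β)

lemma minpoly_deg {β : ℂ} (hβ : IsIntegral ℤ β) : (minpoly ℤ β).natDegree = Module.finrank ℚ ℚ⟮β⟯ := by
  rw [IntermediateField.adjoin.finrank (hβ.tower_top), minpoly.isIntegrallyClosed_eq_field_fractions' ℚ hβ,
    (minpoly.monic hβ).natDegree_map]

lemma zc_elem {α β : ℂ} [NumberField ℚ⟮α⟯] (hβ : IsIntegral ℤ β) (h : ℚ⟮β⟯ = ℚ⟮α⟯) (p n : ℕ) [Fact p.Prime]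
    (hz : ∀ β : 𝓞 ℚ⟮α⟯, Zc p n (minpoly ℤ β)) : Zc p n (minpoly ℤ β) := by
  have hm : β ∈ ℚ⟮α⟯ := h ▸ mem_adjoin_simple_self ℚ β
  have hi : IsIntegral ℤ (⟨β, hm⟩ : ℚ⟮α⟯) := by
    rw [← isIntegral_algebraMap_iff (algebraMap ℚ⟮α⟯ ℂ).injective]
    exact hβ
  let x : 𝓞 ℚ⟮α⟯ := ⟨⟨β, hm⟩, hi⟩
  have h2 := minpoly.algebraMap_eq (A := ℤ) (B := 𝓞 ℚ⟮α⟯) (B' := ℂ) (FaithfulSMul.algebraMap_injective _ _) x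
  have h3 : algebraMap (𝓞 ℚ⟮α⟯) ℂ x = β := rfl
  rw [h3] at h2
  rw [h2]
  exact hz x

lemma full_congr {α γ : ℂ} (h : ℚ⟮γ⟯ = ℚ⟮α⟯) (hF : ¬ Full α) : ¬ Full γ := by
  have : ∀ L : IntermediateField ℚ ℂ, L = ℚ⟮α⟯ →
      ¬ Module.finrank ℚ (normalClosure ℚ L ℂ) = (Module.finrank ℚ L).factorial := by
    rintro L rfl; exact hF
  exact this _ h

lemma zf_pos {p n d : ℕ} [Fact p.Prime] {f : (ZMod p)[X]} (hf : f.natDegree = d) (hd : 1 ≤ d) (h : ZF p n f) : n ≠ 0 := by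
  rintro rfl
  obtain ⟨u, h1, h2, h3⟩ := h
  rw [h1.natDegree_eq_zero.1 h2, one_pow] at h3
  have := natDegree_eq_zero_of_isUnit (isUnit_of_dvd_one h3)
  omega

lemma exists_D (d B : ℕ) (hd : 3 ≤ d) (hB : d ≤ B) : ∃ c : ℕ, 0 < c ∧ ∀ α : ℂ, IsIntegral ℤ α → Mini α → ¬ Full α →
    Module.finrank ℚ ℚ⟮α⟯ = d → ∃ D, FD d B c α D := by
  classical
  refine ⟨∏ p ∈ (Finset.range (B + 1)).filter Nat.Prime, p ^ (d * d), Finset.prod_pos fun p hp =>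
    pow_pos (Finset.mem_filter.1 hp).2.pos _, fun α hα hM hF hfr => ?_⟩
  have : NumberField ℚ⟮α⟯ := nf_adj hα
  set Δ := (discr ℚ⟮α⟯).natAbs with hΔ
  have hΔ0 : Δ ≠ 0 := Int.natAbs_ne_zero.2 (discr_ne_zero _)
  set s := Δ.primeFactors.filter (B < ·) with hs
  let g : ℕ →₀ ℕ := Finsupp.onFinset s (fun p => if p ∈ s then max 2 (Δ.factorization p) else 0) (by
    intro p hp; by_contra h; simp [h] at hp)
  have hgs : g.support = s := by
    ext p
    simp only [g, Finsupp.mem_support_iff, Finsupp.onFinset_apply]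
    by_cases h : p ∈ s <;> simp [h]
  have hpr : ∀ p ∈ s, p.Prime := fun p hp => Nat.prime_of_mem_primeFactors (Finset.mem_filter.1 hp).1
  have hfac : (g.prod (· ^ ·)).factorization = g := Nat.prod_pow_factorization_eq_self (by rw [hgs]; exact hpr)
  have hD0 : g.prod (· ^ ·) ≠ 0 := by
    rw [Finsupp.prod, hgs]
    exact Finset.prod_ne_zero_iff.2 fun p hp => pow_ne_zero _ (hpr p hp).ne_zero
  have hpf : (g.prod (· ^ ·)).primeFactors = s := by
    rw [← Nat.support_factorization, hfac, hgs]
  have hgp : ∀ p ∈ s, g p = max 2 (Δ.factorization p) := by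
    intro p hp; simp [g, hp]
  have hdv : ∀ p : ℕ, (p:ℤ) ^ (Δ.factorization p) ∣ discr ℚ⟮α⟯ := by
    intro p
    rw [← Int.natCast_pow, Int.natCast_dvd]
    exact Nat.ordProj_dvd _ _
  have key : ∀ p ∈ s, ∀ β : ℂ, IsIntegral ℤ β → ℚ⟮β⟯ = ℚ⟮α⟯ →
      ZF p (d - g p) ((minpoly ℤ β).map (Int.castRingHom (ZMod p))) := by
    intro p hp β hβ he
    have hP := hpr p hp
    have : Fact p.Prime := ⟨hP⟩
    have hBp : B < p := (Finset.mem_filter.1 hp).2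
    apply zf_of_zc _ _ _ (minpoly.monic hβ)
    rw [hgp p hp]
    rcases le_total 2 (Δ.factorization p) with h | h
    · rw [max_eq_right h]
      apply zc_elem hβ he
      have := (zc_field ℚ⟮α⟯ p 1 (by rw [pow_one]; exact hfr.trans_lt (by omega)) (by omega) _ (hdv p)).2
      have h5 : d - Δ.factorization p = Module.finrank ℚ ℚ⟮α⟯ * 1 - Δ.factorization p := by rw [mul_one]; exact congrArg (· - _) hfr.symm
      rw [h5]
      exact this
    · rw [max_eq_left h]
      have hpd : (p : ℤ) ∣ discr ℚ⟮α⟯ := by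
        rw [Int.natCast_dvd]
        exact Nat.dvd_of_mem_primeFactors (Finset.mem_filter.1 hp).1
      have hr : ∀ γ : ℂ, ℚ⟮γ⟯ = ℚ⟮α⟯ → IsIntegral ℤ γ → Zc p (d - 2) (minpoly ℤ γ) := by
        intro γ h1 h2
        have hn : NumberField ℚ⟮γ⟯ := nf_adj h2
        have h3 : Module.finrank ℚ ℚ⟮γ⟯ = d := by rw [h1, hfr]
        have h4 := r2 γ h2 (by unfold Mini; rw [h1]; exact hM) (full_congr h1 hF) (by omega) p (by
          have : ∀ (L : IntermediateField ℚ ℂ) (_ : NumberField L), L = ℚ⟮α⟯ → (p : ℤ) ∣ discr L := by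
            rintro L _ rfl; exact hpd
          exact this _ hn h1)
        rwa [h3] at h4
      exact hr β he hβ
  refine ⟨g.prod (· ^ ·), ⟨hD0, ?_⟩, ?_, ?_⟩
  · rw [hpf, hfac]
    intro p hp
    have hP := hpr p hp
    have : Fact p.Prime := ⟨hP⟩
    refine ⟨(Finset.mem_filter.1 hp).2, by rw [hgp p hp]; exact le_max_left _ _, ?_⟩
    have h1 := key p hp α hα rfl
    have := zf_pos (d := d) (by rw [(minpoly.monic hα).natDegree_map, minpoly_deg hα, hfr]) (by omega) h1
    omega
  · intro _
    have h1 : Δ = ∏ p ∈ Δ.primeFactors, p ^ Δ.factorization p := (Nat.prod_factorization_pow_eq_self hΔ0).symm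
    have h2 := Finset.prod_filter_mul_prod_filter_not Δ.primeFactors (B < ·) (fun p => p ^ Δ.factorization p)
    calc Δ = _ := h1
      _ = _ := h2.symm
      _ = (∏ p ∈ Δ.primeFactors with ¬ B < p, p ^ Δ.factorization p) * ∏ p ∈ s, p ^ Δ.factorization p := mul_comm _ _
      _ ≤ _ := by
        apply Nat.mul_le_mul
        · have : Finset.filter (fun p => ¬ B < p) Δ.primeFactors ⊆ (Finset.range (B + 1)).filter Nat.Prime := by
            intro p hp
            rw [Finset.mem_filter] at hp ⊢
            exact ⟨Finset.mem_range.2 (by omega), Nat.prime_of_mem_primeFactors hp.1⟩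
          calc _ ≤ ∏ p ∈ Δ.primeFactors with ¬ B < p, p ^ (d * d) := by
                apply Finset.prod_le_prod'
                intro p hp
                rw [Finset.mem_filter] at hp
                have hP := Nat.prime_of_mem_primeFactors hp.1
                have : Fact p.Prime := ⟨hP⟩
                apply Nat.pow_le_pow_right hP.pos
                have := (zc_field ℚ⟮α⟯ p d (hfr.trans_lt (Nat.lt_pow_self hP.one_lt)) (by omega) _ (hdv p)).1
                exact this.trans (Nat.mul_le_mul_right _ hfr.le)
            _ ≤ _ := Finset.prod_le_prod_of_subset_of_one_le' this fun p hp _ =>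
                Nat.one_le_pow _ _ (Finset.mem_filter.1 hp).2.pos
        · rw [Finsupp.prod, hgs]
          apply Finset.prod_le_prod'
          intro p hp
          apply Nat.pow_le_pow_right (hpr p hp).pos
          rw [hgp p hp]; exact le_max_right _ _
  · intro β hβ he p hp
    rw [hpf] at hp
    rw [hfac]
    exact key p hp β hβ he

lemma LB_sum {X : Type} (F : ℕ → Set X) (k K e Ω : ℕ) (A : ℝ) (hA : 0 < A) (G : ℕ → ℕ → ℕ → Set X)
    (h1 : ∀ N, 2 ≤ N → ∀ x ∈ F N, ∃ C D, 1 ≤ C ∧ C ≤ N ∧ Squarefree C ∧ D ∣ C ^ e ∧ x ∈ G N C D)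
    (h2 : ∀ N, 2 ≤ N → ∀ C D, 1 ≤ C → C ≤ N → Squarefree C → D ∣ C ^ e → (G N C D).Finite ∧
      ((G N C D).ncard : ℝ) ≤ A * (N : ℝ) ^ k * (1 + Real.log N) ^ Ω * ((K : ℝ) ^ C.primeFactors.card / C)) : LB k F := by
  classical
  refine ⟨A, hA, Ω + (e + 1) * K, fun N hN => ?_⟩
  set s := (Finset.Icc 1 N).filter Squarefree
  set t := s.sigma (fun C => (C ^ e).divisors)
  have hsub : F N ⊆ ⋃ q ∈ t, G N q.1 q.2 := by
    intro x hx
    obtain ⟨C, D, h3, h4, h5, h6, h7⟩ := h1 N hN x hx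
    simp only [Set.mem_iUnion]
    exact ⟨⟨C, D⟩, Finset.mem_sigma.2 ⟨Finset.mem_filter.2 ⟨Finset.mem_Icc.2 ⟨h3, h4⟩, h5⟩,
      Nat.mem_divisors.2 ⟨h6, pow_ne_zero _ (Nat.one_le_iff_ne_zero.1 h3)⟩⟩, h7⟩
  have hG : ∀ q ∈ t, (G N q.1 q.2).Finite ∧
      ((G N q.1 q.2).ncard : ℝ) ≤ A * (N : ℝ) ^ k * (1 + Real.log N) ^ Ω * ((K : ℝ) ^ q.1.primeFactors.card / q.1) := by
    rintro ⟨C, D⟩ hq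
    obtain ⟨h3, h4⟩ := Finset.mem_sigma.1 hq
    obtain ⟨h5, h6⟩ := Finset.mem_filter.1 h3
    obtain ⟨h7, h8⟩ := Finset.mem_Icc.1 h5
    exact h2 N hN C D h7 h8 h6 (Nat.dvd_of_mem_divisors h4)
  have hfin : (⋃ q ∈ t, G N q.1 q.2).Finite := Set.Finite.biUnion t.finite_toSet fun q hq => (hG q hq).1
  refine ⟨hfin.subset hsub, ?_⟩
  have hl := one_le_log' hN
  calc ((F N).ncard : ℝ) ≤ ((⋃ q ∈ t, G N q.1 q.2).ncard : ℝ) := by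
        exact_mod_cast Set.ncard_le_ncard hsub hfin
    _ ≤ ∑ q ∈ t, ((G N q.1 q.2).ncard : ℝ) := by
        exact_mod_cast Finset.set_ncard_biUnion_le t _
    _ ≤ ∑ q ∈ t, A * (N : ℝ) ^ k * (1 + Real.log N) ^ Ω * ((K : ℝ) ^ q.1.primeFactors.card / q.1) :=
        Finset.sum_le_sum fun q hq => (hG q hq).2
    _ = A * (N : ℝ) ^ k * (1 + Real.log N) ^ Ω * ∑ C ∈ s, (((e + 1) * K : ℕ) : ℝ) ^ C.primeFactors.card / C := by
        rw [Finset.mul_sum, Finset.sum_sigma]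
        apply Finset.sum_congr rfl
        intro C hC
        obtain ⟨h5, h6⟩ := Finset.mem_filter.1 hC
        obtain ⟨h7, h8⟩ := Finset.mem_Icc.1 h5
        dsimp only
        rw [Finset.sum_const, nsmul_eq_mul]
        have : (C ^ e).divisors.card = (e + 1) ^ C.primeFactors.card ∨ e = 0 := by
          by_cases he : e = 0
          · exact Or.inr he
          left
          rw [Nat.card_divisors (pow_ne_zero _ (by omega)), Nat.primeFactors_pow _ he, ← Finset.prod_const]
          apply Finset.prod_congr rfl
          intro p hp
          rw [Nat.factorization_pow]
          simp only [Finsupp.smul_apply, smul_eq_mul]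
          rw [Nat.factorization_eq_one_of_squarefree h6 (Nat.prime_of_mem_primeFactors hp) (Nat.dvd_of_mem_primeFactors hp)]
          simp
        rcases this with h | h
        · rw [h]; push_cast; rw [mul_pow]; ring
        · subst h; simp
    _ ≤ A * (N : ℝ) ^ k * (1 + Real.log N) ^ Ω * (1 + Real.log N) ^ ((e + 1) * K) := by
        gcongr
        exact omega_sum _ N (by omega)
    _ = _ := by rw [pow_add]; ring

/-- radical -/
def rd (D : ℕ) : ℕ := ∏ p ∈ D.primeFactors, p

lemma rd_pf (D : ℕ) : (rd D).primeFactors = D.primeFactors :=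
  Nat.primeFactors_prod fun _ hp => Nat.prime_of_mem_primeFactors hp

lemma rd_pos (D : ℕ) : 0 < rd D := Finset.prod_pos fun _ hp => (Nat.prime_of_mem_primeFactors hp).pos

lemma rd_sq (D : ℕ) : Squarefree (rd D) := by
  unfold rd
  apply Finset.squarefree_prod_of_pairwise_isCoprime
  · intro p hp q hq h
    exact Nat.coprime_iff_isRelPrime.1 ((Nat.coprime_primes (Nat.prime_of_mem_primeFactors hp) (Nat.prime_of_mem_primeFactors hq)).2 h)
  · intro p hp
    exact (Nat.prime_of_mem_primeFactors hp).prime.irreducible.squarefree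

lemma rd_two {d B D : ℕ} (h : GoodD d B D) : rd D ^ 2 ≤ D := by
  conv_rhs => rw [← Nat.prod_factorization_pow_eq_self h.1]
  rw [rd, ← Finset.prod_pow, Finsupp.prod, Nat.support_factorization]
  exact Finset.prod_le_prod' fun p hp => Nat.pow_le_pow_right (Nat.prime_of_mem_primeFactors hp).pos (h.2 p hp).2.1

lemma rd_dvd {d B D : ℕ} (h : GoodD d B D) : D ∣ rd D ^ (d - 1) := by
  conv_lhs => rw [← Nat.prod_factorization_pow_eq_self h.1]
  rw [rd, ← Finset.prod_pow, Finsupp.prod, Nat.support_factorization]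
  exact Finset.prod_dvd_prod_of_dvd _ _ fun p hp => pow_dvd_pow _ (h.2 p hp).2.2

lemma rd_le {d B D : ℕ} (h : GoodD d B D) : D ≤ rd D ^ (d - 1) :=
  Nat.le_of_dvd (pow_pos (rd_pos D) _) (rd_dvd h)

/-- coefficient vector -/
def cv (m : ℕ) {R : Type} [CommRing R] (f : R[X]) : Fin m → R := fun i => f.coeff (i + 1)

lemma cv_inj {R : Type} [CommRing R] {d : ℕ} (hd : 1 ≤ d) {f g : R[X]} (hf : f.Monic) (hg : g.Monic) (hfd : f.natDegree = d)
    (hgd : g.natDegree = d) (h0 : f.coeff 0 = g.coeff 0) (h : cv (d - 1) f = cv (d - 1) g) : f = g := by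
  ext n
  rcases Nat.eq_zero_or_pos n with rfl | hn
  · exact h0
  rcases lt_trichotomy n d with h1 | rfl | h1
  · have := congrFun h ⟨n - 1, by omega⟩
    simp only [cv] at this
    rwa [Nat.sub_add_cancel hn] at this
  · have h1 := hf.coeff_natDegree
    have h2 := hg.coeff_natDegree
    rw [hfd] at h1; rw [hgd] at h2; rw [h1, h2]
  · rw [coeff_eq_zero_of_natDegree_lt (by omega), coeff_eq_zero_of_natDegree_lt (by omega)]

lemma prod_factor {d B D : ℕ} (h : GoodD d B D) (K : ℕ) (e : ℕ) (he : d - 1 ≤ e) :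
    (∏ p ∈ D.primeFactors, ((K * p ^ (e - D.factorization p) : ℕ) : ℝ)) = (K : ℝ) ^ D.primeFactors.card * ((rd D : ℝ) ^ e / D) := by
  have hD : (D : ℝ) = ∏ p ∈ D.primeFactors, (p : ℝ) ^ D.factorization p := by
    conv_lhs => rw [← Nat.prod_factorization_pow_eq_self h.1]
    rw [Finsupp.prod, Nat.support_factorization]; push_cast; rfl
  rw [rd]
  push_cast
  rw [Finset.prod_mul_distrib, Finset.prod_const, hD, ← Finset.prod_pow, ← Finset.prod_div_distrib]
  congr 1
  apply Finset.prod_congr rfl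
  intro p hp
  have hp0 : (p : ℝ) ≠ 0 := by exact_mod_cast (Nat.prime_of_mem_primeFactors hp).ne_zero
  rw [pow_sub₀ _ hp0 ((h.2 p hp).2.2.trans he)]; rfl

theorem case2 (d : ℕ) (hd : 3 ≤ d) (a₀ : ℤ) (ha : a₀ ≠ 0) (B : ℕ) (hB : a₀.natAbs ≤ B) :
    LB (d - 2) (fun N => {f ∈ PF d a₀ N | ∃ D, GoodD d B D ∧ ZD d D f ∧ rd D ≤ N ∧ N ^ 2 < D}) := by
  apply LB_sum _ (d - 2) (2 * d * 2 ^ (d * d)) (d - 1) 0 (4 ^ (d - 1)) (by positivity)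
    (fun N C D => {f ∈ PF d a₀ N | GoodD d B D ∧ ZD d D f ∧ rd D = C ∧ N ^ 2 < D})
  · rintro N hN f ⟨hf, D, h1, h2, h3, h4⟩
    exact ⟨rd D, D, rd_pos D, h3, rd_sq D, rd_dvd h1, hf, h1, h2, rfl, h4⟩
  · intro N hN C D hC1 hCN hsq hdv
    by_cases hgood : GoodD d B D ∧ rd D = C ∧ N ^ 2 < D
    swap
    · have : {f ∈ PF d a₀ N | GoodD d B D ∧ ZD d D f ∧ rd D = C ∧ N ^ 2 < D} = ∅ := by
        ext f
        simp only [Set.mem_sep_iff, Set.mem_empty_iff_false, iff_false]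
        tauto
      rw [this]
      refine ⟨Set.finite_empty, ?_⟩
      rw [Set.ncard_empty, Nat.cast_zero]
      have := one_le_log' hN
      positivity
    obtain ⟨hg, hrd, hND⟩ := hgood
    have hpf : C.primeFactors = D.primeFactors := by rw [← hrd, rd_pf]
    have hcrt := crt_box (ι := Fin (d - 1)) C hsq (fun _ => N)
      (fun p => cv (d - 1) '' {f : (ZMod p)[X] | f.Monic ∧ f.natDegree = d ∧ f.coeff 0 = (a₀ : ZMod p) ∧
        ZF p (d - D.factorization p) f}) (fun p => 2 * d * 2 ^ (d * d) * p ^ (d - 1 - D.factorization p)) (by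
        intro p hp
        rw [hpf] at hp
        have hP := Nat.prime_of_mem_primeFactors hp
        have : Fact p.Prime := ⟨hP⟩
        obtain ⟨h1, h2, h3⟩ := hg.2 p hp
        have ha' : (a₀ : ZMod p) ≠ 0 := by
          rw [Ne, ZMod.intCast_zmod_eq_zero_iff_dvd, Int.natCast_dvd]
          intro h
          have := Nat.le_of_dvd (Int.natAbs_pos.2 ha) h
          omega
        have hc := zf_count0 p (d - D.factorization p) d hP (by omega) (by omega) _ ha'
        refine (Set.ncard_image_le ((zf_count p (d - D.factorization p) d).1.subset ?_)).trans ?_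
        · rintro f ⟨h4, h5, h6, h7⟩; exact ⟨h4, h5, h7⟩
        · have h8 : (2 * d * 2 ^ (d * (d - D.factorization p)) * (p : ℝ) ^ (d - D.factorization p - 1)) ≤
            ((2 * d * 2 ^ (d * d) * p ^ (d - 1 - D.factorization p) : ℕ) : ℝ) := by
            push_cast
            have : d - D.factorization p - 1 = d - 1 - D.factorization p := by omega
            rw [this]
            gcongr
            · norm_num
            · omega
          exact_mod_cast hc.trans h8)
    have hmap : Set.MapsTo (cv (d - 1)) {f ∈ PF d a₀ N | GoodD d B D ∧ ZD d D f ∧ rd D = C ∧ N ^ 2 < D}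
        {a : Fin (d - 1) → ℤ | (∀ i, |a i| ≤ ((fun _ => N : Fin (d - 1) → ℕ) i : ℤ)) ∧ ∀ p ∈ C.primeFactors,
          (fun i => (a i : ZMod p)) ∈ cv (d - 1) '' {f : (ZMod p)[X] | f.Monic ∧ f.natDegree = d ∧
            f.coeff 0 = (a₀ : ZMod p) ∧ ZF p (d - D.factorization p) f}} := by
      rintro f ⟨⟨h1, h2, h3, h4⟩, -, h5, -⟩
      refine ⟨fun i => h4 _ (by omega) (by omega), fun p hp => ?_⟩
      rw [hpf] at hp
      have : Fact p.Prime := ⟨Nat.prime_of_mem_primeFactors hp⟩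
      refine ⟨f.map (Int.castRingHom (ZMod p)), ⟨h1.map _, by rw [h1.natDegree_map, h2], by simp [h3], h5 p hp⟩, ?_⟩
      ext i; simp [cv]
    have hinj : Set.InjOn (cv (R := ℤ) (d - 1)) {f ∈ PF d a₀ N | GoodD d B D ∧ ZD d D f ∧ rd D = C ∧ N ^ 2 < D} := by
      rintro f ⟨⟨h1, h2, h3, -⟩, -⟩ g ⟨⟨h4, h5, h6, -⟩, -⟩ h
      exact cv_inj (by omega) h1 h4 h2 h5 (by rw [h3, h6]) h
    refine ⟨Set.Finite.of_injOn hmap hinj hcrt.1, ?_⟩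
    have h1 := Set.ncard_le_ncard_of_injOn _ hmap hinj hcrt.1
    refine (Nat.cast_le.2 h1).trans (hcrt.2.trans ?_)
    rw [Finset.prod_const, Finset.card_univ, Fintype.card_fin, hpf, prod_factor hg _ _ le_rfl, hrd]
    have hC0 : (0:ℝ) < C := by exact_mod_cast hC1
    have hCN' : (C:ℝ) ≤ N := by exact_mod_cast hCN
    have hN0 : (0:ℝ) < N := by linarith
    have hD0 : (0:ℝ) < D := by exact_mod_cast Nat.pos_of_ne_zero hg.1
    have e1 : (2 * (N:ℝ) / C + 2) ≤ 4 * N / C := by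
      rw [div_add' _ _ _ hC0.ne']; gcongr; linarith
    have e2 : (N:ℝ) * C ≤ D := by
      have : (N:ℝ) ^ 2 < D := by exact_mod_cast hND
      nlinarith
    have e3 : (N : ℝ) ^ (d - 1) = N ^ (d - 2) * N := by rw [← pow_succ]; congr 1; omega
    calc _ ≤ (4 * (N:ℝ) / C) ^ (d - 1) * (((2 * d * 2 ^ (d * d) : ℕ) : ℝ) ^ D.primeFactors.card * ((C : ℝ) ^ (d - 1) / D)) := by
          gcongr
      _ ≤ (4 * (N:ℝ) / C) ^ (d - 1) * (((2 * d * 2 ^ (d * d) : ℕ) : ℝ) ^ D.primeFactors.card * ((C : ℝ) ^ (d - 1) / (N * C))) := by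
          gcongr
      _ = _ := by
          rw [div_pow, mul_pow, e3]
          field_simp

lemma res_prod {R : Type} [CommRing R] [IsDomain R] (s : Multiset R) (g : R[X]) (n : ℕ) (hn : g.natDegree ≤ n) :
    resultant (s.map (fun r => X - C r)).prod g s.card n = (s.map (fun r => g.eval r)).prod := by
  induction s using Multiset.induction_on with
  | empty => simp
  | cons a s ih =>
    rw [Multiset.map_cons, Multiset.prod_cons, Multiset.card_cons, Multiset.map_cons, Multiset.prod_cons, ← ih]
    have h := resultant_mul_left (X - C a) (s.map (fun r => X - C r)).prod g n hn
    rw [natDegree_X_sub_C, natDegree_multiset_prod_X_sub_C_eq_card] at h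
    rw [add_comm s.card, h]
    congr 1
    have := resultant_X_sub_C_pow_left a g 1 n hn
    rwa [pow_one, pow_one] at this

lemma res_form {k : Type} [Field k] [IsAlgClosed k] (q g : k[X]) (n : ℕ) (hq : q.natDegree = n) (hn : 1 ≤ n)
    (hg : g.natDegree ≤ n) :
    resultant (q.map C) (g.map C + C (X : k[X]) * X) n n =
      C (q.leadingCoeff ^ n) * (q.roots.map (fun r => C (g.eval r) + X * C r)).prod := by
  have hs : q.Splits := IsAlgClosed.splits q
  have h1 := hs.eq_prod_roots
  have h2 : q.map C = C (C q.leadingCoeff) * ((q.roots.map (C : k →+* k[X])).map (fun r => X - C r)).prod := by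
    nth_rw 1 [h1]
    rw [Polynomial.map_mul, map_C, Polynomial.map_multiset_prod, Multiset.map_map, Multiset.map_map]
    simp
  have hc : (q.roots.map (C : k →+* k[X])).card = n := by
    rw [Multiset.card_map, ← hs.natDegree_eq_card_roots, hq]
  have h3 := res_prod (q.roots.map (C : k →+* k[X])) (g.map C + C (X : k[X]) * X) n ?_
  · rw [hc] at h3
    rw [h2, resultant_C_mul_left, h3, C_pow, Multiset.map_map]
    congr 3
    ext r
    simp
  · refine (natDegree_add_le _ _).trans (max_le ((natDegree_map_le).trans hg) ?_)
    exact (natDegree_C_mul_le _ _).trans (by simpa using hn)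

/-- generic polynomial without linear term -/
noncomputable def GG (m : ℕ) (a₀ : ℤ) : (MvPolynomial (Fin m) ℤ)[X] :=
  X ^ (m + 2) + ∑ i : Fin m, C (MvPolynomial.X i) * X ^ (i.1 + 2) + C (a₀ : MvPolynomial (Fin m) ℤ)

/-- eliminated polynomial -/
noncomputable def PP (m : ℕ) (a₀ : ℤ) : (MvPolynomial (Fin m) ℤ)[X] := X * derivative (GG m a₀) - GG m a₀

/-- the resultant in the linear coefficient -/
noncomputable def QQ (m : ℕ) (a₀ : ℤ) : (MvPolynomial (Fin m) ℤ)[X] :=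
  resultant ((PP m a₀).map C) ((GG m a₀).map C + C (X : (MvPolynomial (Fin m) ℤ)[X]) * X) (m + 2) (m + 2)

/-- double discriminant -/
noncomputable def DD (m : ℕ) (a₀ : ℤ) : MvPolynomial (Fin m) ℤ :=
  resultant (QQ m a₀) (QQ m a₀).derivative (m + 2) (m + 1)

section
variable {k : Type} [Field k] (m : ℕ) (a₀ : ℤ) (φ : MvPolynomial (Fin m) ℤ →+* k)

lemma GG_map : (GG m a₀).map φ = X ^ (m + 2) + ∑ i : Fin m, C (φ (MvPolynomial.X i)) * X ^ (i.1 + 2) + C (a₀ : k) := by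
  simp [GG, Polynomial.map_sum]

lemma PP_map : (PP m a₀).map φ = X * derivative ((GG m a₀).map φ) - (GG m a₀).map φ := by
  simp [PP, derivative_map]

lemma GG_coeff_top : ((GG m a₀).map φ).coeff (m + 2) = 1 := by
  rw [GG_map, coeff_add, coeff_add, coeff_X_pow, finsetSum_coeff, Finset.sum_eq_zero]
  · rw [coeff_C]; simp
  · intro i _
    rw [coeff_C_mul, coeff_X_pow, if_neg (by omega), mul_zero]

lemma GG_deg : ((GG m a₀).map φ).natDegree ≤ m + 2 := by
  rw [GG_map]
  refine (natDegree_add_le _ _).trans (max_le ((natDegree_add_le _ _).trans (max_le (natDegree_X_pow_le _) ?_)) (by simp))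
  apply natDegree_sum_le_of_forall_le
  intro i _
  exact (natDegree_C_mul_X_pow_le _ _).trans (by omega)

lemma GG_coeff_zero : ((GG m a₀).map φ).coeff 0 = a₀ := by
  rw [GG_map, coeff_add, coeff_add, coeff_X_pow, finsetSum_coeff, Finset.sum_eq_zero]
  · simp
  · intro i _
    rw [coeff_C_mul, coeff_X_pow, if_neg (by omega), mul_zero]

lemma PP_coeff_top : ((PP m a₀).map φ).coeff (m + 2) = (m + 1 : ℕ) := by
  rw [PP_map, coeff_sub, coeff_X_mul, coeff_derivative, GG_coeff_top]
  push_cast; ring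

lemma PP_coeff_zero : ((PP m a₀).map φ).coeff 0 = -a₀ := by
  rw [PP_map, coeff_sub, coeff_X_mul_zero, GG_coeff_zero]; simp

lemma PP_deg (hm : ((m + 1 : ℕ) : k) ≠ 0) : ((PP m a₀).map φ).natDegree = m + 2 := by
  apply natDegree_eq_of_le_of_coeff_ne_zero
  · rw [PP_map]
    refine (natDegree_sub_le _ _).trans (max_le ?_ (GG_deg m a₀ φ))
    refine natDegree_mul_le.trans ?_
    rw [natDegree_X]
    have := natDegree_derivative_le ((GG m a₀).map φ)
    have := GG_deg m a₀ φ
    omega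
  · rwa [PP_coeff_top]

lemma PP_root (ha : (a₀ : k) ≠ 0) (r : k) (hr : r ∈ ((PP m a₀).map φ).roots) : r ≠ 0 := by
  rintro rfl
  have := (mem_roots'.1 hr).2
  rw [IsRoot.def, ← coeff_zero_eq_eval_zero, PP_coeff_zero] at this
  exact ha (neg_eq_zero.1 this)

lemma QQ_map [IsAlgClosed k] (hm : ((m + 1 : ℕ) : k) ≠ 0) : (QQ m a₀).map φ = C (((m + 1 : ℕ) : k) ^ (m + 2)) *
    (((PP m a₀).map φ).roots.map (fun r => C (((GG m a₀).map φ).eval r) + X * C r)).prod := by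
  have h1 := res_form ((PP m a₀).map φ) ((GG m a₀).map φ) (m + 2) (PP_deg m a₀ φ hm) (by omega) (GG_deg m a₀ φ)
  have h2 : ((PP m a₀).map φ).leadingCoeff = (m + 1 : ℕ) := by
    rw [leadingCoeff, PP_deg m a₀ φ hm, PP_coeff_top]
  rw [h2] at h1
  rw [← h1, QQ, ← coe_mapRingHom φ, ← resultant_map_map, coe_mapRingHom]
  have hcomm : (mapRingHom φ).comp C = (C : k →+* k[X]).comp φ := RingHom.ext fun x => by simp
  have e1 : ((PP m a₀).map C).map (mapRingHom φ) = ((PP m a₀).map φ).map C := by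
    rw [Polynomial.map_map, Polynomial.map_map, hcomm]
  have e2 : ((GG m a₀).map C + C (X : (MvPolynomial (Fin m) ℤ)[X]) * X).map (mapRingHom φ) =
      ((GG m a₀).map φ).map C + C (X : k[X]) * X := by
    rw [Polynomial.map_add, Polynomial.map_mul, map_X, map_C, Polynomial.map_map, Polynomial.map_map, hcomm,
      coe_mapRingHom, map_X]
  rw [e1, e2]

lemma QQ_deg [IsAlgClosed k] (hm : ((m + 1 : ℕ) : k) ≠ 0) (ha : (a₀ : k) ≠ 0) :
    ((QQ m a₀).map φ).natDegree = m + 2 ∧ (QQ m a₀).map φ ≠ 0 := by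
  have hz : ∀ r ∈ ((PP m a₀).map φ).roots, C (((GG m a₀).map φ).eval r) + X * C r ≠ 0 ∧
      (C (((GG m a₀).map φ).eval r) + X * C r).natDegree = 1 := by
    intro r hr
    have hr0 := PP_root m a₀ φ ha r hr
    have : (C (((GG m a₀).map φ).eval r) + X * C r).natDegree = 1 := by
      rw [add_comm, mul_comm]; exact natDegree_linear hr0
    refine ⟨?_, this⟩
    intro h; rw [h] at this; simp at this
  have h0 : (0 : k[X]) ∉ ((PP m a₀).map φ).roots.map (fun r => C (((GG m a₀).map φ).eval r) + X * C r) := by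
    intro h
    obtain ⟨r, hr, h1⟩ := Multiset.mem_map.1 h
    exact (hz r hr).1 h1
  have hc : ((m + 1 : ℕ) : k) ^ (m + 2) ≠ 0 := pow_ne_zero _ hm
  rw [QQ_map m a₀ φ hm]
  refine ⟨?_, mul_ne_zero (C_ne_zero.2 hc) (Multiset.prod_ne_zero h0)⟩
  rw [natDegree_C_mul hc, natDegree_multiset_prod _ h0, Multiset.map_map, Multiset.map_congr rfl (g := fun _ => 1)]
  · rw [Multiset.map_const', Multiset.sum_replicate, smul_eq_mul, mul_one,
      ← (IsAlgClosed.splits ((PP m a₀).map φ)).natDegree_eq_card_roots, PP_deg m a₀ φ hm]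
  · intro r hr; exact (hz r hr).2

lemma DD_zero [IsAlgClosed k] (hm : ((m + 1 : ℕ) : k) ≠ 0) (ha : (a₀ : k) ≠ 0) (t r s : k)
    (hrs : ({r, s} : Multiset k) ≤ ((PP m a₀).map φ).roots) (hr : ((GG m a₀).map φ).eval r + t * r = 0)
    (hs : ((GG m a₀).map φ).eval s + t * s = 0) : φ (DD m a₀) = 0 ∧ ((QQ m a₀).map φ).eval t = 0 := by
  obtain ⟨w, hw⟩ := Multiset.le_iff_exists_add.1 hrs
  have h1 := QQ_map m a₀ φ hm
  rw [hw] at h1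
  simp only [Multiset.insert_eq_cons, Multiset.map_add, Multiset.map_cons, Multiset.map_singleton, Multiset.prod_add,
    Multiset.prod_cons, Multiset.prod_singleton] at h1
  have e1 : ((QQ m a₀).map φ).eval t = 0 := by
    rw [h1]; simp only [eval_mul, eval_add, eval_C, eval_X, hr]; ring
  have e2 : ((QQ m a₀).map φ).derivative.eval t = 0 := by
    rw [h1]; simp only [derivative_mul, derivative_add, derivative_C, derivative_X, eval_mul, eval_add, eval_C, eval_X, eval_zero, hr, hs]; ring
  refine ⟨?_, e1⟩
  obtain ⟨u, v, -, -, huv⟩ := exists_mul_add_mul_eq_C_resultant (m := m + 2) (n := m + 1) ((QQ m a₀).map φ) ((QQ m a₀).map φ).derivative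
    (QQ_deg m a₀ φ hm ha).1.le ((natDegree_derivative_le _).trans (by rw [(QQ_deg m a₀ φ hm ha).1]; omega)) (by omega)
  have := congrArg (eval t) huv
  rw [eval_add, eval_mul, eval_mul, e1, e2, eval_C, derivative_map, resultant_map_map] at this
  rw [DD, ← this]; ring

end

lemma DD_ne (m : ℕ) (a₀ : ℤ) (ha : a₀ ≠ 0) : DD m a₀ ≠ 0 := by
  intro h
  let φ : MvPolynomial (Fin m) ℤ →+* ℂ := (MvPolynomial.aeval (fun _ => (0 : ℂ))).toRingHom
  have hm : ((m + 1 : ℕ) : ℂ) ≠ 0 := by exact_mod_cast Nat.succ_ne_zero m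
  have ha' : (a₀ : ℂ) ≠ 0 := by exact_mod_cast ha
  have hG : (GG m a₀).map φ = X ^ (m + 2) + C (a₀ : ℂ) := by
    rw [GG_map]; simp [φ]
  have hP : (PP m a₀).map φ = C ((m + 1 : ℕ) : ℂ) * (X ^ (m + 2) - C (a₀ / ((m + 1 : ℕ) : ℂ))) := by
    rw [PP_map, hG, mul_sub, ← C_mul, mul_div_cancel₀ _ hm]
    simp only [derivative_add, derivative_X_pow, derivative_C, add_zero]
    rw [show m + 2 - 1 = m + 1 by omega, pow_succ X (m + 1)]
    simp only [C_eq_natCast]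
    push_cast; ring
  have hnd : ((PP m a₀).map φ).roots.Nodup := by
    rw [hP, roots_C_mul _ hm]
    exact nodup_roots (separable_X_pow_sub_C _ (by exact_mod_cast (by omega : m + 2 ≠ 0)) (div_ne_zero ha' hm))
  have hval : ∀ r ∈ ((PP m a₀).map φ).roots, r ≠ 0 ∧ ((GG m a₀).map φ).eval r = ((m + 2 : ℕ) : ℂ) * (a₀ / ((m + 1 : ℕ) : ℂ)) := by
    intro r hr
    refine ⟨PP_root m a₀ φ ha' r hr, ?_⟩
    have := (mem_roots'.1 hr).2
    rw [hP, IsRoot.def, eval_mul, eval_C, mul_eq_zero, or_iff_right hm] at this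
    simp only [eval_sub, eval_pow, eval_X, eval_C, sub_eq_zero] at this
    rw [hG]; simp only [eval_add, eval_pow, eval_X, eval_C]
    rw [this]; field_simp; push_cast; ring
  set E : ℂ := ((m + 2 : ℕ) : ℂ) * (a₀ / ((m + 1 : ℕ) : ℂ))
  have hE : E ≠ 0 := mul_ne_zero (by exact_mod_cast (by omega : m + 2 ≠ 0)) (div_ne_zero ha' hm)
  have hroots : ((QQ m a₀).map φ).roots = ((PP m a₀).map φ).roots.map (fun r => - (r⁻¹ * E)) := by
    rw [QQ_map m a₀ φ hm, roots_C_mul _ (pow_ne_zero _ hm), roots_multiset_prod, Multiset.bind_map]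
    · rw [← Multiset.bind_singleton]
      apply Multiset.bind_congr
      intro r hr
      obtain ⟨h1, h2⟩ := hval r hr
      rw [h2, add_comm, mul_comm, roots_C_mul_X_add_C _ h1]
    · intro h
      obtain ⟨r, hr, h1⟩ := Multiset.mem_map.1 h
      have := congrArg (fun q => q.coeff 1) h1
      simp at this
      exact (hval r hr).1 this
  have hnd' : ((QQ m a₀).map φ).roots.Nodup := by
    rw [hroots]
    apply Multiset.Nodup.map_on _ hnd
    intro r hr s hs h
    exact inv_injective (mul_right_cancel₀ hE (neg_injective h))
  have hsep : ((QQ m a₀).map φ).Separable := by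
    rw [← nodup_roots_iff_of_splits (QQ_deg m a₀ φ hm ha').2 (IsAlgClosed.splits _)]
    exact hnd'
  have h1 : φ (DD m a₀) = 0 := by rw [h, _root_.map_zero]
  rw [DD, ← resultant_map_map, ← derivative_map] at h1
  have hdeg := (QQ_deg m a₀ φ hm ha').1
  have hdeg' : ((QQ m a₀).map φ).derivative.natDegree = m + 1 := by
    rw [natDegree_derivative, hdeg]; rfl
  have h2 : resultant ((QQ m a₀).map φ) ((QQ m a₀).map φ).derivative = 0 := by rw [hdeg, hdeg', h1]
  exact (resultant_eq_zero_iff.1 h2).2 hsep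

lemma mult2 {k : Type} [DecidableEq k] (s : Multiset k) (h : s.toFinset.card + 2 ≤ s.card) :
    ∃ a b, (a ≠ b ∧ 2 ≤ s.count a ∧ 2 ≤ s.count b) ∨ (a = b ∧ 3 ≤ s.count a) := by
  have h1 : s.dedup ≤ s := Multiset.dedup_le s
  have h2 : 2 ≤ (s - s.dedup).card := by
    rw [Multiset.card_sub h1]
    have : s.toFinset.card = s.dedup.card := rfl
    omega
  obtain ⟨w, hwc⟩ := Multiset.card_pos_iff_exists_mem.1 (show 0 < (Multiset.powersetCard 2 (s - s.dedup)).card by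
    rw [Multiset.card_powersetCard]; exact Nat.choose_pos h2)
  obtain ⟨hw, hc⟩ := Multiset.mem_powersetCard.1 hwc
  obtain ⟨a, b, rfl⟩ := Multiset.card_eq_two.1 hc
  have key : ∀ x, x ∈ s → s.count x = (s - s.dedup).count x + 1 := by
    intro x hx
    have h3 : s.dedup.count x = 1 := Multiset.count_eq_one_of_mem (Multiset.nodup_dedup s) (Multiset.mem_dedup.2 hx)
    have h4 : 1 ≤ s.count x := Multiset.one_le_count_iff_mem.2 hx
    rw [Multiset.count_sub, h3]; omega
  have hsub : s - s.dedup ≤ s := Multiset.sub_le_self _ _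
  have ha : a ∈ s := Multiset.mem_of_le (hw.trans hsub) (by simp)
  have hb : b ∈ s := Multiset.mem_of_le (hw.trans hsub) (by simp)
  have ca := Multiset.count_le_of_le a hw
  have cb := Multiset.count_le_of_le b hw
  refine ⟨a, b, ?_⟩
  by_cases hab : a = b
  · right
    subst hab
    refine ⟨rfl, ?_⟩
    rw [key a ha]
    rw [Multiset.insert_eq_cons, Multiset.count_cons_self, Multiset.count_singleton_self] at ca; omega
  · left
    rw [key a ha, key b hb]
    rw [Multiset.insert_eq_cons, Multiset.count_cons_self] at ca
    rw [Multiset.insert_eq_cons, Multiset.count_cons, Multiset.count_singleton_self] at cb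
    exact ⟨hab, by omega, by omega⟩

lemma zf_two {p n : ℕ} [Fact p.Prime] {k : Type} [Field k] [IsAlgClosed k] [Algebra (ZMod p) k] {f : (ZMod p)[X]} (hf : f.Monic)
    (hn : n + 2 ≤ f.natDegree) (h : ZF p n f) :
    ∃ a b : k, (a ≠ b ∧ (X - C a) ^ 2 * (X - C b) ^ 2 ∣ f.map (algebraMap (ZMod p) k)) ∨
      (a = b ∧ (X - C a) ^ 3 ∣ f.map (algebraMap (ZMod p) k)) := by
  classical
  obtain ⟨u, h1, h2, h3⟩ := h
  set F := f.map (algebraMap (ZMod p) k) with hF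
  have hFm : F.Monic := hf.map _
  have hs : F.Splits := IsAlgClosed.splits F
  have hcard : F.roots.card = f.natDegree := by rw [← hs.natDegree_eq_card_roots, hf.natDegree_map]
  have hsub : F.roots.toFinset ⊆ (u.map (algebraMap (ZMod p) k)).roots.toFinset := by
    intro z hz
    rw [Multiset.mem_toFinset] at hz ⊢
    rw [mem_roots (h1.map _).ne_zero]
    have h4 : F ∣ (u.map (algebraMap (ZMod p) k)) ^ f.natDegree := by
      rw [← Polynomial.map_pow]; exact Polynomial.map_dvd _ h3
    have h5 := (mem_roots'.1 hz).2.dvd h4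
    rw [IsRoot.def, eval_pow] at h5
    exact eq_zero_of_pow_eq_zero h5
  have hle : F.roots.toFinset.card ≤ n := by
    refine (Finset.card_le_card hsub).trans ((Multiset.toFinset_card_le _).trans ((card_roots' _).trans ?_))
    rw [h1.natDegree_map, h2]
  obtain ⟨a, b, hab⟩ := mult2 F.roots (by omega)
  refine ⟨a, b, ?_⟩
  simp only [count_roots] at hab
  have hF0 := hFm.ne_zero
  rcases hab with ⟨h4, h5, h6⟩ | ⟨h4, h5⟩
  · left
    refine ⟨h4, ?_⟩
    refine IsCoprime.mul_dvd ?_ ((le_rootMultiplicity_iff hF0).1 h5) ((le_rootMultiplicity_iff hF0).1 h6)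
    exact (pairwise_coprime_X_sub_C (s := id) Function.injective_id h4).pow
  · right
    exact ⟨h4, (le_rootMultiplicity_iff hF0).1 h5⟩

lemma dvd_both {k : Type} [Field k] {F : k[X]} {a b : k} (h : (a ≠ b ∧ (X - C a) ^ 2 * (X - C b) ^ 2 ∣ F) ∨
      (a = b ∧ (X - C a) ^ 3 ∣ F)) : (X - C a) * (X - C b) ∣ F ∧ (X - C a) * (X - C b) ∣ derivative F := by
  rcases h with ⟨-, w, hw⟩ | ⟨rfl, w, hw⟩
  · have : F = ((X - C a) * (X - C b)) ^ 2 * w := by rw [hw]; ring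
    rw [this]
    refine ⟨⟨((X - C a) * (X - C b)) * w, by ring⟩, ?_⟩
    rw [derivative_mul, derivative_pow]
    refine dvd_add ⟨C (2:k) * derivative ((X - C a) * (X - C b)) * w, by simp; ring⟩ ⟨((X - C a) * (X - C b)) * derivative w, by ring⟩
  · rw [hw]
    refine ⟨⟨(X - C a) * w, by ring⟩, ?_⟩
    rw [derivative_mul, derivative_pow]
    refine dvd_add ⟨C (3:k) * derivative (X - C a) * w, by simp; ring⟩ ⟨(X - C a) * derivative w, by ring⟩

lemma zd_two {d B D : ℕ} (hg : GoodD d B D) {f : ℤ[X]} (h : ZD d D f) {p : ℕ} (hp : p ∈ D.primeFactors) :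
    ZF p (d - 2) (f.map (Int.castRingHom (ZMod p))) := by
  obtain ⟨u, h1, h2, h3⟩ := h p hp
  obtain ⟨-, h4, h5⟩ := hg.2 p hp
  have : Fact p.Prime := ⟨Nat.prime_of_mem_primeFactors hp⟩
  refine ⟨u * X ^ (D.factorization p - 2), h1.mul (monic_X_pow _), ?_, ?_⟩
  · rw [h1.natDegree_mul (monic_X_pow _), natDegree_X_pow, h2]; omega
  · rw [mul_pow]; exact h3.mul_right _

/-- upper coefficients -/
def uv (m : ℕ) (f : ℤ[X]) : Fin m → ℤ := fun i => f.coeff (i + 2)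

lemma GG_eq {m : ℕ} {a₀ : ℤ} {f : ℤ[X]} (hf : f.Monic) (hd : f.natDegree = m + 2) (h0 : f.coeff 0 = a₀) :
    f = (GG m a₀).map (MvPolynomial.eval (uv m f)) + C (f.coeff 1) * X := by
  have h1 := f.as_sum_range_C_mul_X_pow
  have h2 : f.coeff (m + 2) = 1 := by rw [← hd]; exact hf.coeff_natDegree
  rw [hd, Finset.sum_range_succ, h2, Finset.sum_range_succ', Finset.sum_range_succ', h0] at h1
  nth_rw 1 [h1]
  simp only [GG, Polynomial.map_add, Polynomial.map_pow, map_X, Polynomial.map_sum, Polynomial.map_mul, map_C,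
    MvPolynomial.eval_X, uv]
  rw [Finset.sum_range]
  simp
  ring

lemma DD_key {m B D : ℕ} {a₀ : ℤ} (hm : 1 ≤ m) (ha : a₀ ≠ 0) (hB : a₀.natAbs ≤ B) (hB' : m + 2 ≤ B) (hg : GoodD (m + 2) B D)
    {f : ℤ[X]} (hf : f.Monic) (hd : f.natDegree = m + 2) (h0 : f.coeff 0 = a₀) (h : ZD (m + 2) D f) {p : ℕ}
    (hp : p ∈ D.primeFactors) : (p : ℤ) ∣ MvPolynomial.eval (uv m f) (DD m a₀) ∧
    (((QQ m a₀).map (MvPolynomial.eval (uv m f))).map (Int.castRingHom (ZMod p))).eval (f.coeff 1 : ZMod p) = 0 := by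
  have : Fact p.Prime := ⟨Nat.prime_of_mem_primeFactors hp⟩
  let k := AlgebraicClosure (ZMod p)
  have : CharP k p := charP_of_injective_algebraMap (algebraMap (ZMod p) k).injective p
  have hBp := (hg.2 p hp).1
  have hz := zd_two hg h hp
  obtain ⟨a, b, hab⟩ := zf_two (k := k) (hf.map _) (by rw [hf.natDegree_map, hd]; omega) hz
  obtain ⟨d1, d2⟩ := dvd_both hab
  set φ : MvPolynomial (Fin m) ℤ →+* k := (Int.castRingHom k).comp (MvPolynomial.eval (uv m f))
  have hcast : (algebraMap (ZMod p) k).comp (Int.castRingHom (ZMod p)) = Int.castRingHom k := RingHom.ext_int _ _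
  have hF : (f.map (Int.castRingHom (ZMod p))).map (algebraMap (ZMod p) k) = (GG m a₀).map φ + C (f.coeff 1 : k) * X := by
    rw [Polynomial.map_map, hcast]
    nth_rw 1 [GG_eq hf hd h0]
    rw [Polynomial.map_add, Polynomial.map_mul, map_C, map_X, Polynomial.map_map]; rfl
  rw [hF] at d1 d2
  have hm' : ((m + 1 : ℕ) : k) ≠ 0 := by
    rw [Ne, CharP.cast_eq_zero_iff k p]
    intro h; have := Nat.le_of_dvd (by omega) h; omega
  have ha' : (a₀ : k) ≠ 0 := by
    rw [Ne, CharP.intCast_eq_zero_iff k p, Int.natCast_dvd]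
    intro h; have := Nat.le_of_dvd (Int.natAbs_pos.2 ha) h; omega
  have hPP : (X - C a) * (X - C b) ∣ (PP m a₀).map φ := by
    have : (PP m a₀).map φ = X * derivative ((GG m a₀).map φ + C (f.coeff 1 : k) * X) - ((GG m a₀).map φ + C (f.coeff 1 : k) * X) := by
      rw [PP_map]; simp only [derivative_add, derivative_mul, derivative_C, derivative_X]; ring
    rw [this]
    exact dvd_sub (d2.mul_left _) d1
  have hP0 : (PP m a₀).map φ ≠ 0 := by
    intro h; have := PP_deg m a₀ φ hm'; rw [h] at this; simp at this
  have hrs : ({a, b} : Multiset k) ≤ ((PP m a₀).map φ).roots := by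
    have := roots.le_of_dvd hP0 hPP
    rw [roots_mul (mul_ne_zero (X_sub_C_ne_zero _) (X_sub_C_ne_zero _)), roots_X_sub_C, roots_X_sub_C] at this
    exact this
  have e1 : ((GG m a₀).map φ).eval a + (f.coeff 1 : k) * a = 0 := by
    have := dvd_iff_isRoot.1 ((dvd_mul_right _ _).trans d1)
    simpa using this
  have e2 : ((GG m a₀).map φ).eval b + (f.coeff 1 : k) * b = 0 := by
    have := dvd_iff_isRoot.1 ((dvd_mul_left _ _).trans d1)
    simpa using this
  obtain ⟨r1, r3⟩ := DD_zero m a₀ φ hm' ha' _ a b hrs e1 e2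
  refine ⟨(CharP.intCast_eq_zero_iff k p _).1 r1, ?_⟩
  apply (algebraMap (ZMod p) k).injective
  rw [_root_.map_zero, ← r3, ← eval_map_apply, Polynomial.map_map, Polynomial.map_map, hcast]
  simp [φ]

lemma QQ_roots {m B : ℕ} {a₀ : ℤ} (ha : a₀ ≠ 0) (hB : a₀.natAbs ≤ B) (hB' : m + 2 ≤ B) (a : Fin m → ℤ) {p : ℕ} (hP : p.Prime) (hp : B < p) :
    ({x : Fin 1 → ZMod p | (((QQ m a₀).map (MvPolynomial.eval a)).map (Int.castRingHom (ZMod p))).eval (x 0) = 0}).ncard ≤ m + 2 := by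
  have : Fact p.Prime := ⟨hP⟩
  let k := AlgebraicClosure (ZMod p)
  have : CharP k p := charP_of_injective_algebraMap (algebraMap (ZMod p) k).injective p
  set φ : MvPolynomial (Fin m) ℤ →+* k := (Int.castRingHom k).comp (MvPolynomial.eval a)
  have hcast : (algebraMap (ZMod p) k).comp (Int.castRingHom (ZMod p)) = Int.castRingHom k := RingHom.ext_int _ _
  have hm' : ((m + 1 : ℕ) : k) ≠ 0 := by
    rw [Ne, CharP.cast_eq_zero_iff k p]
    intro h; have := Nat.le_of_dvd (by omega) h; omega
  have ha' : (a₀ : k) ≠ 0 := by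
    rw [Ne, CharP.intCast_eq_zero_iff k p, Int.natCast_dvd]
    intro h; have := Nat.le_of_dvd (Int.natAbs_pos.2 ha) h; omega
  set q := ((QQ m a₀).map (MvPolynomial.eval a)).map (Int.castRingHom (ZMod p)) with hq
  have hqk : q.map (algebraMap (ZMod p) k) = (QQ m a₀).map φ := by
    rw [hq, Polynomial.map_map, Polynomial.map_map, hcast]
  obtain ⟨h1, h2⟩ := QQ_deg m a₀ φ hm' ha'
  rw [← hqk] at h1 h2
  rw [natDegree_map] at h1
  have hq0 : q ≠ 0 := by rintro h; rw [h] at h2; simp at h2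
  have hmap : Set.MapsTo (fun x : Fin 1 → ZMod p => x 0) {x | q.eval (x 0) = 0} (q.roots.toFinset : Set (ZMod p)) := by
    intro x hx
    rw [Finset.mem_coe, Multiset.mem_toFinset, mem_roots hq0]
    exact hx
  have hinj : Set.InjOn (fun x : Fin 1 → ZMod p => x 0) {x | q.eval (x 0) = 0} := by
    intro x _ y _ h
    ext i; rw [Subsingleton.elim i 0]; exact h
  have := Set.ncard_le_ncard_of_injOn _ hmap hinj (Finset.finite_toSet _)
  rw [Set.ncard_coe_finset] at this
  exact this.trans ((Multiset.toFinset_card_le _).trans ((card_roots' _).trans h1.le))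

lemma uv_fib {m N : ℕ} {a₀ : ℤ} {f g : ℤ[X]} (hf : f ∈ PF (m + 2) a₀ N) (hg : g ∈ PF (m + 2) a₀ N) (h : uv m f = uv m g)
    (h1 : f.coeff 1 = g.coeff 1) : f = g := by
  rw [GG_eq hf.1 hf.2.1 hf.2.2.1, GG_eq hg.1 hg.2.1 hg.2.2.1, h, h1]

lemma uv_box {m N : ℕ} {a₀ : ℤ} {f : ℤ[X]} (hf : f ∈ PF (m + 2) a₀ N) : uv m f ∈ ibox m N :=
  mem_ibox.2 fun i => hf.2.2.2 _ (by omega) (by have := i.2; omega)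

lemma case1_a (m : ℕ) (hm : 1 ≤ m) (a₀ : ℤ) (ha : a₀ ≠ 0) :
    LB m (fun N => {f ∈ PF (m + 2) a₀ N | MvPolynomial.eval (uv m f) (DD m a₀) = 0}) := by
  classical
  refine ⟨((DD m a₀).totalDegree + 1) * 3 ^ m, by positivity, 0, fun N hN => ?_⟩
  have hI := ((Fintype.piFinset (fun _ : Fin m => Finset.Icc (-(N:ℤ)) N)).filter (fun a => MvPolynomial.eval a (DD m a₀) = 0)).finite_toSet
  have h := ncard_fib (S := {f ∈ PF (m + 2) a₀ N | MvPolynomial.eval (uv m f) (DD m a₀) = 0}) (B := 2 * N + 1) (uv m) hI ?_ ?_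
  · refine ⟨h.1, h.2.trans ?_⟩
    rw [Set.ncard_coe_finset]
    have hz : ((((Fintype.piFinset (fun _ : Fin m => Finset.Icc (-(N:ℤ)) N)).filter (fun a => MvPolynomial.eval a (DD m a₀) = 0)).card : ℕ) : ℝ)
      ≤ (((DD m a₀).totalDegree * (Finset.Icc (-(N:ℤ)) N).card ^ (m - 1) : ℕ) : ℝ) :=
      Nat.cast_le.2 (zeros_card hm _ (DD_ne m a₀ ha) (Finset.Icc (-(N:ℤ)) N))
    have hc : (Finset.Icc (-(N:ℤ)) N).card = 2 * N + 1 := by rw [Int.card_Icc]; omega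
    rw [hc] at hz
    push_cast at hz
    have hN' : (2:ℝ) ≤ N := by exact_mod_cast hN
    calc _ ≤ ((DD m a₀).totalDegree * (2 * (N:ℝ) + 1) ^ (m - 1)) * (2 * N + 1) := by gcongr
      _ = (DD m a₀).totalDegree * (2 * (N:ℝ) + 1) ^ m := by
        obtain ⟨k, rfl⟩ := Nat.exists_eq_add_of_le' hm
        simp only [Nat.add_sub_cancel]; ring
      _ ≤ ((DD m a₀).totalDegree + 1) * (3 * (N:ℝ)) ^ m := by gcongr <;> linarith
      _ = _ := by rw [mul_pow]; ring
  · rintro f ⟨hf, h0⟩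
    exact Finset.mem_coe.2 (Finset.mem_filter.2 ⟨uv_box hf, h0⟩)
  · intro a _
    have hmap : Set.MapsTo (fun f : ℤ[X] => f.coeff 1) {f ∈ {f ∈ PF (m + 2) a₀ N | MvPolynomial.eval (uv m f) (DD m a₀) = 0} | uv m f = a}
        (Finset.Icc (-(N:ℤ)) N : Finset ℤ) := by
      rintro f ⟨⟨hf, -⟩, -⟩
      exact Finset.mem_coe.2 (Finset.mem_Icc.2 (abs_le.1 (hf.2.2.2 1 le_rfl (by omega))))
    have hinj : Set.InjOn (fun f : ℤ[X] => f.coeff 1) {f ∈ {f ∈ PF (m + 2) a₀ N | MvPolynomial.eval (uv m f) (DD m a₀) = 0} | uv m f = a} := by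
      rintro f ⟨⟨hf, -⟩, h1⟩ g ⟨⟨hg, -⟩, h2⟩ h
      exact uv_fib hf hg (h1.trans h2.symm) h
    refine ⟨Set.Finite.of_injOn hmap hinj (Finset.finite_toSet _), ?_⟩
    have := Set.ncard_le_ncard_of_injOn _ hmap hinj (Finset.finite_toSet _)
    rw [Set.ncard_coe_finset, Int.card_Icc] at this
    have h3 : ((N:ℤ) + 1 - -N).toNat = 2 * N + 1 := by omega
    rw [h3] at this
    exact_mod_cast this

lemma case1 (m : ℕ) (hm : 1 ≤ m) (a₀ : ℤ) (ha : a₀ ≠ 0) (B : ℕ) (hB : a₀.natAbs ≤ B) (hB' : m + 2 ≤ B) :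
    LB m (fun N => {f ∈ PF (m + 2) a₀ N | ∃ D, GoodD (m + 2) B D ∧ ZD (m + 2) D f ∧ N < rd D}) := by
  classical
  obtain ⟨C, hC, Ω, hbox⟩ := omega_box hm (DD m a₀) (DD_ne m a₀ ha) (2 * (m + 2)) (by omega)
  have hL : LB m (fun N => {f ∈ PF (m + 2) a₀ N | MvPolynomial.eval (uv m f) (DD m a₀) ≠ 0 ∧
      ∃ D, GoodD (m + 2) B D ∧ ZD (m + 2) D f ∧ N < rd D}) := by
    refine ⟨4 * C, by positivity, Ω, fun N hN => ?_⟩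
    let T := ((ibox m N).filter (fun a => MvPolynomial.eval a (DD m a₀) ≠ 0)).sigma
      (fun a => (MvPolynomial.eval a (DD m a₀)).natAbs.primeFactors.powerset)
    let G : (Σ _ : Fin m → ℤ, Finset ℕ) → Set ℤ[X] := fun t => {f ∈ PF (m + 2) a₀ N | uv m f = t.1 ∧ N < ∏ p ∈ t.2, p ∧
      ∀ p ∈ t.2, p.Prime ∧ B < p ∧
        (((QQ m a₀).map (MvPolynomial.eval t.1)).map (Int.castRingHom (ZMod p))).eval (f.coeff 1 : ZMod p) = 0}
    have hsub : {f ∈ PF (m + 2) a₀ N | MvPolynomial.eval (uv m f) (DD m a₀) ≠ 0 ∧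
      ∃ D, GoodD (m + 2) B D ∧ ZD (m + 2) D f ∧ N < rd D} ⊆ ⋃ t ∈ T, G t := by
      rintro f ⟨hf, h0, D, hg, hz, hr⟩
      simp only [Set.mem_iUnion]
      have hk := fun p (hp : p ∈ D.primeFactors) => DD_key hm ha hB hB' hg hf.1 hf.2.1 hf.2.2.1 hz hp
      refine ⟨⟨uv m f, D.primeFactors⟩, Finset.mem_sigma.2 ⟨Finset.mem_filter.2 ⟨uv_box hf, h0⟩, Finset.mem_powerset.2 ?_⟩,
        hf, rfl, hr, ?_⟩
      · intro p hp
        exact Nat.mem_primeFactors.2 ⟨Nat.prime_of_mem_primeFactors hp, Int.natCast_dvd.1 (hk p hp).1, Int.natAbs_ne_zero.2 h0⟩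
      · intro p hp
        exact ⟨Nat.prime_of_mem_primeFactors hp, (hg.2 p hp).1, (hk p hp).2⟩
    have hG : ∀ t ∈ T, (G t).Finite ∧ ((G t).ncard : ℝ) ≤ 4 * ((m + 2 : ℕ) : ℝ) ^ (MvPolynomial.eval t.1 (DD m a₀)).natAbs.primeFactors.card := by
      rintro ⟨a, s⟩ ht
      obtain ⟨h1, h2⟩ := Finset.mem_sigma.1 ht
      have h2 := Finset.mem_powerset.1 h2
      dsimp only at h1 h2 ⊢
      rcases (G ⟨a, s⟩).eq_empty_or_nonempty with he | ⟨f0, hf0, -, hNs, hps⟩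
      · rw [he, Set.ncard_empty, Nat.cast_zero]; exact ⟨Set.finite_empty, by positivity⟩
      dsimp only at hNs hps
      have hpr : ∀ p ∈ s, p.Prime := fun p hp => (hps p hp).1
      have hpf : (∏ p ∈ s, p).primeFactors = s := Nat.primeFactors_prod hpr
      have hrs : ∏ p ∈ s, p = rd (∏ p ∈ s, p) := by unfold rd; rw [hpf]
      have hcrt := crt_box (ι := Fin 1) (∏ p ∈ s, p) (hrs ▸ rd_sq _) (fun _ => N) (fun p => {x : Fin 1 → ZMod p |
        (((QQ m a₀).map (MvPolynomial.eval a)).map (Int.castRingHom (ZMod p))).eval (x 0) = 0}) (fun _ => m + 2) (by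
          intro p hp
          rw [hpf] at hp
          exact QQ_roots ha hB hB' a (hps p hp).1 (hps p hp).2.1)
      have hmap : Set.MapsTo (fun (f : ℤ[X]) (_ : Fin 1) => f.coeff 1) (G ⟨a, s⟩) {a_1 : Fin 1 → ℤ | (∀ i, |a_1 i| ≤ (N:ℤ)) ∧
          ∀ p ∈ (∏ p ∈ s, p).primeFactors, (fun i => (a_1 i : ZMod p)) ∈ {x : Fin 1 → ZMod p |
        (((QQ m a₀).map (MvPolynomial.eval a)).map (Int.castRingHom (ZMod p))).eval (x 0) = 0}} := by
        rintro f ⟨hf, h3, h4, h5⟩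
        refine ⟨fun _ => hf.2.2.2 1 le_rfl (by omega), fun p hp => ?_⟩
        rw [hpf] at hp
        exact (h5 p hp).2.2
      have hinj : Set.InjOn (fun (f : ℤ[X]) (_ : Fin 1) => f.coeff 1) (G ⟨a, s⟩) := by
        rintro f ⟨hf, h3, -⟩ g ⟨hg, h4, -⟩ h
        exact uv_fib hf hg (h3.trans h4.symm) (congrFun h 0)
      refine ⟨Set.Finite.of_injOn hmap hinj hcrt.1, ?_⟩
      refine (Nat.cast_le.2 (Set.ncard_le_ncard_of_injOn _ hmap hinj hcrt.1)).trans (hcrt.2.trans ?_)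
      rw [hpf, Finset.prod_const, Finset.prod_const, Finset.card_univ, Fintype.card_fin, pow_one]
      have h6 : 2 * (N:ℝ) / ((∏ p ∈ s, p : ℕ) : ℝ) + 2 ≤ 4 := by
        have : (N:ℝ) < ((∏ p ∈ s, p : ℕ) : ℝ) := by exact_mod_cast hNs
        have h0 : (0:ℝ) < ((∏ p ∈ s, p : ℕ) : ℝ) := lt_of_le_of_lt (Nat.cast_nonneg N) this
        have : 2 * (N:ℝ) / ((∏ p ∈ s, p : ℕ) : ℝ) ≤ 2 := by rw [div_le_iff₀ h0]; linarith
        linarith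
      gcongr
      · push_cast; linarith
    have hfin : (⋃ t ∈ T, G t).Finite := Set.Finite.biUnion T.finite_toSet fun q hq => (hG q hq).1
    refine ⟨hfin.subset hsub, ?_⟩
    calc _ ≤ ((⋃ t ∈ T, G t).ncard : ℝ) := Nat.cast_le.2 (Set.ncard_le_ncard hsub hfin)
      _ ≤ ∑ t ∈ T, ((G t).ncard : ℝ) := by exact_mod_cast Finset.set_ncard_biUnion_le T _
      _ ≤ ∑ t ∈ T, 4 * ((m + 2 : ℕ) : ℝ) ^ (MvPolynomial.eval t.1 (DD m a₀)).natAbs.primeFactors.card :=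
        Finset.sum_le_sum fun q hq => (hG q hq).2
      _ = 4 * ∑ a ∈ (ibox m N).filter (fun a => MvPolynomial.eval a (DD m a₀) ≠ 0),
          ((2 * (m + 2) : ℕ) : ℝ) ^ (MvPolynomial.eval a (DD m a₀)).natAbs.primeFactors.card := by
        rw [Finset.mul_sum, Finset.sum_sigma]
        apply Finset.sum_congr rfl
        intro a _
        dsimp only
        rw [Finset.sum_const, nsmul_eq_mul, Finset.card_powerset]
        push_cast
        rw [mul_pow]; ring
      _ ≤ _ := by
        have := hbox N hN
        rw [mul_assoc, mul_assoc, ← mul_assoc C]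
        gcongr
  refine ((case1_a m hm a₀ ha).union hL).mono fun N _ f hf => ?_
  by_cases h : MvPolynomial.eval (uv m f) (DD m a₀) = 0
  · exact Or.inl ⟨hf.1, h⟩
  · exact Or.inr ⟨hf.1, h, hf.2⟩

open NumberField.InfinitePlace NumberField.mixedEmbedding in
lemma mink_lt (K : Type) [Field K] [NumberField K] {d T : ℕ} (hd : Module.finrank ℚ K = d)
    (hT : (discr K).natAbs ≤ T) {R : NNReal} (hR : NNReal.sqrt T * 2 ^ d < R) : minkowskiBound K ↑1 < R := by
  refine lt_of_le_of_lt ?_ (ENNReal.coe_lt_coe.mpr hR)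
  rw [minkowskiBound, volume_fundamentalDomain_fractionalIdealLatticeBasis,
    Units.val_one, FractionalIdeal.absNorm_one, Rat.cast_one,
    ENNReal.ofReal_one, one_mul, mixedEmbedding.finrank, hd, volume_fundamentalDomain_latticeBasis,
    ENNReal.coe_mul, ENNReal.coe_pow, ENNReal.coe_ofNat, show ((NNReal.sqrt T : NNReal) : ENNReal) = 1 * (NNReal.sqrt T : NNReal) by rw [one_mul]]
  gcongr
  · exact pow_le_one₀ (by positivity) (by simp)
  · rw [← NNReal.coe_le_coe, coe_nnnorm, Int.norm_eq_abs, NNReal.coe_natCast, ← Int.cast_abs, Int.abs_eq_natAbs]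
    exact_mod_cast hT

open NumberField.InfinitePlace in
lemma prod_place (K : Type) [Field K] [NumberField K] {d : ℕ} (hd : Module.finrank ℚ K = d) [DecidableEq (InfinitePlace K)] (w₀ : InfinitePlace K) (x R : NNReal) :
    R ^ mult w₀ * ∏ w : InfinitePlace K, (if w = w₀ then x else R) ^ mult w = x ^ mult w₀ * R ^ d := by
  rw [← hd, ← sum_mult_eq, ← Finset.prod_pow_eq_pow_sum, ← Finset.mul_prod_erase Finset.univ _ (Finset.mem_univ w₀),
    ← Finset.mul_prod_erase Finset.univ (fun w => R ^ mult w) (Finset.mem_univ w₀), if_pos rfl]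
  have : ∏ w ∈ Finset.univ.erase w₀, (if w = w₀ then x else R) ^ mult w = ∏ w ∈ Finset.univ.erase w₀, R ^ mult w :=
    Finset.prod_congr rfl fun w hw => by rw [if_neg (Finset.ne_of_mem_erase hw)]
  rw [this]; ring

open NumberField.InfinitePlace NumberField.mixedEmbedding in
lemma short1 (K : Type) [Field K] [NumberField K] {d T : ℕ} (hd : Module.finrank ℚ K = d) (hd1 : 1 ≤ d)
    (hT : (discr K).natAbs ≤ T) {R : NNReal} (hR1 : 1 ≤ R) (hR : NNReal.sqrt T * 2 ^ d < R ^ (d - 1)) :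
    ∃ a : 𝓞 K, (∀ n : ℤ, a ≠ n) ∧ ∀ σ : K →+* ℂ, ‖σ a‖ ≤ 2 * R := by
  classical
  have hm := mink_lt K hd hT hR
  have hRp : (0:NNReal) < R := lt_of_lt_of_le one_pos hR1
  have hR1' : (1:ℝ) ≤ R := by exact_mod_cast hR1
  obtain ⟨k, rfl⟩ := Nat.exists_eq_add_of_le' hd1
  rw [Nat.add_sub_cancel] at hm
  obtain ⟨w₀⟩ : Nonempty (InfinitePlace K) := inferInstance
  have habs : ∀ n : ℤ, |(n:ℝ)| < 1 → n = 0 := fun n h => by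
    have : |n| < 1 := by exact_mod_cast h
    exact Int.abs_lt_one_iff.1 this
  suffices ∃ a : 𝓞 K, (∀ n : ℤ, a ≠ n) ∧ ∀ w : InfinitePlace K, w a ≤ 2 * R by
    obtain ⟨a, h1, h2⟩ := this
    exact ⟨a, h1, fun σ => h2 (InfinitePlace.mk σ)⟩
  rcases isReal_or_isComplex w₀ with hw | hw
  · have hv : minkowskiBound K ↑1 < MeasureTheory.volume (convexBodyLT K (fun w => if w = w₀ then 1 else R)) := by
      refine hm.trans_le ?_
      rw [convexBodyLT_volume]
      have := prod_place K hd w₀ 1 R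
      rw [mult, if_pos hw, one_pow, one_mul, pow_one, pow_succ', mul_right_inj' hRp.ne'] at this
      rw [this]
      exact le_mul_of_one_le_left' (by exact_mod_cast one_le_convexBodyLTFactor K)
    obtain ⟨a, h1, h2⟩ := exists_ne_zero_mem_ringOfIntegers_lt K hv
    refine ⟨a, ?_, ?_⟩
    · rintro n rfl
      have := h2 w₀
      rw [if_pos rfl, ← norm_embedding_eq] at this
      simp at this
      exact h1 (by rw [habs n this, Int.cast_zero])
    · intro w
      have := (h2 w).le
      split_ifs at this
      · push_cast at this; linarith
      · linarith
  · have hv : minkowskiBound K ↑1 < MeasureTheory.volume (convexBodyLT' K (fun w => if w = w₀ then NNReal.sqrt R else R) ⟨w₀, hw⟩) := by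
      refine hm.trans_le ?_
      rw [convexBodyLT'_volume]
      have := prod_place K hd w₀ (NNReal.sqrt R) R
      rw [mult, if_neg (not_isReal_iff_isComplex.2 hw), NNReal.sq_sqrt, pow_succ' R k, ← mul_assoc, ← pow_two, mul_right_inj' (pow_ne_zero _ hRp.ne')] at this
      rw [this]
      exact le_mul_of_one_le_left' (by exact_mod_cast one_le_convexBodyLT'Factor K)
    obtain ⟨a, h1, h2, h3, h4⟩ := exists_ne_zero_mem_ringOfIntegers_lt' K ⟨w₀, hw⟩ hv
    refine ⟨a, ?_, ?_⟩
    · rintro n rfl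
      simp at h3
      exact h1 (by rw [habs n h3, Int.cast_zero])
    · intro w
      by_cases hw' : w = w₀
      · subst hw'
        rw [if_pos rfl, ← NNReal.coe_pow, NNReal.sq_sqrt] at h4
        rw [← norm_embedding_eq]
        refine (Complex.norm_le_abs_re_add_abs_im _).trans ?_
        linarith
      · have := (h2 w hw').le
        rw [if_neg hw'] at this
        linarith

lemma short2 {α : ℂ} (hα : IsIntegral ℤ α) (hM : Mini α) {d T : ℕ} (hd : Module.finrank ℚ ℚ⟮α⟯ = d) (hd1 : 1 ≤ d)
    (hT : ∀ [NumberField ℚ⟮α⟯], (discr ℚ⟮α⟯).natAbs ≤ T) {R : NNReal} (hR1 : 1 ≤ R) (hR : NNReal.sqrt T * 2 ^ d < R ^ (d - 1)) :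
    ∃ γ : ℂ, IsIntegral ℤ γ ∧ ℚ⟮γ⟯ = ℚ⟮α⟯ ∧ (minpoly ℤ γ).coeff (d - 1) = 0 ∧
      ∀ i, |((minpoly ℤ γ).coeff i : ℝ)| ≤ (4 * d * R) ^ (d - i) * 2 ^ d := by
  have := nf_adj hα
  obtain ⟨a, ha, hb⟩ := short1 ℚ⟮α⟯ hd hd1 hT hR1 hR
  set x : ℂ := algebraMap (𝓞 ℚ⟮α⟯) ℂ a with hx
  have hxK : x ∈ ℚ⟮α⟯ := (a : ℚ⟮α⟯).2
  have hxi : IsIntegral ℤ x := (RingOfIntegers.isIntegral a).algebraMap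
  have hgx : ℚ⟮x⟯ = ℚ⟮α⟯ := by
    refine (hM ℚ⟮x⟯ (adjoin_simple_le_iff.2 hxK)).resolve_left fun h => ?_
    rw [adjoin_simple_eq_bot_iff, mem_bot] at h
    obtain ⟨q, hq⟩ := h
    have hqi : IsIntegral ℤ q := by
      rw [← hq] at hxi
      exact (isIntegral_algebraMap_iff (algebraMap ℚ ℂ).injective).1 hxi
    obtain ⟨n, rfl⟩ := IsIntegrallyClosed.isIntegral_iff.1 hqi
    apply ha n
    have hinj : Function.Injective (algebraMap (𝓞 ℚ⟮α⟯) ℂ) := FaithfulSMul.algebraMap_injective _ _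
    apply hinj
    rw [← hx, ← hq, map_intCast]
    simp
  have hfx := fac_simple hxi hgx.symm a rfl
  set t : ℤ := - (minpoly ℤ x).nextCoeff with ht
  have hts : (t : ℂ) = ∑ τ : ℚ⟮α⟯ →+* ℂ, τ a := by
    have := congrArg nextCoeff hfx
    rw [prod_X_sub_C_nextCoeff, nextCoeff_map (RingHom.injective_int _)] at this
    rw [ht]
    push_cast
    rw [← neg_eq_iff_eq_neg] at this
    exact this
  have hcard : Fintype.card (ℚ⟮α⟯ →+* ℂ) = d := (Embeddings.card _ ℂ).trans hd
  have htb : ‖(t:ℂ)‖ ≤ d * (2 * R) := by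
    rw [hts]
    refine (norm_sum_le _ _).trans ((Finset.sum_le_card_nsmul _ _ _ fun τ _ => hb τ).trans ?_)
    rw [Finset.card_univ, hcard, nsmul_eq_mul]
  let b : 𝓞 ℚ⟮α⟯ := d * a - t
  set γ : ℂ := algebraMap (𝓞 ℚ⟮α⟯) ℂ b with hγ
  have hγx : γ = d * x - t := by simp [hγ, b, hx]
  have hγi : IsIntegral ℤ γ := (RingOfIntegers.isIntegral b).algebraMap
  have hd0 : (d:ℂ) ≠ 0 := by exact_mod_cast (by omega : d ≠ 0)
  have hgγ : ℚ⟮γ⟯ = ℚ⟮α⟯ := by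
    rw [← hgx]
    apply le_antisymm
    · rw [adjoin_simple_le_iff, hγx]
      exact sub_mem (mul_mem (_root_.natCast_mem _ d) (mem_adjoin_simple_self ℚ x)) (intCast_mem _ t)
    · rw [adjoin_simple_le_iff]
      have : x = (γ + t) / d := by rw [hγx]; field_simp; ring
      rw [this]
      exact div_mem (add_mem (mem_adjoin_simple_self ℚ γ) (intCast_mem _ t)) (_root_.natCast_mem _ d)
  have hfγ := fac_simple hγi hgγ.symm b rfl
  have hτb : ∀ τ : ℚ⟮α⟯ →+* ℂ, τ b = d * τ a - t := fun τ => by simp [b]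
  have hdeg : (minpoly ℤ γ).natDegree = d := (minpoly_deg hγi).trans (by rw [hgγ]; exact hd)
  have hmon := minpoly.monic hγi
  refine ⟨γ, hγi, hgγ, ?_, ?_⟩
  · have := congrArg nextCoeff hfγ
    rw [prod_X_sub_C_nextCoeff, nextCoeff_map (RingHom.injective_int _), nextCoeff_of_natDegree_pos (by omega), hdeg] at this
    simp only [hτb] at this
    rw [Finset.sum_sub_distrib, ← Finset.mul_sum, ← hts, Finset.sum_const, Finset.card_univ, hcard, nsmul_eq_mul, sub_self, neg_zero, eq_intCast] at this
    exact_mod_cast this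
  · intro i
    have h1 := coeff_le_of_roots_le (p := minpoly ℤ γ) (f := Int.castRingHom ℂ) (B := 4 * d * R) i hmon (IsAlgClosed.splits _) (by
      intro z hz
      rw [hfγ] at hz
      have h2 := (mem_roots'.1 hz).2
      rw [IsRoot.def, eval_prod, Finset.prod_eq_zero_iff] at h2
      obtain ⟨τ, -, h3⟩ := h2
      rw [eval_sub, eval_X, eval_C, sub_eq_zero] at h3
      rw [h3, hτb]
      refine (norm_sub_le _ _).trans ?_
      rw [norm_mul, Complex.norm_natCast]
      have := mul_le_mul_of_nonneg_left (hb τ) (Nat.cast_nonneg (α := ℝ) d)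
      linarith)
    rw [coeff_map, hdeg] at h1
    simp only [eq_intCast, Complex.norm_intCast] at h1
    refine h1.trans ?_
    gcongr
    exact_mod_cast Nat.choose_le_two_pow d i

lemma red_elt {d : ℕ} (hd : 1 ≤ d) {a₀ : ℤ} {N : ℕ} (hN : 1 ≤ N) {f : ℤ[X]} (hf : f ∈ PF d a₀ N) (hirr : Irreducible f) {α : ℂ}
    (hα : aeval α f = 0) {L : IntermediateField ℚ ℂ} [NumberField L] (hL : L = ℚ⟮α⟯) :
    ∃ a : 𝓞 L, minpoly ℤ (algebraMap (𝓞 L) ℂ a) = f ∧ (Algebra.norm ℤ a).natAbs = a₀.natAbs ∧ ∀ σ : L →+* ℂ, ‖σ a‖ ≤ cA d a₀ * N := by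
  classical
  have hi : IsIntegral ℤ α := ⟨f, hf.1, by rw [← aeval_def]; exact hα⟩
  have hm := minpoly_of_irr hf.1 hirr hα
  have hαL : α ∈ L := by rw [hL]; exact mem_adjoin_simple_self ℚ α
  obtain ⟨a, ha⟩ : ∃ a : 𝓞 L, algebraMap (𝓞 L) ℂ a = α := by
    have h1 : IsIntegral ℤ (⟨α, hαL⟩ : L) := (isIntegral_algebraMap_iff (algebraMap L ℂ).injective).1 hi
    exact ⟨⟨_, h1⟩, rfl⟩
  have hfac := fac_simple hi hL a ha
  rw [hm] at hfac
  refine ⟨a, by rw [ha, hm], ?_, ?_⟩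
  · have h1 := congrArg (fun p => ‖p.coeff 0‖) hfac
    simp only [coeff_zero_prod, norm_prod, coeff_map, hf.2.2.1, coeff_sub, coeff_X_zero, coeff_C_zero, zero_sub, norm_neg] at h1
    rw [nf_norm'] at h1
    have h3 : ((a₀.natAbs : ℕ) : ℝ) = ((Algebra.norm ℤ a).natAbs : ℝ) := by
      rw [← h1, Nat.cast_natAbs]; simp
    exact_mod_cast h3.symm
  · intro σ
    refine le_trans ?_ (mah_le hd hN hf)
    have : mah f = ∏ τ : L →+* ℂ, max 1 ‖τ a‖ := by
      unfold mah
      rw [hfac, mah_prod]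
      simp only [mahlerMeasure_X_sub_C]
    rw [this, ← Finset.mul_prod_erase Finset.univ _ (Finset.mem_univ σ)]
    exact (le_max_right 1 _).trans (le_mul_of_one_le_right (by positivity) (one_le_prod_real _ _ fun _ _ => le_max_left _ _))

lemma red {d : ℕ} (hd : 1 ≤ d) {a₀ : ℤ} (ha : a₀ ≠ 0) {k : ℕ} {H : ℕ → Set ℤ[X]} (hH : LB k H)
    (hHm : ∀ N, ∀ g ∈ H N, g.Monic ∧ g.natDegree ≤ d) :
    LB k (fun N => {f ∈ PF d a₀ N | Irreducible f ∧ ∃ α : ℂ, aeval α f = 0 ∧ ∃ γ, IsIntegral ℤ γ ∧ ℚ⟮γ⟯ = ℚ⟮α⟯ ∧ minpoly ℤ γ ∈ H N}) := by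
  obtain ⟨C, hC, Ω, hH⟩ := hH
  have hcA := one_le_cA hd a₀
  set A := (d * (1 + Real.log (cA d a₀)) + 2) ^ d * ((a₀.natAbs : ℝ) ^ d * (12 * Real.exp 1) ^ d) with hA
  have hlA := Real.log_nonneg hcA
  have ha1 : 1 ≤ a₀.natAbs := Int.natAbs_pos.2 ha
  have hA0 : 0 < A := by
    have : (0:ℝ) < a₀.natAbs := by exact_mod_cast ha1
    positivity
  refine ⟨C * d * A, by have : (0:ℝ) < d := by exact_mod_cast hd
                        positivity, Ω + d, fun N hN => ?_⟩
  obtain ⟨hf, hc⟩ := hH N hN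
  have hl := one_le_log' hN
  have hr := roots_count hf (m := d) (hHm N)
  have hN1 : (1:ℝ) ≤ N := by exact_mod_cast (by omega : 1 ≤ N)
  have hX : 1 ≤ cA d a₀ * N := one_le_mul_of_one_le_of_one_le hcA hN1
  have key := ncard_rel (S := {f ∈ PF d a₀ N | Irreducible f ∧ ∃ α : ℂ, aeval α f = 0 ∧ ∃ γ, IsIntegral ℤ γ ∧ ℚ⟮γ⟯ = ℚ⟮α⟯ ∧ minpoly ℤ γ ∈ H N})
    (fun f γ => IsIntegral ℤ γ ∧ ∃ α : ℂ, aeval α f = 0 ∧ ℚ⟮γ⟯ = ℚ⟮α⟯) hr.1 (B := A * (1 + Real.log N) ^ d) ?_ ?_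
  · refine ⟨key.1, key.2.trans ?_⟩
    calc _ ≤ ((C * (N : ℝ) ^ k * (1 + Real.log N) ^ Ω) * d) * (A * (1 + Real.log N) ^ d) := by
          gcongr
          refine hr.2.trans ?_
          gcongr
      _ = _ := by rw [pow_add]; ring
  · rintro f ⟨-, -, α, h1, γ, h2, h3, h4⟩
    exact ⟨γ, ⟨_, h4, minpoly.aeval ℤ γ⟩, h2, α, h1, h3⟩
  · intro γ _
    rcases Set.eq_empty_or_nonempty {f ∈ {f ∈ PF d a₀ N | Irreducible f ∧ ∃ α : ℂ, aeval α f = 0 ∧ ∃ γ, IsIntegral ℤ γ ∧ ℚ⟮γ⟯ = ℚ⟮α⟯ ∧ minpoly ℤ γ ∈ H N} |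
      IsIntegral ℤ γ ∧ ∃ α : ℂ, aeval α f = 0 ∧ ℚ⟮γ⟯ = ℚ⟮α⟯} with he | ⟨f0, ⟨⟨hf0, hi0, -⟩, hγ, α0, hα0, hγα⟩⟩
    · rw [he, Set.ncard_empty, Nat.cast_zero]; exact ⟨Set.finite_empty, by positivity⟩
    have := nf_adj hγ
    have hfr : Module.finrank ℚ ℚ⟮γ⟯ = d := by
      have hi : IsIntegral ℤ α0 := ⟨f0, hf0.1, by rw [← aeval_def]; exact hα0⟩
      rw [hγα, ← minpoly_deg hi, minpoly_of_irr hf0.1 hi0 hα0, hf0.2.1]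
    have hU := nf_U ℚ⟮γ⟯ a₀.natAbs ha1 (cA d a₀ * N) hX d hfr
    have hsub : {f ∈ {f ∈ PF d a₀ N | Irreducible f ∧ ∃ α : ℂ, aeval α f = 0 ∧ ∃ γ, IsIntegral ℤ γ ∧ ℚ⟮γ⟯ = ℚ⟮α⟯ ∧ minpoly ℤ γ ∈ H N} |
      IsIntegral ℤ γ ∧ ∃ α : ℂ, aeval α f = 0 ∧ ℚ⟮γ⟯ = ℚ⟮α⟯} ⊆ (fun a => minpoly ℤ (algebraMap (𝓞 ℚ⟮γ⟯) ℂ a)) ''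
        {α : 𝓞 ℚ⟮γ⟯ | (Algebra.norm ℤ α).natAbs = a₀.natAbs ∧ ∀ σ : ℚ⟮γ⟯ →+* ℂ, ‖σ α‖ ≤ cA d a₀ * N} := by
      rintro f ⟨⟨h1, h2, -⟩, -, α, h3, h4⟩
      obtain ⟨a, h5, h6, h7⟩ := red_elt hd (by omega) h1 h2 h3 h4
      exact ⟨a, ⟨h6, h7⟩, h5⟩
    refine ⟨(hU.1.image _).subset hsub, ?_⟩
    refine (Nat.cast_le.2 ((Set.ncard_le_ncard hsub (hU.1.image _)).trans (Set.ncard_image_le hU.1))).trans (hU.2.trans ?_)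
    have h8 := log_bd hcA hN
    have h9 := Real.log_nonneg hX
    calc _ ≤ (d * ((1 + Real.log (cA d a₀)) * (1 + Real.log N)) + 2 * (1 + Real.log N)) ^ d * ((a₀.natAbs : ℝ) ^ d * (12 * Real.exp 1) ^ d) := by
          gcongr; linarith
      _ = _ := by rw [hA, ← mul_assoc (d:ℝ), ← add_mul, mul_pow]; ring

lemma roots_in {γ : ℂ} (hγ : IsIntegral ℤ γ) (hF : ¬ Full γ) (hd : Module.finrank ℚ ℚ⟮γ⟯ = 3) {z : ℂ}
    (hz : aeval z (minpoly ℚ γ) = 0) : z ∈ ℚ⟮γ⟯ := by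
  have hQ : IsIntegral ℚ γ := hγ.tower_top
  have : Fact (((minpoly ℚ γ).map (algebraMap ℚ ℂ)).Splits) := ⟨IsAlgClosed.splits _⟩
  have hirr := minpoly.irreducible hQ
  have hsp := nc_split γ hQ
  have h1 : Module.finrank ℚ (normalClosure ℚ ℚ⟮γ⟯ ℂ) ∣ 6 := by
    have := Subgroup.card_dvd_of_injective _ (galActionHom_injective (minpoly ℚ γ) ℂ)
    rw [card_of_separable hirr.separable, ← (IsSplittingField.algEquiv (normalClosure ℚ ℚ⟮γ⟯ ℂ) (minpoly ℚ γ)).toLinearEquiv.finrank_eq,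
      Nat.card_perm, Nat.card_eq_fintype_card, card_rootSet_eq_natDegree hirr.separable (IsAlgClosed.splits _),
      ← IntermediateField.adjoin.finrank hQ, hd] at this
    exact this
  have hmem : ∀ z : ℂ, aeval z (minpoly ℚ γ) = 0 → z ∈ normalClosure ℚ ℚ⟮γ⟯ ℂ := fun z hz => by
    rw [nc_eq γ hQ]
    exact subset_adjoin _ _ (mem_rootSet.2 ⟨hirr.ne_zero, hz⟩)
  have hle : ℚ⟮γ⟯ ≤ normalClosure ℚ ℚ⟮γ⟯ ℂ := adjoin_simple_le_iff.2 (hmem γ (minpoly.aeval ℚ γ))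
  have h2 := finrank_bot_mul_relfinrank hle
  rw [hd] at h2
  have h3 : relfinrank ℚ⟮γ⟯ (normalClosure ℚ ℚ⟮γ⟯ ℂ) ≠ 2 := by
    intro h
    rw [h] at h2
    exact hF (by unfold Full; rw [hd, ← h2]; rfl)
  have h4 : relfinrank ℚ⟮γ⟯ (normalClosure ℚ ℚ⟮γ⟯ ℂ) = 1 := by
    rw [← h2] at h1
    have : relfinrank ℚ⟮γ⟯ (normalClosure ℚ ℚ⟮γ⟯ ℂ) ∣ 2 := Nat.dvd_of_mul_dvd_mul_left (by norm_num : 0 < 3) h1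
    rcases (Nat.dvd_prime Nat.prime_two).1 this with h | h
    · exact h
    · exact absurd h h3
  exact relfinrank_eq_one_iff.1 h4 (hmem z hz)

lemma cubic_sq {γ : ℂ} (hγ : IsIntegral ℤ γ) (hM : Mini γ) (hF : ¬ Full γ) (hd : Module.finrank ℚ ℚ⟮γ⟯ = 3)
    (h0 : (minpoly ℤ γ).coeff 2 = 0) :
    ∃ y : ℤ, y ^ 2 = -4 * (minpoly ℤ γ).coeff 1 ^ 3 - 27 * (minpoly ℤ γ).coeff 0 ^ 2 := by
  set g := minpoly ℤ γ with hg
  have hmon : g.Monic := minpoly.monic hγ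
  have hdeg : g.natDegree = 3 := (minpoly_deg hγ).trans hd
  have hs := (IsAlgClosed.splits (g.map (Int.castRingHom ℂ))).eq_prod_roots_of_monic (hmon.map _)
  have hc : (g.map (Int.castRingHom ℂ)).roots.card = 3 := by
    rw [← (IsAlgClosed.splits (g.map (Int.castRingHom ℂ))).natDegree_eq_card_roots, hmon.natDegree_map, hdeg]
  obtain ⟨x, y, z, hxyz⟩ := Multiset.card_eq_three.1 hc
  have hin : ∀ w ∈ (g.map (Int.castRingHom ℂ)).roots, w ∈ ℚ⟮γ⟯ := by
    intro w hw
    apply roots_in hγ hF hd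
    rw [minpoly.isIntegrallyClosed_eq_field_fractions' ℚ hγ, aeval_map_algebraMap, aeval_def, ← eval_map]
    exact (mem_roots'.1 hw).2
  rw [hxyz] at hs hin
  have hx := hin x (by simp)
  have hy := hin y (by simp)
  have hz := hin z (by simp)
  simp only [Multiset.insert_eq_cons, Multiset.map_cons, Multiset.map_singleton, Multiset.prod_cons, Multiset.prod_singleton] at hs
  have hexp : g.map (Int.castRingHom ℂ) = X ^ 3 + C (-(x + y + z)) * X ^ 2 + C (x * y + x * z + y * z) * X + C (-(x * y * z)) := by
    rw [hs]; simp only [C_neg, C_add, C_mul]; ring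
  have key : ∀ p q r : ℂ, (X ^ 3 + C p * X ^ 2 + C q * X + C r).coeff 2 = p ∧ (X ^ 3 + C p * X ^ 2 + C q * X + C r).coeff 1 = q ∧
      (X ^ 3 + C p * X ^ 2 + C q * X + C r).coeff 0 = r := by
    intro p q r; simp [coeff_X, coeff_C]
  obtain ⟨e2, e1, e0⟩ := key (-(x + y + z)) (x * y + x * z + y * z) (-(x * y * z))
  rw [← hexp, coeff_map, eq_intCast] at e2 e1 e0
  rw [h0, Int.cast_zero] at e2
  set δ := (x - y) * (x - z) * (y - z) with hδ
  have hδ2 : δ ^ 2 = ((-4 * g.coeff 1 ^ 3 - 27 * g.coeff 0 ^ 2 : ℤ) : ℂ) := by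
    push_cast
    rw [e1, e0, hδ]
    have : z = -x - y := by linear_combination e2
    rw [this]; ring
  have hδK : δ ∈ ℚ⟮γ⟯ := mul_mem (mul_mem (sub_mem hx hy) (sub_mem hx hz)) (sub_mem hy hz)
  set n : ℤ := -4 * g.coeff 1 ^ 3 - 27 * g.coeff 0 ^ 2 with hn
  have hbot : ℚ⟮δ⟯ = ⊥ := by
    refine (hM ℚ⟮δ⟯ (adjoin_simple_le_iff.2 hδK)).resolve_right fun h => ?_
    have hroot : aeval δ (X ^ 2 - C (n : ℚ)) = 0 := by simp [hδ2]
    have hne : (X ^ 2 - C (n : ℚ)) ≠ 0 := X_pow_sub_C_ne_zero (by norm_num) _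
    have hint : IsIntegral ℚ δ := ⟨_, monic_X_pow_sub_C (n:ℚ) two_ne_zero, by rw [← aeval_def]; exact hroot⟩
    have h1 := natDegree_le_of_dvd (minpoly.dvd ℚ δ hroot) hne
    rw [natDegree_X_pow_sub_C, ← IntermediateField.adjoin.finrank hint, h, hd] at h1
    omega
  rw [adjoin_simple_eq_bot_iff, mem_bot] at hbot
  obtain ⟨q, hq⟩ := hbot
  have hq2 : q ^ 2 = (n : ℚ) := by
    rw [← hq] at hδ2
    have : ((q ^ 2 : ℚ) : ℂ) = ((n : ℚ) : ℂ) := by push_cast; exact hδ2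
    exact_mod_cast this
  have hqi : IsIntegral ℤ q := IsIntegral.of_pow (n := 2) (by norm_num) (by rw [hq2]; exact isIntegral_algebraMap (x := n))
  obtain ⟨m, rfl⟩ := IsIntegrallyClosed.isIntegral_iff.1 hqi
  exact ⟨m, by rw [eq_intCast] at hq2; exact_mod_cast hq2⟩

/-- size of a short generator -/
noncomputable def Yd (d D : ℕ) : ℝ := (D : ℝ) ^ ((1 : ℝ) / (2 * (d - 1 : ℕ)))

lemma Yd_pow {d D : ℕ} (hd : 2 ≤ d) : Yd d D ^ (2 * (d - 1)) = D := by
  unfold Yd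
  rw [← Real.rpow_natCast, ← Real.rpow_mul (Nat.cast_nonneg _)]
  have : ((d - 1 : ℕ) : ℝ) ≠ 0 := by exact_mod_cast (by omega : d - 1 ≠ 0)
  push_cast
  rw [one_div_mul_cancel (by positivity), Real.rpow_one]

lemma one_le_Yd {d D : ℕ} (hD : D ≠ 0) : 1 ≤ Yd d D :=
  Real.one_le_rpow (by exact_mod_cast Nat.one_le_iff_ne_zero.2 hD) (by positivity)

/-- candidates for minimal polynomials of short generators -/
def GS (d : ℕ) (A : ℝ) (D : ℕ) : Set ℤ[X] := {g | g.Monic ∧ g.natDegree = d ∧ g.coeff (d - 1) = 0 ∧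
  (∀ i, |(g.coeff i : ℝ)| ≤ A * Yd d D ^ (d - i)) ∧ ZD d D g}

lemma short3 (d B c : ℕ) (hd : 3 ≤ d) (hc : 0 < c) : ∃ A : ℝ, 1 ≤ A ∧ ∀ α D, IsIntegral ℤ α → Mini α → Module.finrank ℚ ℚ⟮α⟯ = d →
    FD d B c α D → ∃ γ, IsIntegral ℤ γ ∧ ℚ⟮γ⟯ = ℚ⟮α⟯ ∧ minpoly ℤ γ ∈ GS d A D := by
  have hc1 : (1:ℝ) ≤ c := by exact_mod_cast hc
  have hd1 : (3:ℝ) ≤ d := by exact_mod_cast hd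
  have h16 : (1:ℝ) ≤ 16 * d * c := by nlinarith
  refine ⟨(16 * d * c) ^ d * 2 ^ d, one_le_mul_of_one_le_of_one_le (one_le_pow₀ h16) (one_le_pow₀ (by norm_num)), ?_⟩
  intro α D hα hM hfr hFD
  have hD0 := hFD.1.1
  have hY := one_le_Yd (d := d) hD0
  have hYp := Yd_pow (d := d) (D := D) (by omega)
  let R : NNReal := ⟨4 * c * Yd d D, by positivity⟩
  have hRc : (R : ℝ) = 4 * c * Yd d D := rfl
  have hR1 : 1 ≤ R := by
    rw [← NNReal.coe_le_coe, hRc, NNReal.coe_one]; nlinarith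
  have hR : NNReal.sqrt ((c * D : ℕ) : NNReal) * 2 ^ d < R ^ (d - 1) := by
    rw [← NNReal.coe_lt_coe]
    push_cast
    rw [hRc]
    have h1 : Real.sqrt (c * D) ≤ c * Yd d D ^ (d - 1) := by
      rw [Real.sqrt_le_left (by positivity), mul_pow, ← pow_mul, mul_comm (d - 1), hYp]
      have : (c:ℝ) ≤ c ^ 2 := by nlinarith
      gcongr
    have h2 : (2:ℝ) ^ d < 4 ^ (d - 1) := by
      rw [show (4:ℝ) = 2 ^ 2 by norm_num, ← pow_mul]
      exact pow_lt_pow_right₀ (by norm_num) (by omega)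
    have h3 : (c:ℝ) ≤ c ^ (d - 1) := le_self_pow₀ hc1 (by omega)
    calc _ ≤ (c * Yd d D ^ (d - 1)) * 2 ^ d := by gcongr
      _ < (c * Yd d D ^ (d - 1)) * 4 ^ (d - 1) := by gcongr
      _ ≤ (c ^ (d - 1) * Yd d D ^ (d - 1)) * 4 ^ (d - 1) := by gcongr
      _ = _ := by rw [mul_pow, mul_pow]; ring
  obtain ⟨γ, h1, h2, h3, h4⟩ := short2 hα hM hfr (by omega) hFD.2.1 hR1 hR
  refine ⟨γ, h1, h2, minpoly.monic h1, (minpoly_deg h1).trans (by rw [h2]; exact hfr), h3, fun i => ?_, hFD.2.2 γ h1 h2⟩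
  refine (h4 i).trans ?_
  rw [hRc, show 4 * (d:ℝ) * (4 * c * Yd d D) = (16 * d * c) * Yd d D by ring, mul_pow, mul_right_comm]
  gcongr
  omega

lemma abs_count {T : ℝ} (hT : 1 ≤ T) : {m : ℤ | |(m:ℝ)| ≤ T}.Finite ∧ ({m : ℤ | |(m:ℝ)| ≤ T}.ncard : ℝ) ≤ 3 * T := by
  have h := int_interval (-T) T (by linarith)
  have : {m : ℤ | |(m:ℝ)| ≤ T} = {n : ℤ | -T ≤ n ∧ (n : ℝ) ≤ T} := by
    ext m; rw [Set.mem_ofPred_eq, Set.mem_ofPred_eq, abs_le]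
  rw [this]
  exact ⟨h.1, by linarith [h.2]⟩

/-- candidates with small discriminant -/
def HS (d : ℕ) (A : ℝ) (B N : ℕ) : Set ℤ[X] := {g | ∃ D, GoodD d B D ∧ D ≤ N ^ 2 ∧ g ∈ GS d A D}

lemma Yd_le {d D N : ℕ} (hd : 2 ≤ d) (h : D ≤ N ^ 2) : Yd d D ^ (d - 1) ≤ N := by
  have h1 := Yd_pow (D := D) hd
  have : (D:ℝ) ≤ N ^ 2 := by exact_mod_cast h
  rw [← h1, mul_comm, pow_mul] at this
  exact (sq_le_sq₀ (by unfold Yd; positivity) (Nat.cast_nonneg _)).1 this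

lemma sum_aux (n : ℕ) : 2 * ∑ i ∈ Finset.range n, (n + 1 - i) = n * (n + 3) := by
  induction n with
  | zero => rfl
  | succ n ih =>
    rw [Finset.sum_range_succ', mul_add, Finset.sum_congr rfl fun i _ => (by omega : n + 1 + 1 - (i + 1) = n + 1 - i), ih]
    simp only [tsub_zero]; ring

theorem case3_big (d B : ℕ) (hd : 6 ≤ d) (A : ℝ) (hA : 1 ≤ A) : LB (d - 2) (HS d A B) := by
  refine ⟨(3 * A) ^ (d - 1), by positivity, 0, fun N hN => ?_⟩
  have hN0 : N ^ 2 ≠ 0 := by positivity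
  set Z := Yd d (N ^ 2) with hZ
  have hZ1 : 1 ≤ Z := one_le_Yd hN0
  have hZN : Z ^ (d - 1) ≤ N := Yd_le (by omega) le_rfl
  have hpc := poly_count (R := ℤ) d (fun i => if i = d - 1 then {0} else {m : ℤ | |(m:ℝ)| ≤ A * Z ^ (d - i)})
    (fun i => if i = d - 1 then 1 else 3 * (A * Z ^ (d - i))) (by
      intro i hi
      split_ifs with h
      · simp
      · exact abs_count (one_le_mul_of_one_le_of_one_le hA (one_le_pow₀ hZ1)))
  have hsub : HS d A B N ⊆ {p : ℤ[X] | p.Monic ∧ p.natDegree = d ∧ ∀ i < d,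
      p.coeff i ∈ if i = d - 1 then ({0} : Set ℤ) else {m : ℤ | |(m:ℝ)| ≤ A * Z ^ (d - i)}} := by
    rintro g ⟨D, h1, h2, h3, h4, h5, h6, h7⟩
    refine ⟨h3, h4, fun i hi => ?_⟩
    split_ifs with h
    · rw [h]; exact h5
    · refine (h6 i).trans ?_
      have : Yd d D ≤ Z := Real.rpow_le_rpow (Nat.cast_nonneg _) (by exact_mod_cast h2) (by positivity)
      have := zero_le_one.trans (one_le_Yd (d := d) h1.1)
      gcongr
  refine ⟨hpc.1.subset hsub, (Nat.cast_le.2 (Set.ncard_le_ncard hsub hpc.1)).trans (hpc.2.trans ?_)⟩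
  obtain ⟨n, rfl⟩ : ∃ n, d = n + 1 := ⟨d - 1, by omega⟩
  rw [Finset.prod_range_succ, if_pos (by omega), mul_one, pow_zero, mul_one]
  calc _ = ∏ i ∈ Finset.range n, (3 * A) * Z ^ (n + 1 - i) := Finset.prod_congr rfl fun i hi => by
        rw [if_neg (by have := Finset.mem_range.1 hi; omega)]; ring
    _ = (3 * A) ^ n * Z ^ (∑ i ∈ Finset.range n, (n + 1 - i)) := by
        rw [Finset.prod_mul_distrib, Finset.prod_const, Finset.card_range, Finset.prod_pow_eq_pow_sum]
    _ ≤ (3 * A) ^ n * Z ^ (n * (n - 1)) := by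
        gcongr
        · have := sum_aux n
          obtain ⟨m, rfl⟩ : ∃ m, n = m + 5 := ⟨n - 5, by omega⟩
          have e : (m + 5) * (m + 5 - 1) * 2 = (m + 5) * (m + 5 + 3) + (m+5) * m := by
            rw [show m + 5 - 1 = m + 4 by omega]; ring
          have := Nat.zero_le ((m+5)*m)
          omega
    _ ≤ _ := by
        rw [Nat.add_sub_cancel] at hZN ⊢
        rw [pow_mul, show n + 1 - 2 = n - 1 by omega]
        gcongr

lemma zf_one {p d : ℕ} [Fact p.Prime] (hp : d < p) (hd : 1 ≤ d) {f : (ZMod p)[X]} (hf : f.Monic) (hfd : f.natDegree = d)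
    (h0 : f.coeff (d - 1) = 0) (h : ZF p 1 f) : f = X ^ d := by
  obtain ⟨u, h1, h2, h3⟩ := h
  have hu : u = X + C (u.coeff 0) := h1.eq_X_add_C h2
  rw [hfd] at h3
  have he : f = u ^ d := by
    apply eq_of_dvd_of_natDegree_le_of_leadingCoeff h3
    · rw [h1.natDegree_pow, h2, hfd, mul_one]
    · rw [hf.leadingCoeff, (h1.pow d).leadingCoeff]
  have hc : (d : ZMod p) * u.coeff 0 = 0 := by
    rw [← h0, he, hu, coeff_X_add_C_pow]
    simp only [coeff_add, coeff_X_zero, coeff_C_zero, zero_add]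
    rw [show d - (d - 1) = 1 by omega, pow_one, Nat.choose_symm hd, Nat.choose_one_right, mul_comm]
  have hd0 : (d : ZMod p) ≠ 0 := by
    rw [Ne, ZMod.natCast_eq_zero_iff]
    exact fun h => by have := Nat.le_of_dvd (by omega) h; omega
  rw [he, hu, (mul_eq_zero.1 hc).resolve_left hd0, C_0, add_zero]

/-- polynomials with prescribed higher coefficients, last two coefficients in few classes -/
lemma fib2 {D : ℕ} (T : Fin 2 → ℝ) (hT : ∀ i, (rd D : ℝ) ≤ T i) (K : ℕ)
    (S : (p : ℕ) → Set (Fin 2 → ZMod p)) (hS : ∀ p ∈ D.primeFactors, (S p).ncard ≤ K) (P : Set ℤ[X])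
    (hP' : ∀ f ∈ P, ∀ g ∈ P, ∀ i, 2 ≤ i → f.coeff i = g.coeff i) (hP : ∀ g ∈ P, (∀ i : Fin 2, |(g.coeff i : ℝ)| ≤ T i) ∧
      ∀ p ∈ D.primeFactors, (fun i : Fin 2 => (g.coeff i : ZMod p)) ∈ S p) :
    P.Finite ∧ (P.ncard : ℝ) ≤ 16 * T 0 * T 1 / (rd D : ℝ) ^ 2 * (K:ℝ) ^ D.primeFactors.card := by
  have hC0 : (0:ℝ) < rd D := by exact_mod_cast rd_pos D
  have hcrt := crt_box (ι := Fin 2) (rd D) (rd_sq D) (fun i => ⌊T i⌋₊) S (fun _ => K) (by rw [rd_pf]; exact hS)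
  have hmap : Set.MapsTo (fun (g : ℤ[X]) (i : Fin 2) => g.coeff i) P
      {a : Fin 2 → ℤ | (∀ i, |a i| ≤ (⌊T i⌋₊ : ℤ)) ∧ ∀ p ∈ (rd D).primeFactors, (fun i => (a i : ZMod p)) ∈ S p} := by
    intro g hgP
    obtain ⟨h2, h3⟩ := hP g hgP
    refine ⟨fun i => ?_, by rw [rd_pf]; exact h3⟩
    dsimp only
    rw [Int.abs_eq_natAbs, Nat.cast_le]
    apply Nat.le_floor
    rw [Nat.cast_natAbs, Int.cast_abs]
    exact h2 i
  have hinj : Set.InjOn (fun (g : ℤ[X]) (i : Fin 2) => g.coeff i) P := by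
    intro f hf g hg h
    ext n
    rcases Nat.lt_or_ge n 2 with h1 | h1
    · exact congrFun h ⟨n, h1⟩
    · exact hP' f hf g hg n h1
  refine ⟨Set.Finite.of_injOn hmap hinj hcrt.1, ?_⟩
  refine (Nat.cast_le.2 (Set.ncard_le_ncard_of_injOn _ hmap hinj hcrt.1)).trans (hcrt.2.trans ?_)
  rw [Finset.prod_const, Fin.prod_univ_two, rd_pf]
  have e : ∀ i, 2 * (⌊T i⌋₊ : ℝ) / rd D + 2 ≤ 4 * T i / rd D := by
    intro i
    have := Nat.floor_le (hC0.le.trans (hT i))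
    rw [div_add' _ _ _ hC0.ne']; gcongr; linarith [hT i]
  calc _ ≤ (4 * T 0 / rd D) * (4 * T 1 / rd D) * (K:ℝ) ^ D.primeFactors.card := by
        have h0 := hC0.le.trans (hT 0)
        gcongr
        · exact e 0
        · exact e 1
    _ = _ := by ring

lemma two_poly {p : ℕ} [Fact p.Prime] {k : Type} [Field k] [Algebra (ZMod p) k] (S : Set (Fin 2 → ZMod p)) (q₁ q₂ : k[X])
    (h1 : q₁ ≠ 0) (h2 : q₂ ≠ 0) (hd1 : q₁.natDegree ≤ 3) (hd2 : q₂.natDegree ≤ 3) (F₁ F₂ : k → Fin 2 → k)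
    (h : ∀ x ∈ S, ∃ r, (q₁.eval r = 0 ∧ (fun i => algebraMap (ZMod p) k (x i)) = F₁ r) ∨
      (q₂.eval r = 0 ∧ (fun i => algebraMap (ZMod p) k (x i)) = F₂ r)) : S.ncard ≤ 6 := by
  classical
  have hinj : Set.InjOn (fun (x : Fin 2 → ZMod p) i => algebraMap (ZMod p) k (x i)) S := fun x _ y _ h =>
    funext fun i => (algebraMap (ZMod p) k).injective (congrFun h i)
  have hmap : Set.MapsTo (fun (x : Fin 2 → ZMod p) i => algebraMap (ZMod p) k (x i)) S
      ((q₁.roots.toFinset.image F₁ ∪ q₂.roots.toFinset.image F₂ : Finset (Fin 2 → k)) : Set (Fin 2 → k)) := by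
    intro x hx
    rw [Finset.mem_coe, Finset.mem_union, Finset.mem_image, Finset.mem_image]
    obtain ⟨r, ⟨h3, h4⟩ | ⟨h3, h4⟩⟩ := h x hx
    · exact Or.inl ⟨r, Multiset.mem_toFinset.2 ((mem_roots h1).2 h3), h4.symm⟩
    · exact Or.inr ⟨r, Multiset.mem_toFinset.2 ((mem_roots h2).2 h3), h4.symm⟩
  have := Set.ncard_le_ncard_of_injOn _ hmap hinj (Finset.finite_toSet _)
  rw [Set.ncard_coe_finset] at this
  have e : ∀ (q : k[X]) (F : k → Fin 2 → k), q.natDegree ≤ 3 → (q.roots.toFinset.image F).card ≤ 3 := fun q F hq =>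
    Finset.card_image_le.trans ((Multiset.toFinset_card_le _).trans ((card_roots' q).trans hq))
  exact this.trans ((Finset.card_union_le _ _).trans (add_le_add (e _ _ hd1) (e _ _ hd2)))

lemma nz {p n : ℕ} (hp : 10 < p) (h0 : 0 < n) (hn : n ≤ 10) {k : Type} [Field k] [CharP k p] : (n : k) ≠ 0 := by
  rw [Ne, CharP.cast_eq_zero_iff k p]
  exact fun h => by have := Nat.le_of_dvd h0 h; omega

lemma monic_two {k : Type} [Field k] {w : k[X]} (h : w.Monic) (hd : w.natDegree = 2) :
    w = X ^ 2 + C (w.coeff 1) * X + C (w.coeff 0) := by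
  have h2 : w.coeff 2 = 1 := by rw [← hd]; exact h.coeff_natDegree
  conv_lhs => rw [w.as_sum_range_C_mul_X_pow, hd]
  simp only [Finset.sum_range_succ, Finset.sum_range_zero, h2, C_1]; ring

lemma quo {k : Type} [Field k] {F q w : k[X]} {m n : ℕ} (hF : F.Monic) (hd : F.natDegree = m + n) (hq : q.Monic) (hqd : q.natDegree = m)
    (h : F = q * w) : w.Monic ∧ w.natDegree = n := by
  rw [h] at hF hd
  have hw := hq.of_mul_monic_left hF
  rw [hq.natDegree_mul hw] at hd
  exact ⟨hw, by omega⟩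

lemma mod5 {p : ℕ} [Fact p.Prime] (hp : 10 < p) (a₂ a₃ : ZMod p) : {x : Fin 2 → ZMod p | ∃ f : (ZMod p)[X], f.Monic ∧ f.natDegree = 5 ∧
    f.coeff 4 = 0 ∧ f.coeff 3 = a₂ ∧ f.coeff 2 = a₃ ∧ (∀ i : Fin 2, f.coeff i = x i) ∧ ZF p 3 f}.ncard ≤ 6 := by
  let k := AlgebraicClosure (ZMod p)
  have : CharP k p := charP_of_injective_algebraMap (algebraMap (ZMod p) k).injective p
  have h2 : (2:k) ≠ 0 := by exact_mod_cast nz hp (n := 2) (by norm_num) (by norm_num)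
  have h5 : (5:k) ≠ 0 := by exact_mod_cast nz hp (n := 5) (by norm_num) (by norm_num)
  have h10 : (10:k) ≠ 0 := by exact_mod_cast nz hp (n := 10) (by norm_num) (by norm_num)
  set φ := algebraMap (ZMod p) k
  let q₁ : Cubic k := ⟨10, 0, 3 * φ a₂, φ a₃⟩
  let q₂ : Cubic k := ⟨5, 0, φ a₂, -φ a₃⟩
  apply two_poly (k := k) _ q₁.toPoly q₂.toPoly (Cubic.ne_zero_of_a_ne_zero h10) (Cubic.ne_zero_of_a_ne_zero h5)
    (Cubic.natDegree_of_a_ne_zero h10).le (Cubic.natDegree_of_a_ne_zero h5).le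
    (fun r => ![-r ^ 3 * (φ a₂ + 6 * r ^ 2), 3 * r ^ 2 * (φ a₂ + 6 * r ^ 2) - 3 * r ^ 4])
    (fun s => ![2 * s * ((φ a₂ + 3 * s ^ 2) / 2) ^ 2, ((φ a₂ + 3 * s ^ 2) / 2) ^ 2 - 4 * s ^ 2 * ((φ a₂ + 3 * s ^ 2) / 2)])
  rintro x ⟨f, hf, hfd, f4, f3, f2, f1, hz⟩
  have key : ∀ c₄ c₃ c₂ c₁ c₀ : k, f.map φ = X ^ 5 + C c₄ * X ^ 4 + C c₃ * X ^ 3 + C c₂ * X ^ 2 + C c₁ * X + C c₀ →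
      0 = c₄ ∧ φ a₂ = c₃ ∧ φ a₃ = c₂ ∧ φ (x 1) = c₁ ∧ φ (x 0) = c₀ := by
    intro c₄ c₃ c₂ c₁ c₀ h
    rw [← f2, ← f3, ← f1 0, ← f1 1, ← _root_.map_zero φ, ← f4, ← coeff_map, ← coeff_map, ← coeff_map, ← coeff_map, ← coeff_map, h]
    simp [coeff_X, coeff_C]
  have hFm := hf.map φ
  have hFd : (f.map φ).natDegree = 5 := by rw [hf.natDegree_map, hfd]
  obtain ⟨a, b, ⟨-, w, hw⟩ | ⟨rfl, w, hw⟩⟩ := zf_two (k := k) hf (by omega) hz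
  · obtain ⟨h3, h4⟩ := quo (m := 4) (n := 1) hFm hFd (((monic_X_sub_C a).pow 2).mul ((monic_X_sub_C b).pow 2))
      (by rw [((monic_X_sub_C a).pow 2).natDegree_mul ((monic_X_sub_C b).pow 2)]; simp) hw
    set c := w.coeff 0
    rw [h3.eq_X_add_C h4] at hw
    obtain ⟨e4, e3, e2, e1, e0⟩ := key (c - 2 * (a + b)) ((a + b) ^ 2 + 2 * (a * b) - 2 * (a + b) * c)
      (c * ((a + b) ^ 2 + 2 * (a * b)) - 2 * (a + b) * (a * b)) ((a * b) ^ 2 - 2 * (a + b) * (a * b) * c) (c * (a * b) ^ 2) (by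
        rw [hw]; simp only [C_sub, C_add, C_mul, C_pow, map_ofNat]; ring)
    have hc : c = 2 * (a + b) := by linear_combination -e4
    have hπ : (φ a₂ + 3 * (a + b) ^ 2) / 2 = a * b := by
      rw [div_eq_iff h2, e3, hc]; ring
    refine ⟨a + b, Or.inr ⟨?_, ?_⟩⟩
    · simp only [Cubic.toPoly, q₂, eval_add, eval_mul, eval_pow, eval_C, eval_X]
      rw [e3, e2, hc]; ring
    · ext i
      fin_cases i
      · simp only [Fin.zero_eta, Matrix.cons_val_zero]
        rw [hπ, e0, hc]
      · simp only [Fin.mk_one, Matrix.cons_val_one, Matrix.cons_val_zero]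
        rw [hπ, e1, hc]; ring
  · obtain ⟨h3, h4⟩ := quo (m := 3) (n := 2) hFm hFd ((monic_X_sub_C a).pow 3) (by simp) hw
    set u := w.coeff 1
    set t := w.coeff 0
    rw [monic_two h3 h4] at hw
    obtain ⟨e4, e3, e2, e1, e0⟩ := key (u - 3 * a) (t - 3 * a * u + 3 * a ^ 2) (-3 * a * t + 3 * a ^ 2 * u - a ^ 3)
      (3 * a ^ 2 * t - a ^ 3 * u) (- a ^ 3 * t) (by
        rw [hw]; simp only [C_sub, C_add, C_mul, C_pow, C_neg, map_ofNat]; ring)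
    have hc : u = 3 * a := by linear_combination -e4
    have ht : φ a₂ + 6 * a ^ 2 = t := by rw [e3, hc]; ring
    refine ⟨a, Or.inl ⟨?_, ?_⟩⟩
    · simp only [Cubic.toPoly, q₁, eval_add, eval_mul, eval_pow, eval_C, eval_X]
      rw [e3, e2, hc]; ring
    · ext i
      fin_cases i
      · simp only [Fin.zero_eta, Matrix.cons_val_zero]
        rw [ht, e0]
      · simp only [Fin.mk_one, Matrix.cons_val_one, Matrix.cons_val_zero]
        rw [ht, e1, hc]; ring

lemma mod4 {p : ℕ} [Fact p.Prime] (hp : 10 < p) (b : ZMod p) : {x : Fin 2 → ZMod p | ∃ f : (ZMod p)[X], f.Monic ∧ f.natDegree = 4 ∧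
    f.coeff 3 = 0 ∧ f.coeff 2 = b ∧ (∀ i : Fin 2, f.coeff i = x i) ∧ ZF p 2 f}.ncard ≤ 6 := by
  let k := AlgebraicClosure (ZMod p)
  have : CharP k p := charP_of_injective_algebraMap (algebraMap (ZMod p) k).injective p
  have h2 : (2:k) ≠ 0 := by exact_mod_cast nz hp (n := 2) (by norm_num) (by norm_num)
  have h6 : (6:k) ≠ 0 := by exact_mod_cast nz hp (n := 6) (by norm_num) (by norm_num)
  set φ := algebraMap (ZMod p) k
  let q₁ : Cubic k := ⟨6, 0, φ b, 0⟩
  let q₂ : Cubic k := ⟨1, 0, 0, 0⟩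
  apply two_poly (k := k) _ q₁.toPoly q₂.toPoly (Cubic.ne_zero_of_a_ne_zero h6) (Cubic.ne_zero_of_a_ne_zero one_ne_zero)
    (Cubic.natDegree_of_a_ne_zero h6).le (Cubic.natDegree_of_a_ne_zero one_ne_zero).le
    (fun r => ![-3 * r ^ 4, 8 * r ^ 3]) (fun _ => ![(φ b / 2) ^ 2, 0])
  rintro x ⟨f, hf, hfd, f3, f2, f1, hz⟩
  have key : ∀ c₃ c₂ c₁ c₀ : k, f.map φ = X ^ 4 + C c₃ * X ^ 3 + C c₂ * X ^ 2 + C c₁ * X + C c₀ →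
      0 = c₃ ∧ φ b = c₂ ∧ φ (x 1) = c₁ ∧ φ (x 0) = c₀ := by
    intro c₃ c₂ c₁ c₀ h
    rw [← f2, ← f1 0, ← f1 1, ← _root_.map_zero φ, ← f3, ← coeff_map, ← coeff_map, ← coeff_map, ← coeff_map, h]
    simp [coeff_X, coeff_C]
  have hFm := hf.map φ
  have hFd : (f.map φ).natDegree = 4 := by rw [hf.natDegree_map, hfd]
  obtain ⟨a, c, ⟨-, w, hw⟩ | ⟨rfl, w, hw⟩⟩ := zf_two (k := k) hf (by omega) hz
  · obtain ⟨h3, h4⟩ := quo (m := 4) (n := 0) hFm hFd (((monic_X_sub_C a).pow 2).mul ((monic_X_sub_C c).pow 2))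
      (by rw [((monic_X_sub_C a).pow 2).natDegree_mul ((monic_X_sub_C c).pow 2)]; simp) hw
    rw [eq_one_of_monic_natDegree_zero h3 h4] at hw
    obtain ⟨e3, e2, e1, e0⟩ := key (- 2 * (a + c)) ((a + c) ^ 2 + 2 * (a * c)) (-2 * (a + c) * (a * c)) ((a * c) ^ 2) (by
        rw [hw]; simp only [C_add, C_mul, C_pow, C_neg, map_ofNat]; ring)
    have hc : a + c = 0 := by
      have : 2 * (a + c) = 0 := by linear_combination e3
      exact (mul_eq_zero.1 this).resolve_left h2
    rw [hc] at e2 e1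
    refine ⟨0, Or.inr ⟨by simp [Cubic.toPoly, q₂], ?_⟩⟩
    ext i
    fin_cases i
    · simp only [Fin.zero_eta, Matrix.cons_val_zero]
      rw [e0, e2, zero_pow two_ne_zero, zero_add, mul_div_cancel_left₀ _ h2]
    · simp only [Fin.mk_one, Matrix.cons_val_one, Matrix.cons_val_zero]
      rw [e1]; ring
  · obtain ⟨h3, h4⟩ := quo (m := 3) (n := 1) hFm hFd ((monic_X_sub_C a).pow 3) (by simp) hw
    set u := w.coeff 0
    rw [h3.eq_X_add_C h4] at hw
    obtain ⟨e3, e2, e1, e0⟩ := key (u - 3 * a) (-3 * a * u + 3 * a ^ 2) (3 * a ^ 2 * u - a ^ 3) (- a ^ 3 * u) (by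
        rw [hw]; simp only [C_sub, C_add, C_mul, C_pow, C_neg, map_ofNat]; ring)
    have hc : u = 3 * a := by linear_combination -e3
    refine ⟨a, Or.inl ⟨?_, ?_⟩⟩
    · simp only [Cubic.toPoly, q₁, eval_add, eval_mul, eval_pow, eval_C, eval_X]
      rw [e2, hc]; ring
    · ext i
      fin_cases i
      · simp only [Fin.zero_eta, Matrix.cons_val_zero]
        rw [e0, hc]; ring
      · simp only [Fin.mk_one, Matrix.cons_val_one, Matrix.cons_val_zero]
        rw [e1, hc]; ring

lemma agree {f g : ℤ[X]} {d D D' : ℕ} {A A' : ℝ} (hf : f ∈ GS d A D) (hg : g ∈ GS d A' D') (h : ∀ i, 2 ≤ i → i < d - 1 → f.coeff i = g.coeff i)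
    (i : ℕ) (hi : 2 ≤ i) : f.coeff i = g.coeff i := by
  obtain ⟨f1, f2, f3, -⟩ := hf
  obtain ⟨g1, g2, g3, -⟩ := hg
  rcases lt_trichotomy i (d - 1) with h1 | rfl | h1
  · exact h i hi h1
  · rw [f3, g3]
  · rcases eq_or_ne i d with rfl | h2
    · have := f1.coeff_natDegree
      have := g1.coeff_natDegree
      simp_all
    · rw [coeff_eq_zero_of_natDegree_lt (by omega), coeff_eq_zero_of_natDegree_lt (by omega)]

lemma rd_leN {d B D N : ℕ} (h : GoodD d B D) (hD : D ≤ N ^ 2) : rd D ≤ N :=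
  (Nat.pow_le_pow_iff_left two_ne_zero).1 ((rd_two h).trans hD)

theorem case3_five (B : ℕ) (hB : 10 ≤ B) (A : ℝ) (hA : 1 ≤ A) : LB 3 (HS 5 A B) := by
  apply LB_sum _ 3 6 4 0 (144 * A ^ 4) (by positivity) (fun N C D => {g | g ∈ GS 5 A D ∧ GoodD 5 B D ∧ rd D = C ∧ D ≤ N ^ 2})
  · rintro N hN g ⟨D, h1, h2, h3⟩
    exact ⟨rd D, D, rd_pos D, rd_leN h1 h2, rd_sq D, rd_dvd h1, h3, h1, rfl, h2⟩
  intro N hN C D hC1 hCN hsq hdv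
  by_cases hgood : GoodD 5 B D ∧ rd D = C ∧ D ≤ N ^ 2
  swap
  · have he : {g | g ∈ GS 5 A D ∧ GoodD 5 B D ∧ rd D = C ∧ D ≤ N ^ 2} = ∅ := by
      rw [Set.eq_empty_iff_forall_notMem]; exact fun g hg => hgood hg.2
    have := one_le_log' hN
    rw [he, Set.ncard_empty, Nat.cast_zero]
    exact ⟨Set.finite_empty, by positivity⟩
  obtain ⟨hg, rfl, hDN⟩ := hgood
  set Y := Yd 5 D with hY
  have hY1 : 1 ≤ Y := one_le_Yd hg.1
  have hYN : Y ^ 4 ≤ N := Yd_le (by norm_num) hDN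
  have hY8 : Y ^ 8 = D := Yd_pow (by norm_num)
  have hC0 : (0:ℝ) < rd D := by exact_mod_cast hC1
  have hYC : Y ^ 2 ≤ rd D := by
    have h1 : (D:ℝ) ≤ (rd D:ℝ) ^ 4 := by exact_mod_cast rd_le hg
    rw [← hY8, show Y ^ 8 = (Y ^ 2) ^ 4 by ring] at h1
    exact (pow_le_pow_iff_left₀ (by positivity) hC0.le (by norm_num)).1 h1
  have hCY : (rd D : ℝ) ≤ Y ^ 4 := by
    have h1 : (rd D:ℝ) ^ 2 ≤ D := by exact_mod_cast rd_two hg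
    rw [← hY8, show Y ^ 8 = (Y ^ 4) ^ 2 by ring] at h1
    exact (sq_le_sq₀ hC0.le (by positivity)).1 h1
  have hT : ∀ n, 1 ≤ A * Y ^ n := fun n => one_le_mul_of_one_le_of_one_le hA (one_le_pow₀ hY1)
  have hI1 := abs_count (hT 2)
  have hI2 := abs_count (hT 3)
  have key := ncard_fib (S := {g | g ∈ GS 5 A D ∧ GoodD 5 B D ∧ rd D = rd D ∧ D ≤ N ^ 2}) (fun g => (g.coeff 3, g.coeff 2))
    (hI1.1.prod hI2.1) (B := 16 * (A * Y ^ 5) * (A * Y ^ 4) / (rd D : ℝ) ^ 2 * (6:ℕ) ^ D.primeFactors.card)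
    (fun g hg => ⟨hg.1.2.2.2.1 3, hg.1.2.2.2.1 2⟩) (by
    rintro ⟨a₂, a₃⟩ -
    refine fib2 ![A * Y ^ 5, A * Y ^ 4] ?_ 6 (fun p => {x : Fin 2 → ZMod p | ∃ f : (ZMod p)[X], f.Monic ∧ f.natDegree = 5 ∧
        f.coeff 4 = 0 ∧ f.coeff 3 = a₂ ∧ f.coeff 2 = a₃ ∧ (∀ i : Fin 2, f.coeff i = x i) ∧ ZF p 3 f}) (fun p hp => ?_) _ ?_ ?_
    · intro i; fin_cases i
      · refine hCY.trans ((pow_le_pow_right₀ hY1 (by norm_num : 4 ≤ 5)).trans ?_)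
        exact le_mul_of_one_le_left (by positivity) hA
      · exact hCY.trans (le_mul_of_one_le_left (by positivity) hA)
    · have : Fact p.Prime := ⟨Nat.prime_of_mem_primeFactors hp⟩
      exact mod5 (by have := (hg.2 p hp).1; omega) _ _
    · rintro f ⟨⟨h1, -⟩, h2⟩ g ⟨⟨h3, -⟩, h4⟩
      rw [← h4, Prod.mk.injEq] at h2
      refine agree h1 h3 fun i hi hi' => ?_
      obtain rfl | rfl : i = 2 ∨ i = 3 := by omega
      exacts [h2.2, h2.1]
    · rintro g ⟨⟨⟨g1, g2, g3, g4, g5⟩, -⟩, h2⟩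
      obtain ⟨h3, h4⟩ := Prod.mk.inj h2
      refine ⟨fun i => ?_, fun p hp => ?_⟩
      · fin_cases i
        exacts [g4 0, g4 1]
      · have : Fact p.Prime := ⟨Nat.prime_of_mem_primeFactors hp⟩
        refine ⟨g.map (Int.castRingHom (ZMod p)), g1.map _, by rw [g1.natDegree_map, g2], ?_, ?_, ?_, fun i => by simp, zd_two hg g5 hp⟩
        · rw [coeff_map, g3, _root_.map_zero]
        · rw [coeff_map, h3]; rfl
        · rw [coeff_map, h4]; rfl)
  refine ⟨key.1, key.2.trans ?_⟩
  rw [Set.ncard_prod, rd_pf, pow_zero, mul_one]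
  push_cast
  calc _ ≤ (3 * (A * Y ^ 2)) * (3 * (A * Y ^ 3)) * (16 * (A * Y ^ 5) * (A * Y ^ 4) / (rd D : ℝ) ^ 2 * 6 ^ D.primeFactors.card) := by
        gcongr
        exacts [hI1.2, hI2.2]
    _ = 144 * A ^ 4 * ((Y ^ 4) ^ 3 * Y ^ 2) / (rd D : ℝ) ^ 2 * 6 ^ D.primeFactors.card := by ring
    _ ≤ 144 * A ^ 4 * ((N:ℝ) ^ 3 * rd D) / (rd D : ℝ) ^ 2 * 6 ^ D.primeFactors.card := by gcongr
    _ = _ := by field_simp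

lemma mult_count {T : ℝ} {m : ℕ} (hm : 0 < m) (hT : m ≤ T) : {b : ℤ | |(b:ℝ)| ≤ T ∧ (m:ℤ) ∣ b}.Finite ∧
    ({b : ℤ | |(b:ℝ)| ≤ T ∧ (m:ℤ) ∣ b}.ncard : ℝ) ≤ 3 * (T / m) := by
  have hm0 : (0:ℝ) < m := by exact_mod_cast hm
  have h := abs_count ((one_le_div hm0).2 hT)
  have hsub : {b : ℤ | |(b:ℝ)| ≤ T ∧ (m:ℤ) ∣ b} ⊆ (fun c : ℤ => (m:ℤ) * c) '' {c : ℤ | |(c:ℝ)| ≤ T / m} := by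
    rintro b ⟨h1, c, rfl⟩
    refine ⟨c, ?_, rfl⟩
    rw [Int.cast_mul, abs_mul, Int.cast_natCast, abs_of_pos hm0] at h1
    rw [Set.mem_ofPred_eq, le_div_iff₀ hm0]; linarith
  have hf := h.1.image (fun c : ℤ => (m:ℤ) * c)
  exact ⟨hf.subset hsub, (Nat.cast_le.2 ((Set.ncard_le_ncard hsub hf).trans (Set.ncard_image_le h.1))).trans h.2⟩

lemma gs_dvd {d B D : ℕ} (hd : 2 ≤ d) (hB : d ≤ B) (hg : GoodD d B D) {g : ℤ[X]} {A : ℝ} (h : g ∈ GS d A D) {p : ℕ} (hp : p ∈ D.primeFactors)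
    (hv : D.factorization p = d - 1) {i : ℕ} (hi : i < d) : (p:ℤ) ∣ g.coeff i := by
  have : Fact p.Prime := ⟨Nat.prime_of_mem_primeFactors hp⟩
  obtain ⟨h1, h2, h3, -, h5⟩ := h
  have hz := h5 p hp
  rw [hv, show d - (d - 1) = 1 by omega] at hz
  have := zf_one (d := d) (by have := (hg.2 p hp).1; omega) (by omega) (h1.map _) (by rw [h1.natDegree_map, h2])
    (by rw [coeff_map, h3, _root_.map_zero]) hz
  have h6 := congrArg (fun q => q.coeff i) this
  simp only [coeff_map, coeff_X_pow, if_neg hi.ne, eq_intCast] at h6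
  exact (ZMod.intCast_zmod_eq_zero_iff_dvd _ _).1 h6

theorem case3_four (B : ℕ) (hB : 10 ≤ B) (A : ℝ) (hA : 1 ≤ A) : LB 2 (HS 4 A B) := by
  apply LB_sum _ 2 6 3 0 (48 * A ^ 3) (by positivity) (fun N C D => {g | g ∈ GS 4 A D ∧ GoodD 4 B D ∧ rd D = C ∧ D ≤ N ^ 2})
  · rintro N hN g ⟨D, h1, h2, h3⟩
    exact ⟨rd D, D, rd_pos D, rd_leN h1 h2, rd_sq D, rd_dvd h1, h3, h1, rfl, h2⟩
  intro N hN C D hC1 hCN hsq hdv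
  by_cases hgood : GoodD 4 B D ∧ rd D = C ∧ D ≤ N ^ 2
  swap
  · have he : {g | g ∈ GS 4 A D ∧ GoodD 4 B D ∧ rd D = C ∧ D ≤ N ^ 2} = ∅ := by
      rw [Set.eq_empty_iff_forall_notMem]; exact fun g hg => hgood hg.2
    have := one_le_log' hN
    rw [he, Set.ncard_empty, Nat.cast_zero]
    exact ⟨Set.finite_empty, by positivity⟩
  obtain ⟨hg, rfl, hDN⟩ := hgood
  set Y := Yd 4 D with hY
  have hY1 : 1 ≤ Y := one_le_Yd hg.1
  have hYN : Y ^ 3 ≤ N := Yd_le (by norm_num) hDN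
  have hY6 : Y ^ 6 = D := Yd_pow (by norm_num)
  have hC0 : (0:ℝ) < rd D := by exact_mod_cast hC1
  have hCN' : (rd D:ℝ) ≤ N := by exact_mod_cast hCN
  have hCY : (rd D : ℝ) ≤ Y ^ 3 := by
    have h1 : (rd D:ℝ) ^ 2 ≤ D := by exact_mod_cast rd_two hg
    rw [← hY6, show Y ^ 6 = (Y ^ 3) ^ 2 by ring] at h1
    exact (sq_le_sq₀ hC0.le (by positivity)).1 h1
  set s := D.primeFactors.filter (fun p => D.factorization p = 3) with hs
  set m := ∏ p ∈ s, p with hm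
  have hsp : ∀ p ∈ s, p.Prime := fun p hp => Nat.prime_of_mem_primeFactors (Finset.mem_filter.1 hp).1
  have hm0 : 0 < m := Finset.prod_pos fun p hp => (hsp p hp).pos
  have hm0' : (0:ℝ) < m := by exact_mod_cast hm0
  have hmD : D = rd D ^ 2 * m := by
    conv_lhs => rw [← Nat.prod_factorization_pow_eq_self hg.1]
    rw [hm, hs, rd, ← Finset.prod_pow, Finset.prod_filter, ← Finset.prod_mul_distrib, Finsupp.prod, Nat.support_factorization]
    refine Finset.prod_congr rfl fun p hp => ?_
    obtain ⟨-, h1, h2⟩ := hg.2 p hp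
    split_ifs with h
    · rw [h]; ring
    · rw [show D.factorization p = 2 by omega, mul_one]
  have hmr : m ≤ rd D := Nat.le_of_dvd hC1 (Finset.prod_dvd_prod_of_subset _ _ _ (Finset.filter_subset _ _))
  have hmD' : (D:ℝ) = (rd D:ℝ) ^ 2 * m := by exact_mod_cast hmD
  have hmY : (m:ℝ) ≤ Y ^ 2 := by
    have h0 : (m:ℝ) ≤ rd D := by exact_mod_cast hmr
    have h1 : (m:ℝ) ^ 3 ≤ (Y ^ 2) ^ 3 := by
      rw [← pow_mul, hY6, hmD', pow_succ]; gcongr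
    exact (pow_le_pow_iff_left₀ hm0'.le (by positivity) (by norm_num)).1 h1
  have hI := mult_count hm0 (hmY.trans (le_mul_of_one_le_left (by positivity) hA))
  have key := ncard_fib (S := {g | g ∈ GS 4 A D ∧ GoodD 4 B D ∧ rd D = rd D ∧ D ≤ N ^ 2}) (fun g => g.coeff 2)
    hI.1 (B := 16 * (A * Y ^ 4) * (A * Y ^ 3) / (rd D : ℝ) ^ 2 * (6:ℕ) ^ D.primeFactors.card)
    (fun g hgG => ⟨hgG.1.2.2.2.1 2, by
      rw [Int.natCast_dvd]
      apply Finset.prod_primes_dvd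
      · exact fun p hp => (hsp p hp).prime
      · intro p hp
        obtain ⟨hp1, hp2⟩ := Finset.mem_filter.1 hp
        exact Int.natCast_dvd.1 (gs_dvd (by norm_num) (by omega) hg hgG.1 hp1 hp2 (by norm_num))⟩) (by
    rintro b -
    refine fib2 ![A * Y ^ 4, A * Y ^ 3] ?_ 6 (fun p => {x : Fin 2 → ZMod p | ∃ f : (ZMod p)[X], f.Monic ∧ f.natDegree = 4 ∧
        f.coeff 3 = 0 ∧ f.coeff 2 = b ∧ (∀ i : Fin 2, f.coeff i = x i) ∧ ZF p 2 f}) (fun p hp => ?_) _ ?_ ?_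
    · intro i; fin_cases i
      · refine hCY.trans ((pow_le_pow_right₀ hY1 (by norm_num : 3 ≤ 4)).trans ?_)
        exact le_mul_of_one_le_left (by positivity) hA
      · exact hCY.trans (le_mul_of_one_le_left (by positivity) hA)
    · have : Fact p.Prime := ⟨Nat.prime_of_mem_primeFactors hp⟩
      exact mod4 (by have := (hg.2 p hp).1; omega) _
    · rintro f ⟨⟨h1, -⟩, h2⟩ g ⟨⟨h3, -⟩, h4⟩
      refine agree h1 h3 fun i hi hi' => ?_
      obtain rfl : i = 2 := by omega
      exact h2.trans h4.symm
    · rintro g ⟨⟨⟨g1, g2, g3, g4, g5⟩, -⟩, h3⟩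
      refine ⟨fun i => ?_, fun p hp => ?_⟩
      · fin_cases i
        exacts [g4 0, g4 1]
      · have : Fact p.Prime := ⟨Nat.prime_of_mem_primeFactors hp⟩
        refine ⟨g.map (Int.castRingHom (ZMod p)), g1.map _, by rw [g1.natDegree_map, g2], ?_, ?_, fun i => by simp, zd_two hg g5 hp⟩
        · rw [coeff_map, g3, _root_.map_zero]
        · rw [coeff_map, h3]; rfl)
  refine ⟨key.1, key.2.trans ?_⟩
  rw [rd_pf, pow_zero, mul_one]
  push_cast
  calc _ ≤ (3 * (A * Y ^ 2 / m)) * (16 * (A * Y ^ 4) * (A * Y ^ 3) / (rd D : ℝ) ^ 2 * 6 ^ D.primeFactors.card) := by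
        gcongr
        exact hI.2
    _ = 48 * A ^ 3 * (Y ^ 3 * Y ^ 6) / ((rd D : ℝ) ^ 2 * m) * 6 ^ D.primeFactors.card := by field_simp; ring
    _ = 48 * A ^ 3 * Y ^ 3 * 6 ^ D.primeFactors.card := by rw [hY6, hmD']; field_simp
    _ = 48 * A ^ 3 * (Y ^ 3 * rd D) * (6 ^ D.primeFactors.card / rd D) := by field_simp
    _ ≤ 48 * A ^ 3 * (N * N) * (6 ^ D.primeFactors.card / rd D) := by gcongr
    _ = _ := by ring

theorem case3_three (B : ℕ) (hB : 10 ≤ B) (A : ℝ) (hA : 1 ≤ A) : LB 1 (fun N => {g ∈ HS 3 A B N | Irreducible g ∧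
    ∃ y : ℤ, y ^ 2 = -4 * g.coeff 1 ^ 3 - 27 * g.coeff 0 ^ 2}) := by
  refine ⟨3 * A * (3 * A) * (3 * (2 * A ^ 2)), by positivity, 0, fun N hN => ?_⟩
  have hN1 : (1:ℝ) ≤ N := by exact_mod_cast (by omega : 1 ≤ N)
  set Q := Real.sqrt N with hQ
  have hQ1 : 1 ≤ Q := Real.one_le_sqrt.2 hN1
  have hQ2 : Q * Q = N := Real.mul_self_sqrt (by positivity)
  have hI1 := abs_count hA
  have hI2 := abs_count (one_le_mul_of_one_le_of_one_le hA hQ1)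
  have hI3 := abs_count (T := 2 * A ^ 2 * Q) (one_le_mul_of_one_le_of_one_le (by nlinarith) hQ1)
  have hI := hI1.1.prod (hI2.1.prod hI3.1)
  let Φ : ℤ × ℤ × ℤ → ℤ[X] := fun v => let c := (v.2.2 ^ 2 + 27 * v.2.1 ^ 2) / (-4 * v.1 ^ 3)
    X ^ 3 + C (c * v.1) * X + C (c * v.2.1)
  have hsub : {g ∈ HS 3 A B N | Irreducible g ∧ ∃ y : ℤ, y ^ 2 = -4 * g.coeff 1 ^ 3 - 27 * g.coeff 0 ^ 2} ⊆
      Φ '' ({m : ℤ | |(m:ℝ)| ≤ A} ×ˢ ({m : ℤ | |(m:ℝ)| ≤ A * Q} ×ˢ {m : ℤ | |(m:ℝ)| ≤ 2 * A ^ 2 * Q})) := by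
    rintro g ⟨⟨D, hg, hDN, hGS⟩, hirr, y, hy⟩
    have hv : ∀ p ∈ D.primeFactors, D.factorization p = 2 := fun p hp => by have := (hg.2 p hp).2; omega
    have hd : ∀ i < 3, ((rd D : ℕ) : ℤ) ∣ g.coeff i := fun i hi => by
      rw [Int.natCast_dvd]
      apply Finset.prod_primes_dvd
      · exact fun p hp => (Nat.prime_of_mem_primeFactors hp).prime
      · exact fun p hp => Int.natCast_dvd.1 (gs_dvd (by norm_num) (by omega) hg hGS hp (hv p hp) hi)
    have hD : D = rd D ^ 2 := by
      conv_lhs => rw [← Nat.prod_factorization_pow_eq_self hg.1]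
      rw [rd, ← Finset.prod_pow, Finsupp.prod, Nat.support_factorization]
      exact Finset.prod_congr rfl fun p hp => by rw [hv p hp]
    set c := rd D
    have hc0 : (0:ℤ) < c := by exact_mod_cast rd_pos D
    have hcN : (c:ℝ) ≤ N := by exact_mod_cast rd_leN hg hDN
    have hc0' : (0:ℝ) < c := by exact_mod_cast hc0
    obtain ⟨u, hu⟩ := hd 1 (by norm_num)
    obtain ⟨v, hv'⟩ := hd 0 (by norm_num)
    obtain ⟨h1, h2, h3, h4, -⟩ := hGS
    have hdy : (c:ℤ) ∣ y := by
      rw [← Int.pow_dvd_pow_iff two_ne_zero, hy, hu, hv']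
      exact ⟨-4 * c * u ^ 3 - 27 * v ^ 2, by ring⟩
    obtain ⟨z, rfl⟩ := hdy
    have hz : z ^ 2 + 27 * v ^ 2 = c * (-4 * u ^ 3) := by
      rw [hu, hv'] at hy
      have : (c:ℤ) ^ 2 * (z ^ 2 + 27 * v ^ 2) = c ^ 2 * (c * (-4 * u ^ 3)) := by linear_combination hy
      exact mul_left_cancel₀ (by positivity) this
    have h33 : g.coeff 3 = 1 := by rw [← h2]; exact h1.coeff_natDegree
    have hgeq : g = X ^ 3 + C (c * u) * X + C (c * v) := by
      conv_lhs => rw [g.as_sum_range_C_mul_X_pow, h2]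
      simp only [Finset.sum_range_succ, Finset.sum_range_zero, h33, C_1, hu, hv', show g.coeff 2 = 0 from h3, C_0]; ring
    have hu0 : u ≠ 0 := by
      rintro rfl
      have hv0 : v = 0 := by nlinarith [sq_nonneg z, sq_nonneg v]
      rw [hgeq, hv0] at hirr
      simp only [mul_zero, C_0, zero_mul, add_zero] at hirr
      rcases hirr.isUnit_or_isUnit (pow_succ (X : ℤ[X]) 2) with h | h
      · exact not_isUnit_X ((isUnit_pow_iff two_ne_zero).1 h)
      · exact not_isUnit_X h
    have hY4 : Yd 3 D ^ 4 = D := Yd_pow (by norm_num)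
    have hY0 : 0 ≤ Yd 3 D := by unfold Yd; positivity
    have hY2 : Yd 3 D ^ 2 = c := by
      rw [hD] at hY4
      push_cast at hY4
      rw [show Yd 3 (c ^ 2) ^ 4 = (Yd 3 (c ^ 2) ^ 2) ^ 2 by ring, ← hD] at hY4
      exact (sq_eq_sq₀ (by positivity) hc0'.le).1 hY4
    have hYQ : Yd 3 D ≤ Q := by
      apply Real.le_sqrt_of_sq_le; rw [hY2]; exact hcN
    have b1 : |(u:ℝ)| ≤ A := by
      have := h4 1
      rw [hu, Int.cast_mul, abs_mul, show 3 - 1 = 2 from rfl, hY2, Int.cast_natCast, abs_of_pos hc0', mul_comm] at this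
      exact le_of_mul_le_mul_right this hc0'
    have b2 : |(v:ℝ)| ≤ A * Q := by
      have := h4 0
      rw [hv', Int.cast_mul, abs_mul, show 3 - 0 = 2 + 1 from rfl, pow_succ, hY2, Int.cast_natCast, abs_of_pos hc0'] at this
      have h5 : |(v:ℝ)| ≤ A * Yd 3 D := by
        refine le_of_mul_le_mul_left (this.trans (le_of_eq ?_)) hc0'; ring
      exact h5.trans (by gcongr)
    have b3 : |(z:ℝ)| ≤ 2 * A ^ 2 * Q := by
      apply abs_le_of_sq_le_sq _ (by positivity)
      have hz' : (z:ℝ) ^ 2 + 27 * v ^ 2 = c * (-4 * u ^ 3) := by exact_mod_cast hz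
      have h5 : -(u:ℝ) ^ 3 ≤ A ^ 3 := by
        rw [← Odd.neg_pow (by decide)]
        refine (le_abs_self _).trans ?_
        rw [abs_pow, abs_neg]; gcongr
      have h6 : A ^ 3 ≤ A ^ 4 := pow_le_pow_right₀ hA (by norm_num)
      calc (z:ℝ) ^ 2 ≤ c * (4 * (-u ^ 3)) := by nlinarith [sq_nonneg (v:ℝ)]
        _ ≤ N * (4 * A ^ 4) := by
          have : (c:ℝ) * (4 * (-u ^ 3)) ≤ c * (4 * A ^ 4) := by gcongr; linarith
          exact this.trans (by gcongr)
        _ = _ := by rw [← hQ2]; ring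
    refine ⟨(u, v, z), ⟨b1, b2, b3⟩, ?_⟩
    simp only [Φ]
    rw [hz, Int.mul_ediv_cancel _ (by simpa using hu0), ← hgeq]
  refine ⟨(hI.image Φ).subset hsub, ?_⟩
  refine (Nat.cast_le.2 ((Set.ncard_le_ncard hsub (hI.image Φ)).trans (Set.ncard_image_le hI))).trans ?_
  rw [Set.ncard_prod, Set.ncard_prod]
  push_cast
  calc _ ≤ (3 * A) * ((3 * (A * Q)) * (3 * (2 * A ^ 2 * Q))) := by
        gcongr
        exacts [hI1.2, hI2.2, hI3.2]
    _ = _ := by rw [← hQ2]; ring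

lemma case3_all (d B : ℕ) (hd : 3 ≤ d) (hB : 10 ≤ B) (A : ℝ) (hA : 1 ≤ A) : LB (d - 2) (fun N => {g ∈ HS d A B N | d = 3 →
    Irreducible g ∧ ∃ y : ℤ, y ^ 2 = -4 * g.coeff 1 ^ 3 - 27 * g.coeff 0 ^ 2}) := by
  obtain rfl | rfl | rfl | h : d = 3 ∨ d = 4 ∨ d = 5 ∨ 6 ≤ d := by omega
  · exact (case3_three B hB A hA).mono fun N _ g hg => ⟨hg.1, hg.2 rfl⟩
  · exact (case3_four B hB A hA).mono fun N _ g hg => hg.1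
  · exact (case3_five B hB A hA).mono fun N _ g hg => hg.1
  · exact (case3_big d B h A hA).mono fun N _ g hg => hg.1

theorem main_LB (d : ℕ) (hd : 3 ≤ d) (a₀ : ℤ) (ha : a₀ ≠ 0) :
    LB (d - 2) (fun N => {f ∈ PF d a₀ N | ¬ (Irreducible f ∧ ∃ α : ℂ, aeval α f = 0 ∧ Full α)}) := by
  set B := d + a₀.natAbs + 10 with hB
  obtain ⟨c, hc, hD⟩ := exists_D d B hd (by omega)
  obtain ⟨A, hA, hS⟩ := short3 d B c hd hc
  have h1 : LB (d - 2) (fun N => {f ∈ PF d a₀ N | ∃ D, GoodD d B D ∧ ZD d D f ∧ N < rd D}) := by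
    obtain ⟨m, rfl⟩ : ∃ m, d = m + 2 := ⟨d - 2, by omega⟩
    exact case1 m (by omega) a₀ ha B (by omega) (by omega)
  have h3 := red (d := d) (a₀ := a₀) (by omega) ha (case3_all d B hd (by omega) A hA) (by
    rintro N g ⟨⟨D, -, -, h1, h2, -⟩, -⟩
    exact ⟨h1, h2.le⟩)
  refine ((((partA ha (by omega)).union (partB ha (by omega))).union h1).union ((case2 d hd a₀ ha B (by omega)).union h3)).mono ?_
  rintro N hN f ⟨hf, hbad⟩
  by_cases hirr : Irreducible f
  swap
  · exact Or.inl (Or.inl (Or.inl ⟨hf, hirr⟩))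
  obtain ⟨α, hα⟩ : ∃ α : ℂ, aeval α f = 0 := IsAlgClosed.exists_aeval_eq_zero ℂ f (by
    rw [degree_eq_natDegree hf.1.ne_zero, hf.2.1]; exact_mod_cast (by omega : d ≠ 0))
  by_cases hM : Mini α
  swap
  · exact Or.inl (Or.inl (Or.inr ⟨hf, hirr, α, hα, hM⟩))
  have hF : ¬ Full α := fun h => hbad ⟨hirr, α, hα, h⟩
  have hint : IsIntegral ℤ α := ⟨f, hf.1, by rw [← aeval_def]; exact hα⟩
  have hmin : minpoly ℤ α = f := minpoly_of_irr hf.1 hirr hα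
  have hfr : Module.finrank ℚ ℚ⟮α⟯ = d := by rw [← minpoly_deg hint, hmin, hf.2.1]
  obtain ⟨D, hFD⟩ := hD α hint hM hF hfr
  have hZ : ZD d D f := by have := hFD.2.2 α hint rfl; rwa [hmin] at this
  rcases lt_or_ge N (rd D) with h4 | h4
  · exact Or.inl (Or.inr ⟨hf, D, hFD.1, hZ, h4⟩)
  rcases lt_or_ge (N ^ 2) D with h5 | h5
  · exact Or.inr (Or.inl ⟨hf, D, hFD.1, hZ, h4, h5⟩)
  obtain ⟨γ, hγ, hγα, hG⟩ := hS α D hint hM hfr hFD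
  refine Or.inr (Or.inr ⟨hf, hirr, α, hα, γ, hγ, hγα, ⟨D, hFD.1, h5, hG⟩, ?_⟩)
  rintro rfl
  exact ⟨minpoly.irreducible hγ, cubic_sq hγ (by unfold Mini; rw [hγα]; exact hM) (full_congr hγα hF) (by rw [hγα, hfr]) hG.2.2.1⟩

end

attribute [local instance] Polynomial.Gal.splits_ℚ_ℂ

theorem galois_group_not_symmetric_fixed_constant_count (d : ℕ) (hd : 3 ≤ d)
    (a₀ : ℤ) (ha₀ : a₀ ≠ 0) :
    ∃ C : ℝ, 0 < C ∧ ∃ Ω : ℕ, 0 < Ω ∧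
      ∀ N : ℕ, 2 ≤ N →
        (Set.ncard {p : Polynomial ℤ |
            p.Monic ∧ p.natDegree = d ∧ p.coeff 0 = a₀ ∧
            (∀ i, 1 ≤ i → i ≤ d - 1 → |p.coeff i| ≤ (N : ℤ)) ∧
            ¬ (Fintype.card ((p.map (Int.castRingHom ℚ)).rootSet ℂ) = d ∧
              Function.Surjective (galActionHom (p.map (Int.castRingHom ℚ)) ℂ))} : ℝ) ≤
          C * (N : ℝ) ^ (d - 2) * Real.log N ^ Ω := by
  obtain ⟨C, hC, Ω, h⟩ := main_LB d hd a₀ ha₀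
  refine ⟨C * 3 ^ (Ω + 1), by positivity, Ω + 1, by omega, fun N hN => ?_⟩
  obtain ⟨h1, h2⟩ := h N hN
  have hlog : 1 + Real.log N ≤ 3 * Real.log N := by
    have := Real.log_two_gt_d9
    have := Real.log_le_log (by norm_num) (by exact_mod_cast hN : (2:ℝ) ≤ N)
    linarith
  have hl := one_le_log' hN
  refine (Nat.cast_le.2 (Set.ncard_le_ncard ?_ h1)).trans (h2.trans ?_)
  · rintro f ⟨f1, f2, f3, f4, f5⟩
    refine ⟨⟨f1, f2, f3, f4⟩, fun ⟨hirr, α, hα, hF⟩ => f5 ?_⟩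
    have := full_surj f f1 hirr α hα hF
    rw [f2] at this
    exact this
  · calc _ ≤ C * (N:ℝ) ^ (d - 2) * (1 + Real.log N) ^ (Ω + 1) := by
          gcongr
          omega
      _ ≤ C * (N:ℝ) ^ (d - 2) * (3 * Real.log N) ^ (Ω + 1) := by gcongr
      _ = _ := by rw [mul_pow]; ring
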